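/- Let 2 < α ≤ 3 and let u ∈ C^∞(S²) be a solution of −Δu + α = e^{2u} on S². If there exists p ∈ S² such that ∇u(p) = 0, ∇u(−p) = 0 and D²u(p) = D²u(−p), where the tangent spaces T_pS² and T_{−p}S² are identified naturally (both being the orthogonal complement of p in ℝ³), then u is axially symmetric with respect to some point; moreover if α = 3 then u is a constant function. -/

import Mathlib

open MeasureTheory Real
open scoped RealInnerProductSpace ContDiff

noncomputable section

abbrev E3 : Type := EuclideanSpace ℝ (Fin 3)

/-- The unit sphere `S²` as a subset of `ℝ³`. -/
def S2 : Set E3 := Metric.sphere 0 1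

/-- The Euclidean Laplacian of `u : ℝ³ → ℝ`.  For a `0`-homogeneous function it
coincides on `S²` with the Laplace–Beltrami operator of the round metric applied
to the restriction of `u` to `S²`. -/
def lap (u : E3 → ℝ) (x : E3) : ℝ :=
  ∑ i : Fin 3, iteratedFDeriv ℝ 2 u x ![EuclideanSpace.single i 1, EuclideanSpace.single i 1]

/-- `u : ℝ³ → ℝ` is positively homogeneous of degree `0`, i.e. it is the radial
extension of a function on `S²`. -/
def Hom0 (u : E3 → ℝ) : Prop := ∀ (x : E3) (r : ℝ), 0 < r → u (r • x) = u x

/-- `u` represents a smooth solution of the mean field equation `-Δ_{S²} u + α = e^{2u}`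
on `S²`, encoded through its degree-zero homogeneous extension to `ℝ³ \ {0}`. -/
def MFE (u : E3 → ℝ) (α : ℝ) : Prop :=
  ContDiffOn ℝ ∞ u {(0 : E3)}ᶜ ∧ Hom0 u ∧
    ∀ x ∈ S2, -lap u x + α = Real.exp (2 * u x)

/-- Reflection of `ℝ³` across the plane `{x · y = 0}`. -/
def Refl (y x : E3) : E3 := x - (2 * ⟪x, y⟫) • y

/-- The closed half-sphere `H_y`. -/
def halfSphere (y : E3) : Set E3 := {x ∈ S2 | 0 ≤ ⟪x, y⟫}

/-- The great circle `C_y`. -/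
def circleOf (y : E3) : Set E3 := {x ∈ S2 | ⟪x, y⟫ = 0}

/-- `u` is axially symmetric with respect to `p`: on the sphere it depends only on `x · p`. -/
def AxiallySymmetric (u : E3 → ℝ) (p : E3) : Prop :=
  ∀ x ∈ S2, ∀ y ∈ S2, ⟪x, p⟫ = ⟪y, p⟫ → u x = u y

/-- `p` is an umbilical critical point of `u` (viewed as a function on `S²`):
the (intrinsic) gradient vanishes and the Hessian, as a quadratic form on the
tangent plane `p^⊥`, is a multiple of the metric. -/
def UmbilicalCritical (u : E3 → ℝ) (p : E3) : Prop :=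
  fderiv ℝ u p = 0 ∧
    ∃ c : ℝ, ∀ v : E3, ⟪v, p⟫ = 0 → iteratedFDeriv ℝ 2 u p ![v, v] = c * ‖v‖ ^ 2

/-- `z` is an eigenvector of the Hessian `D²u(q)` viewed as a symmetric bilinear
form on the tangent plane `q^⊥`. -/
def HessEigen (u : E3 → ℝ) (q z : E3) : Prop :=
  ∃ lam : ℝ, ∀ v : E3, ⟪v, q⟫ = 0 → iteratedFDeriv ℝ 2 u q ![z, v] = lam * ⟪z, v⟫

/-- Cross product on `ℝ³`. -/
def cross (a b : E3) : E3 :=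
  (WithLp.equiv 2 (Fin 3 → ℝ)).symm
    (crossProduct ((WithLp.equiv 2 (Fin 3 → ℝ)) a) ((WithLp.equiv 2 (Fin 3 → ℝ)) b))

/-- `Ω` is a nodal domain of `w` on the sphere: a connected component of
`S² \ w⁻¹(0)` (in the subspace topology of `S²`). -/
def IsNodalDomain (w : E3 → ℝ) (Ω : Set E3) : Prop :=
  ∃ x ∈ S2, w x ≠ 0 ∧ Ω = connectedComponentIn {z ∈ S2 | w z ≠ 0} x

end

noncomputable section

namespace MeanField

open Filter Topology

/-! ### Infinitesimal rotations acting on functions on `ℝ³ \ {0}` -/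

/-- Smoothness away from the origin. -/
def Sm (F : E3 → ℝ) : Prop := ContDiffOn ℝ ∞ F {(0 : E3)}ᶜ

/-- The infinitesimal rotation taking `a` to `c` (for orthonormal `a`, `c`). -/
def rot (a c : E3) : E3 →L[ℝ] E3 :=
  (innerSL ℝ a).smulRight c - (innerSL ℝ c).smulRight a

/-- The derivative of `F` along the rotation field `rot a c`. -/
def K (a c : E3) (F : E3 → ℝ) (x : E3) : ℝ := fderiv ℝ F x (rot a c x)

/-- The second derivative as a bilinear form. -/
def D2 (F : E3 → ℝ) (x v v' : E3) : ℝ := fderiv ℝ (fderiv ℝ F) x v v'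

theorem rot_apply (a c x : E3) : rot a c x = ⟪a, x⟫ • c - ⟪c, x⟫ • a := by
  simp [rot]

theorem K_apply (a c : E3) (F : E3 → ℝ) (x : E3) :
    K a c F x = ⟪a, x⟫ * fderiv ℝ F x c - ⟪c, x⟫ * fderiv ℝ F x a := by
  simp [K, rot_apply]

theorem K_zero_right (a c : E3) (F : E3 → ℝ) : K a c F 0 = 0 := by simp [K]

theorem K_swap (a c : E3) (F : E3 → ℝ) : K a c F = fun x => -K c a F x := by
  ext x; simp only [K_apply]; ring

namespace Sm

theorem contDiffAt {F : E3 → ℝ} (hF : Sm F) {x : E3} (hx : x ≠ 0) : ContDiffAt ℝ ∞ F x :=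
  ContDiffOn.contDiffAt hF (isOpen_compl_singleton.mem_nhds hx)

theorem of_contDiffAt {F : E3 → ℝ} (h : ∀ x, x ≠ 0 → ContDiffAt ℝ ∞ F x) : Sm F :=
  fun x hx => (h x hx).contDiffWithinAt

theorem differentiableAt {F : E3 → ℝ} (hF : Sm F) {x : E3} (hx : x ≠ 0) :
    DifferentiableAt ℝ F x := (hF.contDiffAt hx).differentiableAt (by simp)

theorem continuousAt {F : E3 → ℝ} (hF : Sm F) {x : E3} (hx : x ≠ 0) : ContinuousAt F x :=
  (hF.differentiableAt hx).continuousAt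

theorem contDiffAt_fderiv {F : E3 → ℝ} (hF : Sm F) {x : E3} (hx : x ≠ 0) :
    ContDiffAt ℝ ∞ (fderiv ℝ F) x :=
  (hF.contDiffAt hx).fderiv_right (m := ∞) (by simp)

theorem differentiableAt_fderiv {F : E3 → ℝ} (hF : Sm F) {x : E3} (hx : x ≠ 0) :
    DifferentiableAt ℝ (fderiv ℝ F) x := (hF.contDiffAt_fderiv hx).differentiableAt (by simp)

theorem K {F : E3 → ℝ} (hF : Sm F) (a c : E3) : Sm (K a c F) :=
  of_contDiffAt fun _ hx => (hF.contDiffAt_fderiv hx).clm_apply (rot a c).contDiff.contDiffAt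

theorem add {F G : E3 → ℝ} (hF : Sm F) (hG : Sm G) : Sm (fun x => F x + G x) := ContDiffOn.add hF hG

theorem sub {F G : E3 → ℝ} (hF : Sm F) (hG : Sm G) : Sm (fun x => F x - G x) := ContDiffOn.sub hF hG

theorem mul {F G : E3 → ℝ} (hF : Sm F) (hG : Sm G) : Sm (fun x => F x * G x) := ContDiffOn.mul hF hG

theorem neg {F : E3 → ℝ} (hF : Sm F) : Sm (fun x => -F x) := ContDiffOn.neg hF

theorem pow {F : E3 → ℝ} (hF : Sm F) (n : ℕ) : Sm (fun x => F x ^ n) := ContDiffOn.pow hF n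

theorem const_mul {F : E3 → ℝ} (c : ℝ) (hF : Sm F) : Sm (fun x => c * F x) :=
  contDiffOn_const.mul hF

theorem comp {F : E3 → ℝ} (hF : Sm F) {g : ℝ → ℝ} (hg : ContDiff ℝ ∞ g) : Sm (fun x => g (F x)) :=
  hg.comp_contDiffOn hF

theorem sum {ι : Type*} {s : Finset ι} {F : ι → E3 → ℝ} (hF : ∀ i ∈ s, Sm (F i)) :
    Sm (fun x => ∑ i ∈ s, F i x) := ContDiffOn.sum hF

theorem continuousOn_S2 {F : E3 → ℝ} (hF : Sm F) : ContinuousOn F S2 :=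
  (ContDiffOn.continuousOn hF).mono fun x hx => by
    rintro rfl; simp [S2] at hx

end Sm

theorem Sm.of_contDiff {F : E3 → ℝ} (hF : ContDiff ℝ ∞ F) : Sm F := hF.contDiffOn

theorem S2.norm {x : E3} (hx : x ∈ S2) : ‖x‖ = 1 := by simpa [S2] using hx

theorem S2.ne_zero {x : E3} (hx : x ∈ S2) : x ≠ 0 := by
  rintro rfl; simp [S2] at hx

theorem S2.inner_self {x : E3} (hx : x ∈ S2) : ⟪x, x⟫ = 1 := by
  rw [real_inner_self_eq_norm_sq, S2.norm hx]; norm_num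

theorem S2.neg {x : E3} (hx : x ∈ S2) : -x ∈ S2 := by simpa [S2] using hx

theorem mem_S2_iff {x : E3} : x ∈ S2 ↔ ‖x‖ = 1 := by simp [S2]

theorem isCompact_S2 : IsCompact S2 := isCompact_sphere 0 1

/-! Derivation rules -/

theorem K_ext {F G : E3 → ℝ} {a c : E3} (h : ∀ x, x ≠ 0 → K a c F x = G x) (h0 : G 0 = 0) :
    K a c F = G := by
  ext x
  rcases eq_or_ne x 0 with rfl | hx
  · rw [K_zero_right, h0]
  · exact h x hx

theorem K_add {F G : E3 → ℝ} (hF : Sm F) (hG : Sm G) (a c : E3) :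
    K a c (fun x => F x + G x) = fun x => K a c F x + K a c G x := by
  refine K_ext (fun x hx => ?_) (by simp [K_zero_right])
  have := fderiv_fun_add (hF.differentiableAt hx) (hG.differentiableAt hx)
  simp only [K, this]; simp

theorem K_sub {F G : E3 → ℝ} (hF : Sm F) (hG : Sm G) (a c : E3) :
    K a c (fun x => F x - G x) = fun x => K a c F x - K a c G x := by
  refine K_ext (fun x hx => ?_) (by simp [K_zero_right])
  have := fderiv_fun_sub (hF.differentiableAt hx) (hG.differentiableAt hx)
  simp only [K, this]; simp

theorem K_mul {F G : E3 → ℝ} (hF : Sm F) (hG : Sm G) (a c : E3) :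
    K a c (fun x => F x * G x) = fun x => F x * K a c G x + G x * K a c F x := by
  refine K_ext (fun x hx => ?_) (by simp [K_zero_right])
  have := fderiv_fun_mul (hF.differentiableAt hx) (hG.differentiableAt hx)
  simp only [K, this]; simp

theorem K_comp {F : E3 → ℝ} (hF : Sm F) {g g' : ℝ → ℝ} (hg : ∀ t, HasDerivAt g (g' t) t)
    (a c : E3) : K a c (fun x => g (F x)) = fun x => g' (F x) * K a c F x := by
  refine K_ext (fun x hx => ?_) (by simp [K_zero_right])
  have := ((hg (F x)).comp_hasFDerivAt x (hF.differentiableAt hx).hasFDerivAt).fderiv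
  have h2 : (g ∘ F) = fun x => g (F x) := rfl
  rw [h2] at this
  simp only [K, this]; simp

theorem K_const_mul {F : E3 → ℝ} (r : ℝ) (hF : Sm F) (a c : E3) :
    K a c (fun x => r * F x) = fun x => r * K a c F x :=
  K_comp hF (g := fun t => r * t) (g' := fun _ => r)
    (fun t => by simpa using (hasDerivAt_id t).const_mul r) a c

theorem K_pow {F : E3 → ℝ} (hF : Sm F) (n : ℕ) (a c : E3) :
    K a c (fun x => F x ^ n) = fun x => n * F x ^ (n - 1) * K a c F x :=
  K_comp hF (fun t => by simpa using hasDerivAt_pow n t) a c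

theorem K_sum {ι : Type*} (s : Finset ι) {F : ι → E3 → ℝ} (hF : ∀ i ∈ s, Sm (F i)) (a c : E3) :
    K a c (fun x => ∑ i ∈ s, F i x) = fun x => ∑ i ∈ s, K a c (F i) x := by
  refine K_ext (fun x hx => ?_) (by simp [K_zero_right])
  have := fderiv_fun_sum (fun i hi => (hF i hi).differentiableAt hx)
  simp only [K, this]; simp

theorem D2_symm {F : E3 → ℝ} (hF : Sm F) {x : E3} (hx : x ≠ 0) (v v' : E3) :
    D2 F x v v' = D2 F x v' v :=
  ((hF.contDiffAt hx).isSymmSndFDerivAt (by simpa using (WithTop.coe_le_coe.2 (le_top : (2 : ℕ∞) ≤ ⊤)))) v v'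

theorem fderiv_K {F : E3 → ℝ} (hF : Sm F) {x : E3} (hx : x ≠ 0) (a c v : E3) :
    fderiv ℝ (K a c F) x v = D2 F x v (rot a c x) + fderiv ℝ F x (rot a c v) := by
  have := fderiv_clm_apply (hF.differentiableAt_fderiv hx) (rot a c).differentiableAt (x := x)
  unfold K
  rw [this]; simp [D2, add_comm]

theorem K_K {F : E3 → ℝ} (hF : Sm F) {x : E3} (hx : x ≠ 0) (a c a' c' : E3) :
    K a c (K a' c' F) x
      = D2 F x (rot a c x) (rot a' c' x) + fderiv ℝ F x (rot a' c' (rot a c x)) :=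
  fderiv_K hF hx a' c' _

theorem K_comm {F : E3 → ℝ} (hF : Sm F) (a c a' c' x : E3) :
    K a c (K a' c' F) x - K a' c' (K a c F) x
      = fderiv ℝ F x (rot a' c' (rot a c x) - rot a c (rot a' c' x)) := by
  rcases eq_or_ne x 0 with rfl | hx
  · simp [K_zero_right]
  · rw [K_K hF hx, K_K hF hx, D2_symm hF hx, map_sub]; ring

theorem D2_add_left (F : E3 → ℝ) (x v w v' : E3) : D2 F x (v + w) v' = D2 F x v v' + D2 F x w v' := by
  simp [D2]
theorem D2_add_right (F : E3 → ℝ) (x v w v' : E3) : D2 F x v' (v + w) = D2 F x v' v + D2 F x v' w := by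
  simp [D2]
theorem D2_sub_left (F : E3 → ℝ) (x v w v' : E3) : D2 F x (v - w) v' = D2 F x v v' - D2 F x w v' := by
  simp [D2]
theorem D2_sub_right (F : E3 → ℝ) (x v w v' : E3) : D2 F x v' (v - w) = D2 F x v' v - D2 F x v' w := by
  simp [D2]
theorem D2_smul_left (F : E3 → ℝ) (x v v' : E3) (r : ℝ) : D2 F x (r • v) v' = r * D2 F x v v' := by
  simp [D2]
theorem D2_smul_right (F : E3 → ℝ) (x v v' : E3) (r : ℝ) : D2 F x v' (r • v) = r * D2 F x v' v := by
  simp [D2]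

/-! ### Frames -/

/-- Orthonormal frames of `ℝ³`. -/
abbrev Frame : Type := OrthonormalBasis (Fin 3) ℝ E3

/-- The rotation derivative about the `i`-th axis of a frame. -/
def L (b : Frame) (i : Fin 3) (F : E3 → ℝ) : E3 → ℝ := K (b (i + 1)) (b (i + 2)) F

/-- The spherical Laplacian as the Casimir operator of the rotations. -/
def Lap (b : Frame) (F : E3 → ℝ) (x : E3) : ℝ := ∑ i, L b i (L b i F) x

theorem Sm.L {F : E3 → ℝ} (hF : Sm F) (b : Frame) (i : Fin 3) : Sm (L b i F) := hF.K _ _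

theorem Frame.inner_self (b : Frame) (i : Fin 3) : ⟪b i, b i⟫ = 1 := by
  rw [real_inner_self_eq_norm_sq, b.norm_eq_one]; norm_num

theorem Frame.inner_ne (b : Frame) {i j : Fin 3} (h : i ≠ j) : ⟪b i, b j⟫ = 0 :=
  b.orthonormal.2 h

theorem Frame.mem_S2 (b : Frame) (i : Fin 3) : b i ∈ S2 := by
  rw [mem_S2_iff, b.norm_eq_one]

theorem Frame.expand (b : Frame) (x : E3) :
    x = ⟪b 0, x⟫ • b 0 + ⟪b 1, x⟫ • b 1 + ⟪b 2, x⟫ • b 2 := by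
  conv_lhs => rw [← b.sum_repr' x]
  rw [Fin.sum_univ_three]

theorem Frame.inner_eq (b : Frame) (x y : E3) :
    ⟪x, y⟫ = ⟪b 0, x⟫ * ⟪b 0, y⟫ + ⟪b 1, x⟫ * ⟪b 1, y⟫ + ⟪b 2, x⟫ * ⟪b 2, y⟫ := by
  rw [← b.sum_inner_mul_inner x y, Fin.sum_univ_three]
  simp only [real_inner_comm x]

theorem Frame.inner_matrix (b : Frame) (i j : Fin 3) : ⟪b i, b j⟫ = if i = j then 1 else 0 :=
  orthonormal_iff_ite.mp b.orthonormal i j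

theorem L_comm {F : E3 → ℝ} (hF : Sm F) (b : Frame) (i : Fin 3) (x : E3) :
    L b i (L b (i + 1) F) x - L b (i + 1) (L b i F) x = -L b (i + 2) F x := by
  unfold L
  rw [K_comm hF, K, ← map_neg]
  congr 1
  fin_cases i <;>
  · simp only [rot_apply, inner_sub_right, inner_smul_right, Frame.inner_matrix]
    simp
    try abel

theorem L_add {F G : E3 → ℝ} (hF : Sm F) (hG : Sm G) (b : Frame) (i : Fin 3) :
    L b i (fun x => F x + G x) = fun x => L b i F x + L b i G x := K_add hF hG _ _

theorem L_sub {F G : E3 → ℝ} (hF : Sm F) (hG : Sm G) (b : Frame) (i : Fin 3) :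
    L b i (fun x => F x - G x) = fun x => L b i F x - L b i G x := K_sub hF hG _ _

theorem L_L_succ {F : E3 → ℝ} (hF : Sm F) (b : Frame) (i : Fin 3) :
    L b i (L b (i + 1) F) = fun x => L b (i + 1) (L b i F) x - L b (i + 2) F x := by
  ext x; linarith [L_comm hF b i x]

theorem Lap_L {F : E3 → ℝ} (hF : Sm F) (b : Frame) (i : Fin 3) (x : E3) :
    Lap b (L b i F) x = L b i (Lap b F) x := by
  have e1 : L b (i + 1) (L b i F) = fun x => L b i (L b (i + 1) F) x + L b (i + 2) F x := by
    ext x; linarith [L_comm hF b i x]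
  have e2 : L b (i + 2) (L b i F) = fun x => L b i (L b (i + 2) F) x - L b (i + 1) F x := by
    have := L_L_succ hF b (i + 2)
    rwa [show i + 2 + 1 = i by grind, show i + 2 + 2 = i + 1 by grind] at this
  have c1 := L_comm (hF.L b (i + 1)) b i x
  have c2 := L_comm (hF.L b (i + 2)) b (i + 2) x
  rw [show i + 2 + 1 = i by grind, show i + 2 + 2 = i + 1 by grind] at c2
  have hS : ∀ G : E3 → ℝ, Lap b G
      = fun x => L b i (L b i G) x + L b (i + 1) (L b (i + 1) G) x
        + L b (i + 2) (L b (i + 2) G) x := by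
    intro G; ext x; unfold Lap; rw [Fin.sum_univ_three]; fin_cases i <;> simp <;> ring
  have s := fun j => (hF.L b j).L b j
  rw [hS F, hS (L b i F), L_add ((s _).add (s _)) (s _), L_add (s _) (s _), e1, e2,
    L_add ((hF.L b _).L b _) (hF.L b _), L_sub ((hF.L b _).L b _) (hF.L b _)]
  linarith

theorem L_mul {F G : E3 → ℝ} (hF : Sm F) (hG : Sm G) (b : Frame) (i : Fin 3) :
    L b i (fun x => F x * G x) = fun x => F x * L b i G x + G x * L b i F x := K_mul hF hG _ _

theorem L_comp {F : E3 → ℝ} (hF : Sm F) {g g' : ℝ → ℝ} (hg : ∀ t, HasDerivAt g (g' t) t)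
    (b : Frame) (i : Fin 3) : L b i (fun x => g (F x)) = fun x => g' (F x) * L b i F x :=
  K_comp hF hg _ _

theorem L_pow {F : E3 → ℝ} (hF : Sm F) (n : ℕ) (b : Frame) (i : Fin 3) :
    L b i (fun x => F x ^ n) = fun x => n * F x ^ (n - 1) * L b i F x := K_pow hF n _ _

theorem L_const_mul {F : E3 → ℝ} (r : ℝ) (hF : Sm F) (b : Frame) (i : Fin 3) :
    L b i (fun x => r * F x) = fun x => r * L b i F x := K_const_mul r hF _ _

theorem Lap_add {F G : E3 → ℝ} (hF : Sm F) (hG : Sm G) (b : Frame) (x : E3) :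
    Lap b (fun x => F x + G x) x = Lap b F x + Lap b G x := by
  simp only [Lap, L_add hF hG, L_add (hF.L b _) (hG.L b _), Finset.sum_add_distrib]

theorem Lap_sub {F G : E3 → ℝ} (hF : Sm F) (hG : Sm G) (b : Frame) (x : E3) :
    Lap b (fun x => F x - G x) x = Lap b F x - Lap b G x := by
  simp only [Lap, L_sub hF hG, L_sub (hF.L b _) (hG.L b _), Finset.sum_sub_distrib]

theorem Lap_const_mul {F : E3 → ℝ} (r : ℝ) (hF : Sm F) (b : Frame) (x : E3) :
    Lap b (fun x => r * F x) x = r * Lap b F x := by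
  simp only [Lap, L_const_mul r hF, L_const_mul r (hF.L b _), Finset.mul_sum]

theorem Lap_mul {F G : E3 → ℝ} (hF : Sm F) (hG : Sm G) (b : Frame) (x : E3) :
    Lap b (fun x => F x * G x) x
      = F x * Lap b G x + G x * Lap b F x + 2 * ∑ i, L b i F x * L b i G x := by
  simp only [Lap, L_mul hF hG, L_add (hF.mul (hG.L b _)) (hG.mul (hF.L b _)),
    L_mul hF (hG.L b _), L_mul hG (hF.L b _), Fin.sum_univ_three]
  ring

theorem Lap_comp {F : E3 → ℝ} (hF : Sm F) {g g' g'' : ℝ → ℝ} (hg : ∀ t, HasDerivAt g (g' t) t)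
    (hg' : ∀ t, HasDerivAt g' (g'' t) t) (hs : ContDiff ℝ ∞ g') (b : Frame) (x : E3) :
    Lap b (fun x => g (F x)) x
      = g' (F x) * Lap b F x + g'' (F x) * ∑ i, L b i F x ^ 2 := by
  simp only [Lap, L_comp hF hg, L_mul (hF.comp hs) (hF.L b _), L_comp hF hg', Fin.sum_univ_three]
  ring

theorem Lap_sq {F : E3 → ℝ} (hF : Sm F) (b : Frame) (x : E3) :
    Lap b (fun x => F x ^ 2) x = 2 * F x * Lap b F x + 2 * ∑ i, L b i F x ^ 2 := by
  simp only [sq (F _), Lap_mul hF hF]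
  ring_nf

theorem Lap_sum {ι : Type*} (s : Finset ι) {F : ι → E3 → ℝ} (hF : ∀ i ∈ s, Sm (F i)) (b : Frame)
    (x : E3) : Lap b (fun x => ∑ i ∈ s, F i x) x = ∑ i ∈ s, Lap b (F i) x := by
  unfold Lap L
  simp only [K_sum s hF]
  simp only [K_sum s (fun i hi => (hF i hi).K _ _)]
  rw [Finset.sum_comm]

/-! ### The gradient -/

/-- The squared gradient. -/
def gradSq (F : E3 → ℝ) (x : E3) : ℝ :=
  ‖x‖ ^ 2 * ‖(InnerProductSpace.toDual ℝ E3).symm (fderiv ℝ F x)‖ ^ 2 - fderiv ℝ F x x ^ 2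

theorem gradSq_eq (b : Frame) (F : E3 → ℝ) (x : E3) : gradSq F x = ∑ i, L b i F x ^ 2 := by
  set g := (InnerProductSpace.toDual ℝ E3).symm (fderiv ℝ F x) with hg
  have h : ∀ v, fderiv ℝ F x v = ⟪g, v⟫ := fun v => by simp [hg]
  unfold gradSq L
  simp only [K_apply, h, ← hg, ← real_inner_self_eq_norm_sq, b.inner_eq x x, b.inner_eq g g,
    b.inner_eq g x, Fin.sum_univ_three]
  simp [real_inner_comm g]
  ring

theorem L_axis (b : Frame) (i : Fin 3) (F : E3 → ℝ) : L b i F (b i) = 0 := by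
  simp only [L, K_apply, Frame.inner_matrix]
  fin_cases i <;> simp

/-! ### Rotations as flows -/

/-- The rotation by angle `t` in the plane of the orthonormal pair `a`, `c`. -/
def flow (a c : E3) (t : ℝ) (x : E3) : E3 :=
  x + ((cos t - 1) * ⟪a, x⟫ - sin t * ⟪c, x⟫) • a + (sin t * ⟪a, x⟫ + (cos t - 1) * ⟪c, x⟫) • c

/-- Orthonormal pairs of vectors. -/
structure OPair (a c : E3) : Prop where
  left : ⟪a, a⟫ = 1
  right : ⟪c, c⟫ = 1
  inner : ⟪a, c⟫ = 0

theorem OPair.symm {a c : E3} (h : OPair a c) : OPair c a :=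
  ⟨h.right, h.left, by rw [real_inner_comm]; exact h.inner⟩

theorem OPair.inner' {a c : E3} (h : OPair a c) : ⟪c, a⟫ = 0 := h.symm.inner

theorem Frame.opair (b : Frame) {i j : Fin 3} (h : i ≠ j) : OPair (b i) (b j) :=
  ⟨b.inner_self i, b.inner_self j, b.inner_ne h⟩

theorem flow_zero (a c x : E3) : flow a c 0 x = x := by simp [flow]

theorem inner_left_flow {a c : E3} (h : OPair a c) (t : ℝ) (x : E3) :
    ⟪a, flow a c t x⟫ = cos t * ⟪a, x⟫ - sin t * ⟪c, x⟫ := by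
  simp only [flow, inner_add_right, inner_smul_right, h.left, h.inner]; ring

theorem inner_right_flow {a c : E3} (h : OPair a c) (t : ℝ) (x : E3) :
    ⟪c, flow a c t x⟫ = sin t * ⟪a, x⟫ + cos t * ⟪c, x⟫ := by
  simp only [flow, inner_add_right, inner_smul_right, h.right, h.inner']; ring

theorem norm_flow {a c : E3} (h : OPair a c) (t : ℝ) (x : E3) : ‖flow a c t x‖ = ‖x‖ := by
  have : ‖flow a c t x‖ ^ 2 = ‖x‖ ^ 2 := by
    rw [← real_inner_self_eq_norm_sq, ← real_inner_self_eq_norm_sq]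
    simp only [flow, inner_add_right, inner_add_left, inner_smul_right, real_inner_smul_left,
      h.left, h.inner, h.right, h.inner', real_inner_comm a x, real_inner_comm c x]
    linear_combination (⟪a, x⟫ ^ 2 + ⟪c, x⟫ ^ 2) * sin_sq_add_cos_sq t
  exact (pow_left_inj₀ (norm_nonneg _) (norm_nonneg _) two_ne_zero).1 this

theorem flow_mem_S2 {a c : E3} (h : OPair a c) (t : ℝ) {x : E3} (hx : x ∈ S2) :
    flow a c t x ∈ S2 := by rw [mem_S2_iff, norm_flow h, S2.norm hx]

theorem flow_ne_zero {a c : E3} (h : OPair a c) (t : ℝ) {x : E3} (hx : x ≠ 0) :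
    flow a c t x ≠ 0 := by rw [← norm_ne_zero_iff, norm_flow h, norm_ne_zero_iff]; exact hx

theorem hasDerivAt_flow {a c : E3} (h : OPair a c) (t : ℝ) (x : E3) :
    HasDerivAt (fun t => flow a c t x) (rot a c (flow a c t x)) t := by
  rw [rot_apply, inner_left_flow h, inner_right_flow h]
  have h1 := (((((hasDerivAt_cos t).sub_const 1).mul_const ⟪a, x⟫).sub
    ((hasDerivAt_sin t).mul_const ⟪c, x⟫)).smul_const a).const_add x
  have h2 := ((((hasDerivAt_sin t).mul_const ⟪a, x⟫).add
    (((hasDerivAt_cos t).sub_const 1).mul_const ⟪c, x⟫)).smul_const c)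
  refine (h1.add h2).congr_deriv ?_
  module

theorem continuous_flow (a c x : E3) : Continuous fun t => flow a c t x := by
  unfold flow; fun_prop

theorem hasDerivAt_comp_flow {F : E3 → ℝ} (hF : Sm F) {a c : E3} (h : OPair a c) {x : E3}
    (hx : x ≠ 0) (t : ℝ) :
    HasDerivAt (fun t => F (flow a c t x)) (K a c F (flow a c t x)) t :=
  (hF.differentiableAt (flow_ne_zero h t hx)).hasFDerivAt.comp_hasDerivAt t (hasDerivAt_flow h t x)

theorem second_deriv_nonneg {g g' : ℝ → ℝ} {c : ℝ} (hg : ∀ t, HasDerivAt g (g' t) t)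
    (hc : HasDerivAt g' c 0) (hm : IsLocalMin g 0) : g' 0 = 0 ∧ 0 ≤ c := by
  have h0 : g' 0 = 0 := hm.hasDerivAt_eq_zero (hg 0)
  refine ⟨h0, ?_⟩
  by_contra! hneg
  set f : ℝ → ℝ := fun t => -g t + c / 4 * t ^ 2 with hf
  have hf' : ∀ t, HasDerivAt f (-g' t + c / 2 * t) t := fun t =>
    ((hg t).neg.add ((hasDerivAt_pow 2 t).const_mul (c / 4))).congr_deriv (by push_cast; ring)
  have hd : deriv f = fun t => -g' t + c / 2 * t := funext fun t => (hf' t).deriv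
  have hf'' : HasDerivAt (deriv f) (-c + c / 2) 0 := by
    rw [hd]
    exact (hc.neg.add ((hasDerivAt_id 0).const_mul (c / 2))).congr_deriv (by ring)
  have hmin : IsLocalMin f 0 := isLocalMin_of_deriv_deriv_pos (by rw [hf''.deriv]; linarith)
    (by rw [(hf' 0).deriv, h0]; ring) (hf' 0).continuousAt
  have hev := (hm.and hmin).filter_mono (nhdsWithin_le_nhds (s := {0}ᶜ))
  obtain ⟨t, ⟨h1, h2⟩, ht⟩ := (hev.and self_mem_nhdsWithin).exists
  simp only [hf] at h2
  have : 0 < t ^ 2 := by have : t ≠ 0 := ht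
                         positivity
  nlinarith

theorem flow_isLocalMin {F : E3 → ℝ} {x : E3} (hx : x ∈ S2) (hm : IsLocalMinOn F S2 x)
    {a c : E3} (h : OPair a c) : IsLocalMin (fun t => F (flow a c t x)) 0 := by
  have : Tendsto (fun t => flow a c t x) (𝓝 0) (𝓝[S2] x) := by
    refine tendsto_nhdsWithin_iff.2 ⟨?_, Eventually.of_forall fun t => flow_mem_S2 h t hx⟩
    simpa [flow_zero] using (continuous_flow a c x).tendsto 0
  have := this.eventually hm
  simpa [IsLocalMin, IsMinFilter, flow_zero] using this

theorem K_min {F : E3 → ℝ} (hF : Sm F) {x : E3} (hx : x ∈ S2) (hm : IsLocalMinOn F S2 x)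
    {a c : E3} (h : OPair a c) : K a c F x = 0 ∧ 0 ≤ K a c (K a c F) x := by
  have := second_deriv_nonneg (hasDerivAt_comp_flow hF h (S2.ne_zero hx))
    (hasDerivAt_comp_flow (hF.K a c) h (S2.ne_zero hx) 0) (flow_isLocalMin hx hm h)
  simpa [flow_zero] using this

theorem Lap_min {F : E3 → ℝ} (hF : Sm F) {x : E3} (hx : x ∈ S2) (hm : IsLocalMinOn F S2 x)
    (b : Frame) : (∀ i, L b i F x = 0) ∧ 0 ≤ Lap b F x := by
  have h : ∀ i : Fin 3, OPair (b (i + 1)) (b (i + 2)) := fun i => b.opair (by grind)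
  exact ⟨fun i => (K_min hF hx hm (h i)).1,
    Finset.sum_nonneg fun i _ => (K_min hF hx hm (h i)).2⟩

/-! ### The weight vanishing on antipodal pairs -/

/-- `‖x‖² - ⟪q, x⟫²`. -/
def wt (q x : E3) : ℝ := ⟪x, x⟫ - ⟪q, x⟫ ^ 2

theorem sm_inner (q : E3) : Sm (fun x => ⟪q, x⟫) := Sm.of_contDiff (innerSL ℝ q).contDiff

theorem sm_inner_self : Sm (fun x : E3 => ⟪x, x⟫) := Sm.of_contDiff (contDiff_id.inner ℝ contDiff_id)

theorem sm_wt (q : E3) : Sm (wt q) := sm_inner_self.sub ((sm_inner q).pow 2)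

theorem K_inner (a c q : E3) :
    K a c (fun x => ⟪q, x⟫) = fun x => ⟪a, x⟫ * ⟪q, c⟫ - ⟪c, x⟫ * ⟪q, a⟫ := by
  ext x
  have : fderiv ℝ (fun x => ⟪q, x⟫) x = innerSL ℝ q := (innerSL ℝ q).fderiv
  rw [K, this, rot_apply]; simp [inner_sub_right, inner_smul_right]

theorem K_inner_self (a c : E3) : K a c (fun x => ⟪x, x⟫) = fun _ => 0 := by
  ext x
  have : fderiv ℝ (fun x : E3 => ⟪x, x⟫) x (rot a c x) = 2 * ⟪x, rot a c x⟫ := by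
    rw [fderiv_inner_apply ℝ differentiableAt_fun_id differentiableAt_fun_id]
    simp [real_inner_comm x]; ring
  rw [K, this, rot_apply]; simp [inner_sub_right, inner_smul_right, real_inner_comm x]; ring

theorem wt_nonneg {q : E3} (hq : q ∈ S2) (x : E3) : 0 ≤ wt q x := by
  have := abs_real_inner_le_norm q x
  rw [S2.norm hq, one_mul] at this
  have := sq_le_sq' (by linarith [abs_le.1 this]) (abs_le.1 this).2
  simpa [wt, real_inner_self_eq_norm_sq] using this

theorem L_wt (b : Frame) (i : Fin 3) (q : E3) :
    L b i (wt q) = fun x => -2 * ⟪q, x⟫ * L b i (fun x => ⟪q, x⟫) x := by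
  have : wt q = fun x => ⟪x, x⟫ - ⟪q, x⟫ ^ 2 := rfl
  rw [this, L_sub sm_inner_self ((sm_inner q).pow 2), L_pow (sm_inner q)]
  ext x; simp only [L, K_inner_self]; push_cast; ring

theorem sum_L_inner_sq {q : E3} (hq : q ∈ S2) (b : Frame) (x : E3) :
    ∑ i, L b i (fun x => ⟪q, x⟫) x ^ 2 = wt q x := by
  have h := S2.inner_self hq
  rw [b.inner_eq] at h
  simp only [L, K_inner, wt, b.inner_eq q x, b.inner_eq x x, Fin.sum_univ_three,
    real_inner_comm (b _) q]
  simp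
  linear_combination ((⟪b 0, x⟫^2 + ⟪b 1, x⟫^2 + ⟪b 2, x⟫^2)) * h

theorem Lap_inner (q : E3) (b : Frame) (x : E3) :
    Lap b (fun x => ⟪q, x⟫) x = -2 * ⟪q, x⟫ := by
  have h : ∀ i : Fin 3, L b i (fun x => ⟪q, x⟫)
      = fun x => ⟪⟪q, b (i + 2)⟫ • b (i + 1) - ⟪q, b (i + 1)⟫ • b (i + 2), x⟫ := by
    intro i; ext x
    simp only [L, K_inner, inner_sub_left, real_inner_smul_left]; ring
  unfold Lap
  simp only [h]
  simp only [L, K_inner]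
  simp only [inner_sub_left, real_inner_smul_left, Fin.sum_univ_three,
    Frame.inner_matrix, b.inner_eq q x, real_inner_comm (b _) q]
  simp
  ring

theorem wt_mul_Lap {q : E3} (hq : q ∈ S2) (b : Frame) (x : E3) :
    wt q x * Lap b (wt q) x = ∑ i, L b i (wt q) x ^ 2 - 2 * wt q x ^ 2 := by
  have h1 : Lap b (wt q) x = 4 * ⟪q, x⟫ ^ 2 - 2 * wt q x := by
    have h2 : Lap b (wt q) x = - Lap b (fun x => ⟪q, x⟫ ^ 2) x := by
      simp only [Lap, ← Finset.sum_neg_distrib]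
      refine Finset.sum_congr rfl fun i _ => ?_
      have e : L b i (wt q) = fun x => (-1) * L b i (fun x => ⟪q, x⟫ ^ 2) x := by
        rw [L_wt, L_pow (sm_inner q)]; ext; simp
      rw [e, L_const_mul _ (((sm_inner q).pow 2).L b i)]; simp
    rw [h2, Lap_sq (sm_inner q), Lap_inner, sum_L_inner_sq hq]; ring
  have h3 : ∑ i, L b i (wt q) x ^ 2 = 4 * ⟪q, x⟫ ^ 2 * wt q x := by
    rw [← sum_L_inner_sq hq b, Finset.mul_sum]
    refine Finset.sum_congr rfl fun i _ => ?_
    rw [L_wt]; ring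
  rw [h1, h3]; ring

/-! ### The differential inequality behind unique continuation -/

/-- The nonlinear profiles for which the comparison argument works. -/
structure Profile (f k H h g : ℝ → ℝ) : Prop where
  deriv_f : ∀ t, HasDerivAt f (2 * k t) t
  deriv_H : ∀ t, HasDerivAt H (f t) t
  smooth_f : ContDiff ℝ ∞ f
  smooth_H : ContDiff ℝ ∞ H
  cont_k : Continuous k
  one_le_k : ∀ t, 1 ≤ k t
  H_eq : ∀ t, H t = h t ^ 2
  f_eq : ∀ t, f t = h t * g t
  g_sq : ∀ t, g t ^ 2 = 2 * (k t + 1)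
  H_zero : ∀ t, H t = 0 → t = 0
  H_le : ∀ M, ∃ C, ∀ t, |t| ≤ M → H t ≤ C * t ^ 2

/-- The coupled equations satisfied by `s` and `w`. -/
structure Coupled (α : ℝ) (f k : ℝ → ℝ) (s w : E3 → ℝ) : Prop where
  sm_s : Sm s
  sm_w : Sm w
  lap_w : ∀ (b : Frame) x, x ≠ 0 → Lap b w x = -exp (s x) * f (w x)
  lap_s : ∀ (b : Frame) x, x ≠ 0 → Lap b s x = 2 * α - 2 * exp (s x) * k (w x)

theorem K_congr {F G : E3 → ℝ} (h : ∀ x, x ≠ 0 → F x = G x) (a c : E3) : K a c F = K a c G := by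
  refine K_ext (fun x hx => ?_) (K_zero_right _ _ _)
  have : F =ᶠ[𝓝 x] G := by
    filter_upwards [isOpen_compl_singleton.mem_nhds hx] with y hy using h y hy
  rw [K, K, this.fderiv_eq]

theorem bochner_bound {α η c E S f k H h g a b d x y s t P LP P0 P1 : ℝ}
    (hES : E * S = 1) (hE : 0 < E) (hS : 0 < S) (hη : 0 < η) (hη2 : η ≤ 1 / 2)
    (hk : 1 ≤ k) (hH : H = h ^ 2) (hf : f = h * g) (hg : g ^ 2 = 2 * (k + 1))
    (hηS : η * S * (k + 1) ≤ (α - 1) / 2) (hc1 : 2 * c ≤ α - 1) (hc2 : 2 * c ≤ 2 * η * S / 3)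
    (had : a + d = -S * f) (hP : P = E * (x ^ 2 + y ^ 2) + (1 + η) * H)
    (hLP : LP = E * (2 * (x * (-S * (s * f + 2 * k * x)) + y * (-S * (t * f + 2 * k * y)))
        + 2 * (a ^ 2 + 2 * b ^ 2 + d ^ 2 + (x ^ 2 + y ^ 2)))
      + (x ^ 2 + y ^ 2) * (E * (s ^ 2 + t ^ 2 - (2 * α - 2 * S * k)))
      + 2 * (-E * s * (2 * (x * a + y * b)) + -E * t * (2 * (x * b + y * d)))
      + (1 + η) * (f * (-S * f) + 2 * k * (x ^ 2 + y ^ 2)))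
    (hP0 : P0 = E * (2 * (x * a + y * b)) - E * s * (x ^ 2 + y ^ 2) + (1 + η) * f * x)
    (hP1 : P1 = E * (2 * (x * b + y * d)) - E * t * (x ^ 2 + y ^ 2) + (1 + η) * f * y) :
    0 ≤ P * LP - (P0 ^ 2 + P1 ^ 2) + (2 * (α - 1) - 2 * c) * P ^ 2 := by
  obtain rfl : d = -S * f - a := by linarith
  obtain ⟨p, hp⟩ : ∃ p, p = (a - (-S * f - a)) / 2 - (s * x - t * y) / 2 := ⟨_, rfl⟩
  obtain ⟨q, hq⟩ : ∃ q, q = b - (s * y + t * x) / 2 := ⟨_, rfl⟩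
  obtain ⟨N, hN⟩ : ∃ N, N = x ^ 2 + y ^ 2 := ⟨_, rfl⟩
  have hN0 : 0 ≤ N := by rw [hN]; positivity
  have eLP : LP = 4 * E * (p ^ 2 + q ^ 2) - 2 * (α - 1) * E * N + 2 * η * k * N - η * S * f ^ 2 := by
    rw [hLP, hp, hq, hN]
    linear_combination (S * f ^ 2 - 2 * k * (x ^ 2 + y ^ 2)) * hES
  have eP0 : P0 = 2 * E * (p * x + q * y) + η * f * x := by
    rw [hP0, hp, hq]
    linear_combination (-f * x) * hES
  have eP1 : P1 = 2 * E * (q * x - p * y) + η * f * y := by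
    rw [hP1, hp, hq]
    linear_combination (-f * y) * hES
  have hX : P = E * N + (1 + η) * h ^ 2 := by rw [hP, hN, hH]
  have hP_nonneg : 0 ≤ P := by rw [hX]; positivity
  have hmain : (1 + η) * (P * LP - (P0 ^ 2 + P1 ^ 2))
      = E * ((2 * (1 + η) * h * p - η * g * (x ^ 2 - y ^ 2)) ^ 2
        + (2 * (1 + η) * h * q - η * g * (2 * x * y)) ^ 2)
      + P * ((1 + η) * (- 2 * (α - 1) * E * N + 2 * η * k * N - η * S * f ^ 2)
        - η ^ 2 * g ^ 2 * N) := by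
    rw [eP0, eP1, eLP, hX, hf, hN]
    ring
  have hcoef : (1 + η) * (2 * c * P) ≤ (1 + η) * (- 2 * (α - 1) * E * N + 2 * η * k * N - η * S * f ^ 2)
        - η ^ 2 * g ^ 2 * N + (1 + η) * (2 * (α - 1) * P) := by
    have e1 : f ^ 2 = 2 * (k + 1) * h ^ 2 := by rw [hf, mul_pow, hg]; ring
    have e2 : N = S * (E * N) := by linear_combination (-N) * hES
    obtain ⟨X, hXd⟩ : ∃ X, X = E * N := ⟨_, rfl⟩
    have hX0 : 0 ≤ X := by rw [hXd]; positivity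
    rw [e1, hg, hX, ← hXd] 
    rw [← hXd] at e2
    rw [mul_assoc (-2 * (α - 1)), ← hXd, e2]
    have hηS0 : 0 < η * S := by positivity
    have i1 : (1 + η) * (2 * c) ≤ (1 + η) * (2 * (α - 1)) - 2 * (η * S * (k + 1)) := by
      have h1 : (1 + η) * (2 * c) ≤ (1 + η) * (α - 1) :=
        mul_le_mul_of_nonneg_left hc1 (by linarith)
      have h2 : 0 ≤ η * (α - 1) := by
        have : 0 < η * S * (k + 1) := by positivity
        exact mul_nonneg hη.le (by linarith)
      linarith
    have i2 : (1 + η) * (2 * c) ≤ 2 * (η * S) * (k - η) := by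
      have h1 : (1 + η) * (2 * c) ≤ (1 + η) * (2 * η * S / 3) :=
        mul_le_mul_of_nonneg_left hc2 (by linarith)
      have h2 : η * (η * S) ≤ 1 / 2 * (η * S) := mul_le_mul_of_nonneg_right hη2 hηS0.le
      have h3 : 1 / 2 * (η * S) ≤ (k - η) * (η * S) :=
        mul_le_mul_of_nonneg_right (by linarith) hηS0.le
      linarith
    have j1 := mul_le_mul_of_nonneg_left i1 (by positivity : 0 ≤ (1 + η) * h ^ 2)
    have j2 := mul_le_mul_of_nonneg_left i2 hX0
    linear_combination j1 + j2
  have := mul_le_mul_of_nonneg_left hcoef hP_nonneg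
  have h5 : 0 ≤ (1 + η) * (P * LP - (P0 ^ 2 + P1 ^ 2) + (2 * (α - 1) - 2 * c) * P ^ 2) := by
    have : 0 ≤ E * ((2 * (1 + η) * h * p - η * g * (x ^ 2 - y ^ 2)) ^ 2
        + (2 * (1 + η) * h * q - η * g * (2 * x * y)) ^ 2) := by positivity
    linarith
  exact nonneg_of_mul_nonneg_right h5 (by linarith)

theorem exists_frame_extending (v : Fin 3 → E3) (s : Set (Fin 3))
    (h : ∀ i ∈ s, ∀ j ∈ s, ⟪v i, v j⟫ = if i = j then 1 else 0) :
    ∃ b : Frame, ∀ i ∈ s, b i = v i := by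
  refine Orthonormal.exists_orthonormalBasis_extension_of_card_eq (by simp) ?_
  rw [orthonormal_iff_ite]
  rintro ⟨i, hi⟩ ⟨j, hj⟩
  simpa using h i hi j hj

theorem exists_frame {a c d : E3} (h1 : OPair a c) (h2 : OPair c d) (h3 : OPair d a) :
    ∃ b : Frame, b 0 = a ∧ b 1 = c ∧ b 2 = d := by
  obtain ⟨b, hb⟩ := exists_frame_extending ![a, c, d] Set.univ (by
    intro i _ j _
    fin_cases i <;> fin_cases j <;>
      simp [h1.inner, h2.inner, h3.inner, h1.inner', h2.inner', h3.inner', h1.left, h2.left,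
        h3.left, -inner_self_eq_norm_sq_to_K])
  exact ⟨b, hb 0 trivial, hb 1 trivial, hb 2 trivial⟩

theorem exists_frame_pair {a c : E3} (h : OPair a c) : ∃ b : Frame, b 0 = a ∧ b 1 = c := by
  obtain ⟨b, hb⟩ := exists_frame_extending ![a, c, 0] {0, 1} (by
    intro i hi j hj
    fin_cases i <;> fin_cases j <;>
      simp [h.inner, h.inner', h.left, h.right, -inner_self_eq_norm_sq_to_K] at hi hj ⊢)
  exact ⟨b, hb 0 (by simp), hb 1 (by simp)⟩

theorem exists_frame_last {q : E3} (hq : q ∈ S2) : ∃ b : Frame, b 2 = q := by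
  obtain ⟨b, hb⟩ := exists_frame_extending ![0, 0, q] {2} (by
    intro i hi j hj
    simp at hi hj
    subst hi hj
    simpa [-inner_self_eq_norm_sq_to_K] using S2.inner_self hq)
  exact ⟨b, hb 2 (by simp)⟩

/-- The auxiliary function of the maximum principle argument. -/
def Pfun (η : ℝ) (H : ℝ → ℝ) (s w : E3 → ℝ) (x : E3) : ℝ :=
  exp (-s x) * gradSq w x + (1 + η) * H (w x)

theorem sm_gradSq {w : E3 → ℝ} (hw : Sm w) : Sm (gradSq w) := by
  obtain ⟨b, -⟩ := exists_frame_last (q := EuclideanSpace.single 0 1) (by simp [mem_S2_iff])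
  rw [show gradSq w = fun x => ∑ i, L b i w x ^ 2 from funext (gradSq_eq b w)]
  exact Sm.sum fun i _ => (hw.L b i).pow 2

theorem sm_Pfun {η : ℝ} {H : ℝ → ℝ} {s w : E3 → ℝ} (hs : Sm s) (hw : Sm w)
    (hH : ContDiff ℝ ∞ H) : Sm (Pfun η H s w) :=
  ((hs.neg.comp contDiff_exp).mul (sm_gradSq hw)).add ((hw.comp hH).const_mul _)

theorem L_at_last {F : E3 → ℝ} (hF : Sm F) (b : Frame) :
    L b 2 F (b 2) = 0 ∧ L b 0 (L b 2 F) (b 2) = L b 1 F (b 2) ∧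
    L b 1 (L b 2 F) (b 2) = -L b 0 F (b 2) ∧ L b 1 (L b 0 F) (b 2) = L b 0 (L b 1 F) (b 2) := by
  have h0 := L_comm hF b 0 (b 2)
  have h1 := L_comm hF b 1 (b 2)
  have h2 := L_comm hF b 2 (b 2)
  have e : ∀ G, L b 2 G (b 2) = 0 := fun G => L_axis b 2 G
  simp only [show (0 : Fin 3) + 1 = 1 from rfl, show (0 : Fin 3) + 2 = 2 from rfl,
    show (1 : Fin 3) + 1 = 2 from rfl, show (1 : Fin 3) + 2 = 0 from rfl,
    show (2 : Fin 3) + 1 = 0 from rfl, show (2 : Fin 3) + 2 = 1 from rfl, e] at h0 h1 h2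
  exact ⟨e _, by linarith, by linarith, by linarith⟩

theorem bochner {α η c : ℝ} {f k H h g : ℝ → ℝ} (hpr : Profile f k H h g) {s w : E3 → ℝ}
    (hc : Coupled α f k s w) (b : Frame)
    (hη : 0 < η) (hη2 : η ≤ 1 / 2) (hηS : η * exp (s (b 2)) * (k (w (b 2)) + 1) ≤ (α - 1) / 2)
    (hc1 : 2 * c ≤ α - 1) (hc2 : 2 * c ≤ 2 * η * exp (s (b 2)) / 3) :
    0 ≤ Pfun η H s w (b 2) * Lap b (Pfun η H s w) (b 2) - ∑ i, L b i (Pfun η H s w) (b 2) ^ 2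
      + (2 * (α - 1) - 2 * c) * Pfun η H s w (b 2) ^ 2 := by
  have hs := hc.sm_s
  have hw := hc.sm_w
  set x := b 2 with hx
  have hx0 : x ≠ 0 := S2.ne_zero (b.mem_S2 2)
  have hE := hs.neg.comp contDiff_exp
  have hE' := hs.comp contDiff_exp
  have hN := sm_gradSq hw
  have hH := hw.comp hpr.smooth_H
  have hf := hw.comp hpr.smooth_f
  have smi := fun i => hw.L b i
  have smq := fun i => (hw.L b i).pow 2
  obtain ⟨a1, a2, a3, a4⟩ := L_at_last hw b
  have b1 : L b 2 s x = 0 := L_axis b 2 s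
  rw [← hx] at a1 a2 a3 a4
  have hgr : gradSq w = fun x => ∑ i, L b i w x ^ 2 := funext (gradSq_eq b w)
  have axis : ∀ G, L b 2 G x = 0 := fun G => L_axis b 2 G
  have LN : ∀ j, L b j (gradSq w) x = 2 * (L b 0 w x * L b j (L b 0 w) x
      + L b 1 w x * L b j (L b 1 w) x) := by
    intro j
    have : L b j (fun x => ∑ i, L b i w x ^ 2) x = ∑ i, L b j (fun x => L b i w x ^ 2) x :=
      congrFun (K_sum _ (fun i _ => smq i) _ _) x
    rw [hgr, this]
    simp only [L_pow (smi _), Fin.sum_univ_three, a1]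
    push_cast; ring
  have LapLw : ∀ j, Lap b (L b j w) x
      = -exp (s x) * (L b j s x * f (w x) + 2 * k (w x) * L b j w x) := by
    intro j
    rw [Lap_L hw]
    have : L b j (Lap b w) = L b j (fun x => -1 * (exp (s x) * f (w x))) :=
      K_congr (fun x hx => by rw [hc.lap_w b x hx]; ring) _ _
    rw [this, L_const_mul _ (hE'.mul hf), L_mul hE' hf, L_comp hs Real.hasDerivAt_exp,
      L_comp hw hpr.deriv_f]
    ring
  have LapN : Lap b (gradSq w) x = 2 * (L b 0 w x * Lap b (L b 0 w) x
      + L b 1 w x * Lap b (L b 1 w) x) + 2 * (L b 0 (L b 0 w) x ^ 2 + 2 * L b 0 (L b 1 w) x ^ 2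
        + L b 1 (L b 1 w) x ^ 2 + (L b 0 w x ^ 2 + L b 1 w x ^ 2)) := by
    rw [hgr, Lap_sum _ fun i _ => smq i]
    simp only [Lap_sq (smi _), Fin.sum_univ_three, a1, a2, a3, a4, axis]
    ring
  have hEd : ∀ t, HasDerivAt (fun t => exp (-t)) (-exp (-t)) t := fun t =>
    ((Real.hasDerivAt_exp _).comp t (hasDerivAt_neg t)).congr_deriv (by ring)
  have hEd' : ∀ t, HasDerivAt (fun t => -exp (-t)) (exp (-t)) t := fun t =>
    (hEd t).neg.congr_deriv (by ring)
  have LE : ∀ j, L b j (fun x => exp (-s x)) x = -exp (-s x) * L b j s x := by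
    intro j; rw [L_comp hs hEd]
  have LapE : Lap b (fun x => exp (-s x)) x = exp (-s x) * (L b 0 s x ^ 2 + L b 1 s x ^ 2
      - (2 * α - 2 * exp (s x) * k (w x))) := by
    rw [Lap_comp hs hEd hEd' (contDiff_exp.comp contDiff_neg).neg, hc.lap_s b x hx0,
      Fin.sum_univ_three, b1]
    ring
  have hP : Pfun η H s w = fun x => exp (-s x) * gradSq w x + (1 + η) * H (w x) := rfl
  have LP : ∀ j, L b j (Pfun η H s w) x = exp (-s x) * L b j (gradSq w) x
      - exp (-s x) * L b j s x * gradSq w x + (1 + η) * f (w x) * L b j w x := by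
    intro j
    rw [hP, L_add (hE.mul hN) (hH.const_mul _), L_mul hE hN, L_const_mul _ hH,
      L_comp hw hpr.deriv_H]
    simp only [LE]; ring
  have hNx : gradSq w x = L b 0 w x ^ 2 + L b 1 w x ^ 2 := by
    rw [gradSq_eq b, Fin.sum_univ_three, a1]; ring
  have LapP : Lap b (Pfun η H s w) x = exp (-s x) * Lap b (gradSq w) x
      + gradSq w x * Lap b (fun x => exp (-s x)) x
      + 2 * ∑ i, L b i (fun x => exp (-s x)) x * L b i (gradSq w) x
      + (1 + η) * (f (w x) * Lap b w x + 2 * k (w x) * gradSq w x) := by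
    rw [hP, Lap_add (hE.mul hN) (hH.const_mul _), Lap_mul hE hN, Lap_const_mul _ hH,
      Lap_comp hw hpr.deriv_H hpr.deriv_f hpr.smooth_f, ← gradSq_eq b]
  have hlap := hc.lap_w b x hx0
  rw [Fin.sum_univ_three, axis]
  have key := bochner_bound (α := α) (η := η) (c := c) (E := exp (-s x)) (S := exp (s x))
    (f := f (w x)) (k := k (w x)) (H := H (w x)) (h := h (w x)) (g := g (w x))
    (a := L b 0 (L b 0 w) x) (b := L b 0 (L b 1 w) x) (d := L b 1 (L b 1 w) x)
    (x := L b 0 w x) (y := L b 1 w x) (s := L b 0 s x) (t := L b 1 s x)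
    (P := Pfun η H s w x) (LP := Lap b (Pfun η H s w) x) (P0 := L b 0 (Pfun η H s w) x)
    (P1 := L b 1 (Pfun η H s w) x) (by rw [← exp_add]; simp) (exp_pos _) (exp_pos _) hη hη2
    (hpr.one_le_k _) (hpr.H_eq _) (hpr.f_eq _) (hpr.g_sq _) hηS hc1 hc2
    (by rw [← hlap, Lap, Fin.sum_univ_three, axis]; ring)
    (by rw [hP]; simp only [hNx])
    (by rw [LapP, LapN, LapE, Fin.sum_univ_three, axis, LapLw, LapLw, LE, LE, LN, LN, hNx, hlap, a4]
        ring)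
    (by rw [LP, LN, hNx]) (by rw [LP, LN, hNx, a4])
  linarith

theorem Lap_pow {F : E3 → ℝ} (hF : Sm F) (n : ℕ) (b : Frame) (x : E3) :
    Lap b (fun x => F x ^ (n + 2)) x = (n + 2) * F x ^ (n + 1) * Lap b F x
      + (n + 2) * (n + 1) * F x ^ n * ∑ i, L b i F x ^ 2 := by
  have h1 : ∀ t : ℝ, HasDerivAt (fun t : ℝ => t ^ (n + 2)) ((n + 2) * t ^ (n + 1)) t := fun t =>
    (hasDerivAt_pow (n + 2) t).congr_deriv (by push_cast; simp)
  have h2 : ∀ t : ℝ, HasDerivAt (fun t : ℝ => (n + 2) * t ^ (n + 1))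
      ((n + 2) * (n + 1) * t ^ n) t := fun t =>
    ((hasDerivAt_pow (n + 1) t).const_mul ((n : ℝ) + 2)).congr_deriv
      (by push_cast; simp [mul_assoc])
  exact Lap_comp hF h1 h2 (by fun_prop) b x

/-- A function satisfying a logarithmic differential inequality and dominated by a weight with
`Δ log m = -4` vanishes. -/
theorem max_principle {P m : E3 → ℝ} (hP : Sm P) (hm : Sm m) {C κ : ℝ} (hκ : κ < 4)
    (hP0 : ∀ x, 0 ≤ P x) (hm0 : ∀ x, 0 ≤ m x) (hPm : ∀ x ∈ S2, P x ≤ C * m x)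
    (hmL : ∀ (b : Frame) x, m x * Lap b m x = ∑ i, L b i m x ^ 2 - 4 * m x ^ 2)
    (hPL : ∀ b : Frame, 0 ≤ P (b 2) * Lap b P (b 2) - ∑ i, L b i P (b 2) ^ 2 + κ * P (b 2) ^ 2) :
    ∀ x ∈ S2, P x = 0 := by
  by_contra! hcon
  obtain ⟨x₁, hx₁, hne⟩ := hcon
  have hP1 : 0 < P x₁ := lt_of_le_of_ne (hP0 _) hne.symm
  have hCm : 0 < C * m x₁ := hP1.trans_le (hPm x₁ hx₁)
  have hC : 0 < C := pos_of_mul_pos_left hCm (hm0 _)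
  have hm1 : 0 < m x₁ := pos_of_mul_pos_right hCm hC.le
  obtain ⟨n, hn⟩ := exists_nat_gt (4 / (4 - κ))
  have hn' : (n + 3) * κ < 4 * (n + 2) := by
    rw [div_lt_iff₀ (by linarith)] at hn; nlinarith
  set R : E3 → ℝ := fun x => P x ^ (n + 3) / m x ^ (n + 2) with hR
  have hRle : ∀ x ∈ S2, 0 < m x → R x ≤ C ^ (n + 3) * m x := by
    intro x hx hmx
    rw [hR]; simp only
    rw [div_le_iff₀ (by positivity)]
    calc P x ^ (n + 3) ≤ (C * m x) ^ (n + 3) := pow_le_pow_left₀ (hP0 x) (hPm x hx) _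
      _ = _ := by ring
  have hv : 0 < R x₁ := by simp only [hR]; positivity
  have hmc := hm.continuousOn_S2
  have hPc := hP.continuousOn_S2
  set D := {x ∈ S2 | R x₁ ≤ C ^ (n + 3) * m x} with hD
  have hDm : ∀ x ∈ D, 0 < m x := fun x hx =>
    pos_of_mul_pos_right (hv.trans_le hx.2) (by positivity)
  have hDc : IsCompact D :=
    isCompact_S2.of_isClosed_subset
      ((continuousOn_const.mul hmc).preimage_isClosed_of_isClosed isCompact_S2.isClosed
        isClosed_Ici) (fun x hx => hx.1)
  have hx₁D : x₁ ∈ D := ⟨hx₁, hRle x₁ hx₁ hm1⟩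
  have hRc : ContinuousOn R D := by
    have hs : D ⊆ S2 := fun x hx => hx.1
    exact ((hPc.mono hs).pow _).div ((hmc.mono hs).pow _) fun x hx => (pow_pos (hDm x hx) _).ne'
  obtain ⟨x₀, hx₀, hmax⟩ := hDc.exists_isMaxOn ⟨x₁, hx₁D⟩ hRc
  have hm0' := hDm x₀ hx₀
  have hR0 : 0 < R x₀ := hv.trans_le (hmax hx₁D)
  have hP0' : 0 < P x₀ := by
    refine lt_of_le_of_ne (hP0 _) fun h => ?_
    simp only [hR, ← h] at hR0
    simp at hR0
  set Ψ : E3 → ℝ := fun x => P x₀ ^ (n + 3) * m x ^ (n + 2) - m x₀ ^ (n + 2) * P x ^ (n + 3)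
    with hΨ
  have hmin : IsLocalMinOn Ψ S2 x₀ := by
    refine eventually_nhdsWithin_of_forall fun x hx => ?_
    have h0 : Ψ x₀ = 0 := by simp only [hΨ]; ring
    rw [h0]
    rcases (hm0 x).eq_or_lt with h | h
    · have : P x = 0 := le_antisymm (by simpa [← h] using hPm x hx) (hP0 x)
      simp [hΨ, this, ← h]
    · have hle : R x ≤ R x₀ := by
        by_cases hxD : x ∈ D
        · exact hmax hxD
        · have : C ^ (n + 3) * m x < R x₁ := by
            by_contra! hh; exact hxD ⟨hx, hh⟩
          exact (hRle x hx h).trans (this.le.trans (hmax hx₁D))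
      simp only [hR] at hle
      rw [div_le_div_iff₀ (by positivity) (by positivity)] at hle
      simp only [hΨ]; linarith
  have hsΨ : Sm Ψ := ((hm.pow _).const_mul _).sub ((hP.pow _).const_mul _)
  obtain ⟨b, rfl⟩ := exists_frame_last hx₀.1
  obtain ⟨hgrad, hlap⟩ := Lap_min hsΨ hx₀.1 hmin b
  set x := b 2
  rw [hΨ, Lap_sub ((hm.pow _).const_mul _) ((hP.pow _).const_mul _), Lap_const_mul _ (hm.pow _),
    Lap_const_mul _ (hP.pow _), Lap_pow hm, Lap_pow hP (n + 1)] at hlap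
  have hg : ∀ i, (n + 2) * (P x * L b i m x) = (n + 3) * (m x * L b i P x) := by
    intro i
    have := hgrad i
    rw [hΨ, L_sub ((hm.pow _).const_mul _) ((hP.pow _).const_mul _), L_const_mul _ (hm.pow _),
      L_const_mul _ (hP.pow _), L_pow hm, L_pow hP] at this
    have hpos : P x ^ (n + 2) * m x ^ (n + 1) ≠ 0 := by positivity
    apply mul_left_cancel₀ hpos
    push_cast at this
    linear_combination this
  have hsq : (n + 2) ^ 2 * (P x ^ 2 * ∑ i, L b i m x ^ 2)
      = (n + 3) ^ 2 * (m x ^ 2 * ∑ i, L b i P x ^ 2) := by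
    simp only [Finset.mul_sum]
    refine Finset.sum_congr rfl fun i _ => ?_
    linear_combination ((n + 2) * (P x * L b i m x) + (n + 3) * (m x * L b i P x)) * hg i
  have hml := hmL b x
  have hpl := hPL b
  obtain ⟨A, hA⟩ : ∃ A, A = ∑ i, L b i m x ^ 2 := ⟨_, rfl⟩
  obtain ⟨B, hB⟩ : ∃ B, B = ∑ i, L b i P x ^ 2 := ⟨_, rfl⟩
  rw [← hA] at hml hsq hlap
  rw [← hB] at hpl hsq hlap
  have hfac : 0 ≤ (P x ^ (n + 1) * m x ^ n) * (m x ^ 2 *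
      ((n + 3) * (B - P x * Lap b P x) - 4 * (n + 2) * P x ^ 2)) := by
    refine hlap.trans_eq ?_
    push_cast
    linear_combination (P x ^ (n + 1) * m x ^ n) * (P x ^ 2 * (n + 2) * hml + hsq)
  have h1 := nonneg_of_mul_nonneg_right hfac (by positivity)
  have h2 := nonneg_of_mul_nonneg_right h1 (by positivity)
  have h3 : 0 < P x ^ 2 := by positivity
  have h4 : (0 : ℝ) < n + 3 := by positivity
  nlinarith [mul_nonneg h4.le hpl, mul_lt_mul_of_pos_right hn' h3]

theorem wt_mul_log {q₁ q₂ : E3} (h₁ : q₁ ∈ S2) (h₂ : q₂ ∈ S2) (b : Frame) (x : E3) :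
    (wt q₁ x * wt q₂ x) * Lap b (fun x => wt q₁ x * wt q₂ x) x
      = ∑ i, L b i (fun x => wt q₁ x * wt q₂ x) x ^ 2 - 4 * (wt q₁ x * wt q₂ x) ^ 2 := by
  have e1 := wt_mul_Lap h₁ b x
  have e2 := wt_mul_Lap h₂ b x
  rw [Lap_mul (sm_wt _) (sm_wt _)]
  simp only [L_mul (sm_wt q₁) (sm_wt q₂), Fin.sum_univ_three] at e1 e2 ⊢
  linear_combination wt q₂ x ^ 2 * e1 + wt q₁ x ^ 2 * e2

theorem gradSq_nonneg (w : E3 → ℝ) (x : E3) : 0 ≤ gradSq w x := by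
  obtain ⟨b, -⟩ := exists_frame_last (q := EuclideanSpace.single 0 1) (by simp [mem_S2_iff])
  rw [gradSq_eq b]; positivity

theorem eq_zero_of_vanishing {α : ℝ} (h1 : 1 < α) (h3 : α ≤ 3) {f k H h g : ℝ → ℝ}
    (hpr : Profile f k H h g) {s w : E3 → ℝ} (hc : Coupled α f k s w) {q₁ q₂ : E3}
    (hq₁ : q₁ ∈ S2) (hq₂ : q₂ ∈ S2) {C : ℝ} (hw : ∀ x ∈ S2, w x ^ 2 ≤ C * (wt q₁ x * wt q₂ x))
    (hg : ∀ x ∈ S2, gradSq w x ≤ C * (wt q₁ x * wt q₂ x)) : ∀ x ∈ S2, w x = 0 := by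
  have ne : S2.Nonempty := ⟨q₁, hq₁⟩
  have cw := hc.sm_w.continuousOn_S2
  have cs := hc.sm_s.continuousOn_S2
  obtain ⟨y₁, -, hy₁⟩ := isCompact_S2.exists_isMaxOn ne (continuous_abs.comp_continuousOn cw)
  obtain ⟨y₂, -, hy₂⟩ := isCompact_S2.exists_isMaxOn ne
    ((continuous_exp.comp_continuousOn cs).mul
      ((hpr.cont_k.comp_continuousOn cw).add (continuousOn_const (c := (1 : ℝ)))))
  obtain ⟨y₃, -, hy₃⟩ := isCompact_S2.exists_isMinOn ne (continuous_exp.comp_continuousOn cs)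
  obtain ⟨C', hC'⟩ := hpr.H_le |w y₁|
  obtain ⟨B, hB⟩ : ∃ B, B = exp (s y₂) * (k (w y₂) + 1) := ⟨_, rfl⟩
  have hB' : ∀ x ∈ S2, exp (s x) * (k (w x) + 1) ≤ B := fun x hx => by rw [hB]; exact hy₂ hx
  have hBp : 0 < B := by
    rw [hB]; have := hpr.one_le_k (w y₂); positivity
  obtain ⟨e, he⟩ : ∃ e, e = exp (s y₃) := ⟨_, rfl⟩
  have hep : 0 < e := by rw [he]; positivity
  have he' : ∀ x ∈ S2, e ≤ exp (s x) := fun x hx => by rw [he]; exact hy₃ hx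
  set η := min (1 / 2) ((α - 1) / (2 * B))
  have hη : 0 < η := lt_min (by norm_num) (div_pos (by linarith) (by linarith))
  set c := min ((α - 1) / 2) (η * e / 3)
  have hcp : 0 < c := lt_min (by linarith) (by positivity)
  have hmp := max_principle (sm_Pfun (η := η) hc.sm_s hc.sm_w hpr.smooth_H)
    ((sm_wt q₁).mul (sm_wt q₂)) (C := C / e + (1 + η) * (|C'| * C)) (κ := 2 * (α - 1) - 2 * c)
    (by linarith) ?_ (fun x => mul_nonneg (wt_nonneg hq₁ x) (wt_nonneg hq₂ x)) ?_
    (wt_mul_log hq₁ hq₂) ?_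
  · intro x hx
    have := hmp x hx
    rw [Pfun] at this
    have h4 : 0 ≤ exp (-s x) * gradSq w x := mul_nonneg (exp_pos _).le (gradSq_nonneg _ _)
    have h5 : 0 ≤ H (w x) := by rw [hpr.H_eq]; positivity
    exact hpr.H_zero _ (by nlinarith)
  · intro x
    have h4 : 0 ≤ exp (-s x) * gradSq w x := mul_nonneg (exp_pos _).le (gradSq_nonneg _ _)
    have h5 : 0 ≤ H (w x) := by rw [hpr.H_eq]; positivity
    rw [Pfun]; positivity
  · intro x hx
    have i1 : exp (-s x) ≤ 1 / e := by
      rw [exp_neg, ← one_div]; exact one_div_le_one_div_of_le hep (he' x hx)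
    have i2 : exp (-s x) * gradSq w x ≤ 1 / e * (C * (wt q₁ x * wt q₂ x)) :=
      mul_le_mul i1 (hg x hx) (gradSq_nonneg _ _) (by positivity)
    have i3 : H (w x) ≤ |C'| * (C * (wt q₁ x * wt q₂ x)) :=
      (hC' _ (hy₁ hx)).trans ((mul_le_mul_of_nonneg_right (le_abs_self _) (sq_nonneg _)).trans
        (mul_le_mul_of_nonneg_left (hw x hx) (abs_nonneg _)))
    have i4 := mul_le_mul_of_nonneg_left i3 (by linarith : 0 ≤ 1 + η)
    rw [Pfun]
    calc _ ≤ _ := add_le_add i2 i4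
      _ = _ := by ring
  · intro b
    have hb := b.mem_S2 2
    refine bochner hpr hc b hη (min_le_left _ _) ?_ ?_ ?_
    · have : η ≤ (α - 1) / (2 * B) := min_le_right _ _
      rw [le_div_iff₀ (by positivity)] at this
      have := mul_le_mul_of_nonneg_left (hB' _ hb) hη.le
      linarith
    · have : c ≤ (α - 1) / 2 := min_le_left _ _
      linarith
    · have : c ≤ η * e / 3 := min_le_right _ _
      have := mul_le_mul_of_nonneg_left (he' _ hb) hη.le
      linarith

/-! ### Bounds by the weights -/

theorem exists_bound_of_local {A m : E3 → ℝ} (hm : ∀ x, 0 ≤ m x)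
    (h : ∀ x₀ ∈ S2, ∃ C, ∀ᶠ x in 𝓝[S2] x₀, A x ≤ C * m x) :
    ∃ C, 0 ≤ C ∧ ∀ x ∈ S2, A x ≤ C * m x := by
  refine isCompact_S2.induction_on (p := fun s => ∃ C, 0 ≤ C ∧ ∀ x ∈ s, A x ≤ C * m x)
    ⟨0, le_rfl, by simp⟩ (fun s t hst ⟨C, hC, h⟩ => ⟨C, hC, fun x hx => h x (hst hx)⟩) ?_ ?_
  · rintro s t ⟨C, hC, h⟩ ⟨C', hC', h'⟩
    refine ⟨C + C', by positivity, ?_⟩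
    rintro x (hx | hx)
    · have := h x hx; have := mul_nonneg hC' (hm x); linarith
    · have := h' x hx; have := mul_nonneg hC (hm x); linarith
  · intro x hx
    obtain ⟨C, hC⟩ := h x hx
    refine ⟨_, hC, |C|, abs_nonneg C, fun y hy => ?_⟩
    exact (show A y ≤ C * m y from hy).trans
      (mul_le_mul_of_nonneg_right (le_abs_self C) (hm y))

theorem local_bound_of_pos {A m : E3 → ℝ} {x₀ : E3} (hA : ContinuousWithinAt A S2 x₀)
    (hm : ContinuousWithinAt m S2 x₀) (h : 0 < m x₀) :
    ∃ C, ∀ᶠ x in 𝓝[S2] x₀, A x ≤ C * m x := by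
  refine ⟨(|A x₀| + 1) * (2 / m x₀), ?_⟩
  filter_upwards [hA.eventually (gt_mem_nhds (lt_add_one _)),
    hm.eventually (lt_mem_nhds (half_lt_self h))] with x h1 h2
  have : 1 ≤ 2 / m x₀ * m x := by
    rw [div_mul_eq_mul_div, le_div_iff₀ h]; linarith
  have := mul_le_mul_of_nonneg_left this (by positivity : 0 ≤ |A x₀| + 1)
  linarith [le_abs_self (A x₀)]

theorem wt_neg (q : E3) : wt (-q) = wt q := by
  ext x; simp [wt]

theorem norm_sub_sq_le_wt {q : E3} (hq : q ∈ S2) : ∀ᶠ x in 𝓝[S2] q, ‖x - q‖ ^ 2 ≤ 2 * wt q x := by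
  have : ContinuousAt (fun x => ⟪q, x⟫) q := (innerSL ℝ q).continuous.continuousAt
  have h0 : (0 : ℝ) < ⟪q, q⟫ := by rw [S2.inner_self hq]; norm_num
  filter_upwards [self_mem_nhdsWithin, (this.eventually (lt_mem_nhds h0)).filter_mono
    nhdsWithin_le_nhds] with x hx h
  rw [norm_sub_sq_real, S2.norm hx, S2.norm hq, wt, S2.inner_self hx, real_inner_comm]
  have : ⟪q, x⟫ ≤ 1 := by simpa [S2.norm hx, S2.norm hq] using real_inner_le_norm q x
  nlinarith

theorem eq_or_eq_neg_of_wt {q x : E3} (hq : q ∈ S2) (hx : x ∈ S2) (h : wt q x ≤ 0) :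
    x = q ∨ x = -q := by
  rw [wt, S2.inner_self hx] at h
  have h1 : ⟪q, x⟫ ≤ 1 := by simpa [S2.norm hx, S2.norm hq] using real_inner_le_norm q x
  have h2 : -1 ≤ ⟪q, x⟫ := by
    have := abs_real_inner_le_norm q x
    rw [S2.norm hx, S2.norm hq] at this
    linarith [abs_le.1 this]
  rcases le_or_gt 0 ⟪q, x⟫ with h3 | h3
  · left
    refine ((inner_eq_one_iff_of_norm_eq_one (𝕜 := ℝ) (S2.norm hq) (S2.norm hx)).1 ?_).symm
    nlinarith
  · right
    have := (inner_eq_one_iff_of_norm_eq_one (𝕜 := ℝ) (S2.norm (S2.neg hq)) (S2.norm hx)).1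
      (by rw [inner_neg_left]; nlinarith)
    exact this.symm

theorem bound_local_to_global {A m : E3 → ℝ} {q : E3} (hq : q ∈ S2) (hA : ContinuousOn A S2)
    (hm : ContinuousOn m S2) (hm0 : ∀ x, 0 ≤ m x) (hmq : ∀ x, 0 < wt q x → 0 < m x)
    (h1 : ∃ C, ∀ᶠ x in 𝓝[S2] q, A x ≤ C * m x) (h2 : ∃ C, ∀ᶠ x in 𝓝[S2] (-q), A x ≤ C * m x) :
    ∃ C, 0 ≤ C ∧ ∀ x ∈ S2, A x ≤ C * m x := by
  refine exists_bound_of_local hm0 fun x₀ hx₀ => ?_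
  rcases le_or_gt (wt q x₀) 0 with h | h
  · rcases eq_or_eq_neg_of_wt hq hx₀ h with rfl | rfl
    exacts [h1, h2]
  · exact local_bound_of_pos (hA x₀ hx₀) (hm x₀ hx₀) (hmq _ h)

theorem local_sq_le_wt {g : E3 → ℝ} (hg : Sm g) {q : E3} (hq : q ∈ S2) (h : g q = 0) :
    ∃ C, ∀ᶠ x in 𝓝[S2] q, g x ^ 2 ≤ C * wt q x := by
  obtain ⟨C, hC⟩ := (hg.differentiableAt (S2.ne_zero hq)).hasFDerivAt.isBigO_sub.bound
  refine ⟨C ^ 2 * 2, ?_⟩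
  filter_upwards [norm_sub_sq_le_wt hq, hC.filter_mono nhdsWithin_le_nhds] with x h1 h2
  rw [h, sub_zero, norm_eq_abs] at h2
  calc g x ^ 2 = |g x| ^ 2 := (sq_abs _).symm
    _ ≤ (C * ‖x - q‖) ^ 2 := pow_le_pow_left₀ (abs_nonneg _) h2 2
    _ = C ^ 2 * ‖x - q‖ ^ 2 := by ring
    _ ≤ C ^ 2 * (2 * wt q x) := mul_le_mul_of_nonneg_left h1 (sq_nonneg _)
    _ = _ := by ring

theorem local_sq_le_wt_sq {g : E3 → ℝ} (hg : Sm g) {q : E3} (hq : q ∈ S2) (h : g q = 0)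
    (h' : fderiv ℝ g q = 0) : ∃ C, ∀ᶠ x in 𝓝[S2] q, g x ^ 2 ≤ C * wt q x ^ 2 := by
  have hq0 := S2.ne_zero hq
  obtain ⟨C, hC⟩ := (hg.differentiableAt_fderiv hq0).hasFDerivAt.isBigO_sub.bound
  obtain ⟨r, hr, hball⟩ := Metric.eventually_nhds_iff_ball.1
    (hC.and (isOpen_compl_singleton.mem_nhds hq0))
  refine ⟨C ^ 2 * 4, ?_⟩
  filter_upwards [norm_sub_sq_le_wt hq, mem_nhdsWithin_of_mem_nhds (Metric.ball_mem_nhds q hr)]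
    with x h1 h2
  have hsub : Metric.closedBall q ‖x - q‖ ⊆ Metric.ball q r := by
    refine Metric.closedBall_subset_ball ?_
    rwa [← dist_eq_norm]
  have hCn : 0 ≤ C * ‖x - q‖ := by
    have := (hball x h2).1
    exact (norm_nonneg _).trans this
  have key : ‖g x - g q‖ ≤ (C * ‖x - q‖) * ‖x - q‖ := by
    refine (convex_closedBall q ‖x - q‖).norm_image_sub_le_of_norm_fderiv_le (𝕜 := ℝ)
      (fun y hy => hg.differentiableAt (hball y (hsub hy)).2) (fun y hy => ?_)
      (Metric.mem_closedBall_self (norm_nonneg _)) (by simp [dist_eq_norm])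
    have := (hball y (hsub hy)).1
    rw [h', sub_zero] at this
    rcases eq_or_ne x q with rfl | hne
    · have hy' : y = x := by simpa using hy
      subst hy'; simp [h']
    · have hC0 : 0 ≤ C := nonneg_of_mul_nonneg_left hCn (norm_pos_iff.2 (sub_ne_zero.2 hne))
      refine this.trans (mul_le_mul_of_nonneg_left ?_ hC0)
      rw [← dist_eq_norm]; exact hy
  rw [h, sub_zero, norm_eq_abs] at key
  have hw : 0 ≤ ‖x - q‖ ^ 2 := sq_nonneg _
  calc g x ^ 2 = |g x| ^ 2 := (sq_abs _).symm
    _ ≤ ((C * ‖x - q‖) * ‖x - q‖) ^ 2 := pow_le_pow_left₀ (abs_nonneg _) key 2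
    _ = C ^ 2 * (‖x - q‖ ^ 2) ^ 2 := by ring
    _ ≤ C ^ 2 * (2 * wt q x) ^ 2 :=
        mul_le_mul_of_nonneg_left (pow_le_pow_left₀ hw h1 2) (sq_nonneg _)
    _ = _ := by ring

theorem sq_le_wt {g : E3 → ℝ} (hg : Sm g) {q : E3} (hq : q ∈ S2) (h : g q = 0) (h' : g (-q) = 0) :
    ∃ C, 0 ≤ C ∧ ∀ x ∈ S2, g x ^ 2 ≤ C * wt q x :=
  bound_local_to_global hq (hg.pow 2).continuousOn_S2 (sm_wt q).continuousOn_S2 (wt_nonneg hq)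
    (fun _ h => h) (local_sq_le_wt hg hq h)
    (by simpa [wt_neg] using local_sq_le_wt hg (S2.neg hq) h')

theorem sq_le_wt_sq {g : E3 → ℝ} (hg : Sm g) {q : E3} (hq : q ∈ S2) (h : g q = 0)
    (h' : g (-q) = 0) (hd : fderiv ℝ g q = 0) (hd' : fderiv ℝ g (-q) = 0) :
    ∃ C, 0 ≤ C ∧ ∀ x ∈ S2, g x ^ 2 ≤ C * (wt q x * wt q x) := by
  have := bound_local_to_global (m := fun x => wt q x ^ 2) hq (hg.pow 2).continuousOn_S2
    ((sm_wt q).pow 2).continuousOn_S2 (fun x => sq_nonneg _) (fun x h => by positivity)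
    (local_sq_le_wt_sq hg hq h hd)
    (by simpa [wt_neg] using local_sq_le_wt_sq hg (S2.neg hq) h' hd')
  simpa [sq (wt q _)] using this

theorem sq_le_wt_mul {g : E3 → ℝ} (hg : Sm g) {q₁ q₂ : E3} (hq₁ : q₁ ∈ S2) (hq₂ : q₂ ∈ S2)
    (hne : q₁ ≠ q₂) (hne' : q₁ ≠ -q₂) (h₁ : g q₁ = 0) (h₁' : g (-q₁) = 0) (h₂ : g q₂ = 0)
    (h₂' : g (-q₂) = 0) : ∃ C, 0 ≤ C ∧ ∀ x ∈ S2, g x ^ 2 ≤ C * (wt q₁ x * wt q₂ x) := by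
  obtain ⟨C₁, hC₁, H₁⟩ := sq_le_wt hg hq₁ h₁ h₁'
  obtain ⟨C₂, hC₂, H₂⟩ := sq_le_wt hg hq₂ h₂ h₂'
  obtain ⟨c, hc, hcw⟩ : ∃ c, 0 ≤ c ∧ ∀ x ∈ S2, 1 ≤ c * (wt q₁ x + wt q₂ x) := by
    refine exists_bound_of_local (A := fun _ => 1)
      (fun x => add_nonneg (wt_nonneg hq₁ x) (wt_nonneg hq₂ x)) fun x hx => ?_
    refine local_bound_of_pos continuousWithinAt_const
      (((sm_wt q₁).add (sm_wt q₂)).continuousOn_S2 x hx) ?_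
    by_contra! hcon
    have p1 := wt_nonneg hq₁ x
    have p2 := wt_nonneg hq₂ x
    rcases eq_or_eq_neg_of_wt hq₁ hx (by linarith) with rfl | rfl <;>
    rcases eq_or_eq_neg_of_wt hq₂ hx (by linarith) with h | h
    · exact hne h
    · exact hne' h
    · exact hne' (by rw [← h, neg_neg])
    · exact hne (neg_injective h)
  refine ⟨c * (C₁ + C₂), by positivity, fun x hx => ?_⟩
  have p1 := wt_nonneg hq₁ x
  have p2 := wt_nonneg hq₂ x
  have a1 := mul_le_mul_of_nonneg_right (H₁ x hx) p2
  have a2 := mul_le_mul_of_nonneg_right (H₂ x hx) p1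
  calc g x ^ 2 ≤ g x ^ 2 * (c * (wt q₁ x + wt q₂ x)) :=
        le_mul_of_one_le_right (sq_nonneg _) (hcw x hx)
    _ = c * (g x ^ 2 * wt q₂ x + g x ^ 2 * wt q₁ x) := by ring
    _ ≤ c * (C₁ * wt q₁ x * wt q₂ x + C₂ * wt q₂ x * wt q₁ x) :=
        mul_le_mul_of_nonneg_left (add_le_add a1 a2) hc
    _ = _ := by ring

/-! ### Unique continuation from high-order contact at antipodal points -/

/-- `w` vanishes to second order at `q`. -/
def Flat2 (w : E3 → ℝ) (q : E3) : Prop := w q = 0 ∧ fderiv ℝ w q = 0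

/-- `w` vanishes to third order at `q`. -/
def Flat3 (w : E3 → ℝ) (q : E3) : Prop := Flat2 w q ∧ ∀ v v', D2 w q v v' = 0

theorem eq_zero_of_flat3 {α : ℝ} (h1 : 1 < α) (h3 : α ≤ 3) {f k H h g : ℝ → ℝ}
    (hpr : Profile f k H h g) {s w : E3 → ℝ} (hc : Coupled α f k s w) {q : E3}
    (hq : q ∈ S2) (hw : Flat3 w q) (hw' : Flat3 w (-q)) : ∀ x ∈ S2, w x = 0 := by
  obtain ⟨b, -⟩ := exists_frame_last hq
  have hne := S2.ne_zero hq
  have hne' := S2.ne_zero (S2.neg hq)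
  obtain ⟨C, hC, hb⟩ := sq_le_wt_sq hc.sm_w hq hw.1.1 hw'.1.1 hw.1.2 hw'.1.2
  have hL : ∀ i, ∃ C, 0 ≤ C ∧ ∀ x ∈ S2, L b i w x ^ 2 ≤ C * (wt q x * wt q x) := by
    intro i
    refine sq_le_wt_sq (hc.sm_w.L b i) hq ?_ ?_ ?_ ?_
    · simp [L, K, hw.1.2]
    · simp [L, K, hw'.1.2]
    · ext v; rw [L, fderiv_K hc.sm_w hne, hw.2, hw.1.2]; simp
    · ext v; rw [L, fderiv_K hc.sm_w hne', hw'.2, hw'.1.2]; simp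
  choose C' hC' hb' using hL
  refine eq_zero_of_vanishing h1 h3 hpr hc hq hq (C := C + ∑ i, C' i) (fun x hx => ?_)
    fun x hx => ?_
  · refine (hb x hx).trans (mul_le_mul_of_nonneg_right ?_ (mul_self_nonneg _))
    linarith [Finset.sum_nonneg fun i (_ : i ∈ Finset.univ) => hC' i]
  · rw [gradSq_eq b, add_mul, Finset.sum_mul]
    have := Finset.sum_le_sum fun i (_ : i ∈ Finset.univ) => hb' i x hx
    linarith [mul_nonneg hC (mul_self_nonneg (wt q x))]

theorem eq_zero_of_flat2 {α : ℝ} (h1 : 1 < α) (h3 : α ≤ 3) {f k H h g : ℝ → ℝ}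
    (hpr : Profile f k H h g) {s w : E3 → ℝ} (hc : Coupled α f k s w) {q₁ q₂ : E3}
    (hq₁ : q₁ ∈ S2) (hq₂ : q₂ ∈ S2) (hne : q₁ ≠ q₂) (hne' : q₁ ≠ -q₂)
    (h₁ : Flat2 w q₁) (h₁' : Flat2 w (-q₁)) (h₂ : Flat2 w q₂) (h₂' : Flat2 w (-q₂)) :
    ∀ x ∈ S2, w x = 0 := by
  obtain ⟨b, -⟩ := exists_frame_last hq₁
  obtain ⟨C, hC, hb⟩ := sq_le_wt_mul hc.sm_w hq₁ hq₂ hne hne' h₁.1 h₁'.1 h₂.1 h₂'.1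
  have hL : ∀ i, ∃ C, 0 ≤ C ∧ ∀ x ∈ S2, L b i w x ^ 2 ≤ C * (wt q₁ x * wt q₂ x) := by
    intro i
    refine sq_le_wt_mul (hc.sm_w.L b i) hq₁ hq₂ hne hne' ?_ ?_ ?_ ?_
    · simp [L, K, h₁.2]
    · simp [L, K, h₁'.2]
    · simp [L, K, h₂.2]
    · simp [L, K, h₂'.2]
  choose C' hC' hb' using hL
  have hm : ∀ x, 0 ≤ wt q₁ x * wt q₂ x := fun x => mul_nonneg (wt_nonneg hq₁ x) (wt_nonneg hq₂ x)
  refine eq_zero_of_vanishing h1 h3 hpr hc hq₁ hq₂ (C := C + ∑ i, C' i) (fun x hx => ?_)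
    fun x hx => ?_
  · refine (hb x hx).trans (mul_le_mul_of_nonneg_right ?_ (hm x))
    linarith [Finset.sum_nonneg fun i (_ : i ∈ Finset.univ) => hC' i]
  · rw [gradSq_eq b, add_mul, Finset.sum_mul]
    have := Finset.sum_le_sum fun i (_ : i ∈ Finset.univ) => hb' i x hx
    linarith [mul_nonneg hC (hm x)]

/-! ### Solutions, their homogeneity, and the linearized equation -/

theorem fderiv_hom0 {F : E3 → ℝ} (hF : Hom0 F) (x : E3) {r : ℝ} (hr : 0 < r) :
    fderiv ℝ F x = r • fderiv ℝ F (r • x) := by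
  have h : (fun y => F (r • y)) = F := funext fun y => hF y r hr
  rw [← fderiv_comp_smul, h]

theorem K_hom0 {F : E3 → ℝ} (hF : Hom0 F) (a c : E3) : Hom0 (K a c F) := by
  intro x r hr
  rw [K, K, fderiv_hom0 hF x hr]; simp

theorem fderiv_radial {F : E3 → ℝ} (hF : Hom0 F) (x : E3) : fderiv ℝ F x x = 0 := by
  by_cases hd : DifferentiableAt ℝ F x
  · have h1 : HasDerivAt (fun t : ℝ => t • x) x 1 := by
      simpa using (hasDerivAt_id (1 : ℝ)).smul_const x
    have h2 : HasDerivAt (fun t : ℝ => F (t • x)) (fderiv ℝ F x x) 1 := by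
      have : HasFDerivAt F (fderiv ℝ F x) ((1 : ℝ) • x) := by simpa using hd.hasFDerivAt
      exact this.comp_hasDerivAt 1 h1
    have h3 : (fun t : ℝ => F (t • x)) =ᶠ[𝓝 1] fun _ => F x := by
      filter_upwards [lt_mem_nhds (zero_lt_one' ℝ)] with t ht using hF x t ht
    exact h2.unique ((hasDerivAt_const (1 : ℝ) (F x)).congr_of_eventuallyEq h3)
  · rw [fderiv_zero_of_not_differentiableAt hd]; simp

theorem D2_radial {F : E3 → ℝ} (hF : Hom0 F) (hs : Sm F) {x : E3} (hx : x ≠ 0) (v : E3) :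
    D2 F x v x = -fderiv ℝ F x v := by
  have h1 := fderiv_clm_apply (hs.differentiableAt_fderiv hx)
    (differentiableAt_fun_id (𝕜 := ℝ) (x := x))
  have h2 : (fun y => fderiv ℝ F y y) = fun _ => 0 := funext (fderiv_radial hF)
  rw [h2] at h1
  have h3 := congrArg (fun l => l v) h1
  simp at h3
  rw [D2]; linarith

theorem lap_eq_trace (F : E3 → ℝ) (x : E3) (b : Frame) : lap F x = ∑ i, D2 F x (b i) (b i) := by
  have h1 := congrFun (InnerProductSpace.laplacian_eq_iteratedFDeriv_orthonormalBasis F b) x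
  have h2 := congrFun (InnerProductSpace.laplacian_eq_iteratedFDeriv_orthonormalBasis F
    (EuclideanSpace.basisFun (Fin 3) ℝ)) x
  rw [h1] at h2
  simp only [EuclideanSpace.basisFun_apply] at h2
  rw [lap, ← h2]
  simp [iteratedFDeriv_two_apply, D2]

theorem Lap_eq_lap {F : E3 → ℝ} (hF : Hom0 F) (hs : Sm F) {x : E3} (hx : x ∈ S2) (b : Frame) :
    Lap b F x = lap F x := by
  have hne := S2.ne_zero hx
  have h1 : D2 F x x x = 0 := by rw [D2_radial hF hs hne, fderiv_radial hF, neg_zero]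
  have h2 := fderiv_radial hF x
  have h3 := S2.inner_self hx
  rw [lap_eq_trace F x b]
  simp only [Lap, L, K_K hs hne, rot_apply, Fin.sum_univ_three]
  have s01 := D2_symm hs hne (b 0) (b 1)
  have s02 := D2_symm hs hne (b 0) (b 2)
  have s12 := D2_symm hs hne (b 1) (b 2)
  have e1 : D2 F x (⟪b 0, x⟫ • b 0 + ⟪b 1, x⟫ • b 1 + ⟪b 2, x⟫ • b 2)
      (⟪b 0, x⟫ • b 0 + ⟪b 1, x⟫ • b 1 + ⟪b 2, x⟫ • b 2) = 0 := by rw [← b.expand, h1]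
  have e2 : fderiv ℝ F x (⟪b 0, x⟫ • b 0 + ⟪b 1, x⟫ • b 1 + ⟪b 2, x⟫ • b 2) = 0 := by
    rw [← b.expand, h2]
  have e3 := h3
  rw [b.inner_eq] at e3
  simp only [D2_add_left, D2_add_right, D2_smul_left, D2_smul_right] at e1
  simp only [map_add, map_smul, smul_eq_mul] at e2
  simp [D2_sub_left, D2_sub_right, D2_smul_left, D2_smul_right, inner_sub_right,
    inner_smul_right, b.inner_matrix, -inner_self_eq_norm_sq_to_K]
  rw [s01, s02, s12] at *
  linear_combination (D2 F x (b 0) (b 0) + D2 F x (b 1) (b 1) + D2 F x (b 2) (b 2)) * e3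
    - e1 - 2 * e2

/-- Smooth solutions of the mean field equation, with the spherical Laplacian written in an
arbitrary frame. -/
structure Sol (α : ℝ) (u : E3 → ℝ) : Prop where
  sm : Sm u
  hom : Hom0 u
  lap : ∀ (b : Frame) x, x ≠ 0 → Lap b u x = α - exp (2 * u x)

theorem Sol.of_MFE {α : ℝ} {u : E3 → ℝ} (h : MFE u α) : Sol α u := by
  obtain ⟨h1, h2, h3⟩ := h
  refine ⟨h1, h2, fun b x hx => ?_⟩
  have hL : Hom0 (Lap b u) := fun y r hr => by
    unfold Lap
    exact Finset.sum_congr rfl fun i _ => K_hom0 (K_hom0 h2 _ _) _ _ y r hr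
  have hx' : ‖x‖⁻¹ • x ∈ S2 := by
    rw [mem_S2_iff, norm_smul, norm_inv, norm_norm, inv_mul_cancel₀ (norm_ne_zero_iff.2 hx)]
  have hr : 0 < ‖x‖⁻¹ := inv_pos.2 (norm_pos_iff.2 hx)
  rw [← hL x _ hr, ← h2 x _ hr, Lap_eq_lap h2 h1 hx']
  linarith [h3 _ hx']

theorem sinh_double (t : ℝ) : sinh t = 2 * sinh (t / 2) * cosh (t / 2) := by
  rw [← sinh_two_mul]; ring_nf

theorem cosh_double (t : ℝ) : cosh t = 1 + 2 * sinh (t / 2) ^ 2 := by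
  have := cosh_two_mul (t / 2)
  rw [show 2 * (t / 2) = t by ring, cosh_sq] at this
  linarith

theorem profile_sinh : Profile (fun t => 2 * sinh t) cosh (fun t => 2 * (cosh t - 1))
    (fun t => 2 * sinh (t / 2)) (fun t => 2 * cosh (t / 2)) where
  deriv_f t := (hasDerivAt_sinh t).const_mul 2
  deriv_H t := ((hasDerivAt_cosh t).sub_const 1).const_mul 2
  smooth_f := contDiff_const.mul contDiff_sinh
  smooth_H := contDiff_const.mul (contDiff_cosh.sub contDiff_const)
  cont_k := continuous_cosh
  one_le_k := one_le_cosh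
  H_eq t := by simp only [cosh_double t]; ring
  f_eq t := by simp only [sinh_double t]; ring
  g_sq t := by
    have := cosh_sq (t / 2)
    simp only [cosh_double t]; rw [mul_pow, this]; ring
  H_zero t ht := by
    by_contra h
    have := one_lt_cosh.2 h
    linarith
  H_le M := by
    refine ⟨exp (M ^ 2 / 2), fun t ht => ?_⟩
    have h1 := cosh_le_exp_half_sq t
    have h2 : exp (t ^ 2 / 2) - 1 ≤ t ^ 2 / 2 * exp (t ^ 2 / 2) := by
      have := add_one_le_exp (-(t ^ 2 / 2))
      have h4 : exp (-(t ^ 2 / 2)) * exp (t ^ 2 / 2) = 1 := by rw [← exp_add]; simp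
      nlinarith [exp_pos (t ^ 2 / 2)]
    have h3 : exp (t ^ 2 / 2) ≤ exp (M ^ 2 / 2) := by
      have : t ^ 2 ≤ M ^ 2 := sq_le_sq' (by linarith [(abs_le.1 ht).1]) (abs_le.1 ht).2
      exact exp_le_exp.2 (by linarith)
    nlinarith [sq_nonneg t]

theorem profile_linear : Profile (fun t => 2 * t) (fun _ => 1) (fun t => t ^ 2) (fun t => t)
    (fun _ => 2) where
  deriv_f t := by simpa using (hasDerivAt_id t).const_mul 2
  deriv_H t := by simpa using hasDerivAt_pow 2 t
  smooth_f := contDiff_const.mul contDiff_id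
  smooth_H := contDiff_id.pow 2
  cont_k := continuous_const
  one_le_k _ := le_rfl
  H_eq _ := rfl
  f_eq t := by ring
  g_sq _ := by norm_num
  H_zero := by simp
  H_le M := ⟨1, fun t _ => by simp⟩

theorem Sol.coupled {α : ℝ} {u v : E3 → ℝ} (hu : Sol α u) (hv : Sol α v) :
    Coupled α (fun t => 2 * sinh t) cosh (fun x => u x + v x) (fun x => u x - v x) where
  sm_s := hu.sm.add hv.sm
  sm_w := hu.sm.sub hv.sm
  lap_w b x hx := by
    rw [Lap_sub hu.sm hv.sm, hu.lap b x hx, hv.lap b x hx]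
    rw [sinh_eq, show 2 * u x = (u x + v x) + (u x - v x) by ring,
      show 2 * v x = (u x + v x) + -(u x - v x) by ring, exp_add (u x + v x), exp_add (u x + v x)]
    ring
  lap_s b x hx := by
    rw [Lap_add hu.sm hv.sm, hu.lap b x hx, hv.lap b x hx]
    rw [cosh_eq, show 2 * u x = (u x + v x) + (u x - v x) by ring,
      show 2 * v x = (u x + v x) + -(u x - v x) by ring, exp_add (u x + v x), exp_add (u x + v x)]
    ring

/-- Smooth functions in the kernel of the linearized operator `Δ + 2e^{2u}`. -/
structure Ker (u φ : E3 → ℝ) : Prop where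
  sm : Sm φ
  hom : Hom0 φ
  lap : ∀ (b : Frame) x, x ≠ 0 → Lap b φ x = -2 * exp (2 * u x) * φ x

theorem Ker.coupled {α : ℝ} {u φ : E3 → ℝ} (hu : Sol α u) (h : Ker u φ) :
    Coupled α (fun t => 2 * t) (fun _ => 1) (fun x => 2 * u x) φ where
  sm_s := hu.sm.const_mul 2
  sm_w := h.sm
  lap_w b x hx := by rw [h.lap b x hx]; ring
  lap_s b x hx := by rw [Lap_const_mul 2 hu.sm, hu.lap b x hx]; ring

theorem Ker.combo {u φ ψ : E3 → ℝ} (h : Ker u φ) (h' : Ker u ψ) (r s : ℝ) :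
    Ker u (fun x => r * φ x + s * ψ x) where
  sm := (h.sm.const_mul r).add (h'.sm.const_mul s)
  hom x t ht := by simp only [h.hom x t ht, h'.hom x t ht]
  lap b x hx := by
    rw [Lap_add (h.sm.const_mul r) (h'.sm.const_mul s), Lap_const_mul r h.sm,
      Lap_const_mul s h'.sm, h.lap b x hx, h'.lap b x hx]
    ring

theorem hom0_eq_zero {F : E3 → ℝ} (hF : Hom0 F) (h : ∀ x ∈ S2, F x = 0) {x : E3} (hx : x ≠ 0) :
    F x = 0 := by
  rw [← hF x ‖x‖⁻¹ (inv_pos.2 (norm_pos_iff.2 hx))]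
  refine h _ ?_
  rw [mem_S2_iff, norm_smul, norm_inv, norm_norm, inv_mul_cancel₀ (norm_ne_zero_iff.2 hx)]

/-- Rotation derivatives do not depend on the frame containing them. -/
theorem Lap_K {F : E3 → ℝ} (hF : Sm F) (b : Frame) {a c : E3} (x : E3) :
    Lap b (K a c F) x = K a c (Lap b F) x := by
  have hK : ∀ G : E3 → ℝ, K a c G = fun y => ∑ i : Fin 3,
      (⟪b (i + 1), a⟫ * ⟪b (i + 2), c⟫ - ⟪b (i + 2), a⟫ * ⟪b (i + 1), c⟫) * L b i G y := by
    intro G; ext y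
    rw [K_apply]
    conv_lhs => rw [b.inner_eq a y, b.inner_eq c y, b.expand a, b.expand c]
    simp only [L, K_apply, Fin.sum_univ_three, map_add, map_smul, smul_eq_mul]
    simp [inner_add_right, inner_smul_right, b.inner_matrix, -inner_self_eq_norm_sq_to_K]
    ring
  rw [hK F, hK (Lap b F), Lap_sum _ fun i _ => (hF.L b i).const_mul _]
  exact Finset.sum_congr rfl fun i _ => by rw [Lap_const_mul _ (hF.L b i), Lap_L hF]

theorem Sol.ker {α : ℝ} {u : E3 → ℝ} (hu : Sol α u) (a c : E3) : Ker u (K a c u) where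
  sm := hu.sm.K a c
  hom := K_hom0 hu.hom a c
  lap b x hx := by
    rw [Lap_K hu.sm b x, K_congr (fun y hy => hu.lap b y hy) a c]
    have h1 : ∀ t : ℝ, HasDerivAt (fun t : ℝ => α - exp (2 * t)) (-2 * exp (2 * t)) t := fun t => by
      have := (((hasDerivAt_id t).const_mul 2).exp).const_sub α
      exact this.congr_deriv (by simp; ring)
    rw [K_comp hu.sm h1]

theorem Ker.eq_zero_of_flat3 {α : ℝ} {u φ : E3 → ℝ} (hu : Sol α u) (h1 : 2 < α) (h3 : α ≤ 3)
    (h : Ker u φ) {q : E3} (hq : q ∈ S2) (hf : Flat3 φ q) (hf' : Flat3 φ (-q)) {x : E3}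
    (hx : x ≠ 0) : φ x = 0 :=
  hom0_eq_zero h.hom (MeanField.eq_zero_of_flat3 (by linarith) h3 profile_linear (h.coupled hu) hq
    hf hf') hx

theorem Ker.eq_zero_of_flat2 {α : ℝ} {u φ : E3 → ℝ} (hu : Sol α u) (h1 : 2 < α) (h3 : α ≤ 3)
    (h : Ker u φ) {q₁ q₂ : E3} (hq₁ : q₁ ∈ S2) (hq₂ : q₂ ∈ S2) (hne : q₁ ≠ q₂) (hne' : q₁ ≠ -q₂)
    (h₁ : Flat2 φ q₁) (h₁' : Flat2 φ (-q₁)) (h₂ : Flat2 φ q₂) (h₂' : Flat2 φ (-q₂)) {x : E3}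
    (hx : x ≠ 0) : φ x = 0 :=
  hom0_eq_zero h.hom (MeanField.eq_zero_of_flat2 (by linarith) h3 profile_linear (h.coupled hu) hq₁ hq₂
    hne hne' h₁ h₁' h₂ h₂') hx

/-! ### Reflections and symmetries -/

/-- The reflection across the plane orthogonal to `z`, as a linear isometry. -/
def refl (z : E3) : E3 ≃ₗᵢ[ℝ] E3 := (ℝ ∙ z)ᗮ.reflection

theorem refl_apply {z : E3} (hz : z ∈ S2) (x : E3) : refl z x = x - (2 * ⟪z, x⟫) • z := by
  rw [refl, Submodule.reflection_orthogonal_apply, Submodule.reflection_singleton_apply, S2.norm hz]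
  simp; module

theorem refl_self {z : E3} (hz : z ∈ S2) : refl z z = -z := by
  rw [refl_apply hz, S2.inner_self hz]; module

theorem refl_of_inner {z x : E3} (hz : z ∈ S2) (h : ⟪z, x⟫ = 0) : refl z x = x := by
  rw [refl_apply hz, h]; simp

theorem fderiv_comp_isometry (F : E3 → ℝ) (R : E3 ≃ₗᵢ[ℝ] E3) (x v : E3) :
    fderiv ℝ (fun y => F (R y)) x v = fderiv ℝ F (R x) (R v) := by
  have := R.toContinuousLinearEquiv.comp_right_fderiv (f := F) (x := x)
  exact congrArg (fun l => l v) this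

theorem Sm.comp_isometry {F : E3 → ℝ} (hF : Sm F) (R : E3 ≃ₗᵢ[ℝ] E3) : Sm fun y => F (R y) :=
  .of_contDiffAt fun x hx =>
    (hF.contDiffAt (by simpa using hx)).comp x R.toContinuousLinearEquiv.contDiff.contDiffAt

theorem K_comp_isometry (F : E3 → ℝ) (R : E3 ≃ₗᵢ[ℝ] E3) (a c : E3) :
    K a c (fun y => F (R y)) = fun x => K (R a) (R c) F (R x) := by
  ext x
  rw [K_apply, K_apply, fderiv_comp_isometry, fderiv_comp_isometry, R.inner_map_map,
    R.inner_map_map]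

theorem D2_comp_isometry {F : E3 → ℝ} (hF : Sm F) (R : E3 ≃ₗᵢ[ℝ] E3) {x : E3} (hx : x ≠ 0)
    (v v' : E3) : D2 (fun y => F (R y)) x v v' = D2 F (R x) (R v) (R v') := by
  have hd := (hF.comp_isometry R).differentiableAt_fderiv hx
  have h1 : D2 (fun y => F (R y)) x v v'
      = fderiv ℝ (fun y => fderiv ℝ (fun z => F (R z)) y v') x v := by
    rw [D2, fderiv_clm_apply hd (differentiableAt_const v')]; simp
  have h2 : (fun y => fderiv ℝ (fun z => F (R z)) y v')
      = fun y => (fun z => fderiv ℝ F z (R v')) (R y) := funext fun y => fderiv_comp_isometry F R y v'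
  rw [h1, h2, fderiv_comp_isometry (fun z => fderiv ℝ F z (R v'))]
  rw [fderiv_clm_apply (hF.differentiableAt_fderiv (by simpa using hx)) (differentiableAt_const _)]
  simp [D2]

theorem D2_sub_fun {F G : E3 → ℝ} (hF : Sm F) (hG : Sm G) {x : E3} (hx : x ≠ 0) (v v' : E3) :
    D2 (fun y => F y - G y) x v v' = D2 F x v v' - D2 G x v v' := by
  have h : fderiv ℝ (fun y => F y - G y) =ᶠ[𝓝 x] fun y => fderiv ℝ F y - fderiv ℝ G y := by
    filter_upwards [isOpen_compl_singleton.mem_nhds hx] with y hy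
      using fderiv_fun_sub (hF.differentiableAt hy) (hG.differentiableAt hy)
  rw [D2, h.fderiv_eq, fderiv_fun_sub (hF.differentiableAt_fderiv hx)
    (hG.differentiableAt_fderiv hx)]
  simp [D2]

theorem Sol.comp_isometry {α : ℝ} {u : E3 → ℝ} (hu : Sol α u) (R : E3 ≃ₗᵢ[ℝ] E3) :
    Sol α fun y => u (R y) where
  sm := hu.sm.comp_isometry R
  hom x r hr := by simp only [map_smul]; exact hu.hom _ r hr
  lap b x hx := by
    rw [← hu.lap (b.map R) (R x) (by simpa using hx)]
    simp only [Lap, L, K_comp_isometry, OrthonormalBasis.map_apply]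

/-- If `u` and its transform agree to second order at an antipodal pair, they coincide. -/
theorem Sol.invariant {α : ℝ} {u : E3 → ℝ} (hu : Sol α u) (h1 : 2 < α) (h3 : α ≤ 3)
    (R : E3 ≃ₗᵢ[ℝ] E3) {q : E3} (hq : q ∈ S2)
    (h : ∀ q' : E3, q' = q ∨ q' = -q → u (R q') = u q' ∧ fderiv ℝ u q' = 0 ∧ fderiv ℝ u (R q') = 0 ∧
      ∀ v v', D2 u (R q') (R v) (R v') = D2 u q' v v') (x : E3) : u (R x) = u x := by
  have hR := hu.comp_isometry R
  rcases eq_or_ne x 0 with rfl | hx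
  · simp
  have hflat : ∀ q' : E3, q' = q ∨ q' = -q → Flat3 (fun x => u x - u (R x)) q' := by
    intro q' hq'
    obtain ⟨a1, a2, a3, a4⟩ := h q' hq'
    have hne : q' ≠ 0 := by
      rcases hq' with rfl | rfl
      · exact S2.ne_zero hq
      · exact S2.ne_zero (S2.neg hq)
    refine ⟨⟨by simp only [a1, sub_self], ?_⟩, fun v v' => ?_⟩
    · rw [fderiv_fun_sub (hu.sm.differentiableAt hne) (hR.sm.differentiableAt hne), a2]
      ext v
      simp [fderiv_comp_isometry, a3]
    · rw [D2_sub_fun hu.sm hR.sm hne, D2_comp_isometry hu.sm R hne, a4, sub_self]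
  have hw : Hom0 (fun x => u x - u (R x)) := fun x r hr => by
    simp only [hu.hom x r hr, hR.hom x r hr]
  have := hom0_eq_zero hw (eq_zero_of_flat3 (by linarith) h3 profile_sinh (hu.coupled hR) hq
    (hflat q (.inl rfl)) (hflat (-q) (.inr rfl))) hx
  linarith

theorem D2_tangent {u : E3 → ℝ} (hs : Sm u) (hu : Hom0 u) {q : E3} (hq : q ∈ S2)
    (hc : fderiv ℝ u q = 0) (r : ℝ) (v v' : E3) :
    D2 u q (v + r • q) v' = D2 u q v v' ∧ D2 u q v (v' + r • q) = D2 u q v v' := by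
  have hne := S2.ne_zero hq
  have h : ∀ v, D2 u q v q = 0 := fun v => by rw [D2_radial hu hs hne, hc]; simp
  refine ⟨?_, ?_⟩
  · rw [D2_add_left, D2_smul_left, D2_symm hs hne q, h]; ring
  · rw [D2_add_right, D2_smul_right, h]; ring

/-- The antipodal matching condition implies reflection symmetry. -/
theorem Sol.invariant_of_match {α : ℝ} {u : E3 → ℝ} (hu : Sol α u) (h1 : 2 < α) (h3 : α ≤ 3)
    {p : E3} (hp : p ∈ S2) (hc : fderiv ℝ u p = 0) (hc' : fderiv ℝ u (-p) = 0)
    (hh : ∀ v v', ⟪v, p⟫ = 0 → ⟪v', p⟫ = 0 → D2 u p v v' = D2 u (-p) v v') (x : E3) :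
    u (refl p x) = u x := by
  have hne := S2.ne_zero hp
  have hne' := S2.ne_zero (S2.neg hp)
  have t1 : ∀ (r : ℝ) (v v' : E3), D2 u p (v + r • p) v' = D2 u p v v' ∧ D2 u p v (v' + r • p) = D2 u p v v' :=
    fun r v v' => D2_tangent hu.sm hu.hom hp hc r v v'
  have t2 : ∀ (r : ℝ) (v v' : E3), D2 u (-p) (v + r • p) v' = D2 u (-p) v v' ∧
      D2 u (-p) v (v' + r • p) = D2 u (-p) v v' := fun r v v' => by
    have := D2_tangent hu.sm hu.hom (S2.neg hp) hc' (-r) v v'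
    simpa using this
  have hfull : ∀ (r s : ℝ) (v v' : E3), D2 u p (v + r • p) (v' + s • p) = D2 u (-p) v v' := by
    intro r s v v'
    have e : ∀ v : E3, v = (v - ⟪p, v⟫ • p) + ⟪p, v⟫ • p := fun v => by simp
    have o : ∀ v : E3, ⟪v - ⟪p, v⟫ • p, p⟫ = 0 := fun v => by
      rw [inner_sub_left, real_inner_smul_left, S2.inner_self hp, real_inner_comm]; ring
    rw [(t1 _ _ _).1, (t1 _ _ _).2, e v, e v', (t1 _ _ _).1, (t1 _ _ _).2, (t2 _ _ _).1,
      (t2 _ _ _).2, hh _ _ (o v) (o v')]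
  have hval : u (-p) = u p := by
    obtain ⟨b, -⟩ := exists_frame_last hp
    have e1 := Lap_eq_lap hu.hom hu.sm hp b
    have e2 := Lap_eq_lap hu.hom hu.sm (S2.neg hp) b
    have e3 : _root_.lap u p = _root_.lap u (-p) := by
      rw [lap_eq_trace u p b, lap_eq_trace u (-p) b]
      refine Finset.sum_congr rfl fun i _ => ?_
      simpa using hfull 0 0 (b i) (b i)
    rw [hu.lap b p hne, hu.lap b _ hne'] at *
    have : exp (2 * u (-p)) = exp (2 * u p) := by linarith
    have := exp_injective this
    linarith
  have hr : ∀ v : E3, refl p v = v + (-(2 * ⟪p, v⟫)) • p := fun v => by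
    rw [refl_apply hp, neg_smul, sub_eq_add_neg]
  refine hu.invariant h1 h3 (refl p) hp ?_ x
  rintro q' (rfl | rfl)
  · rw [refl_self hp]
    refine ⟨hval, hc, hc', fun v v' => ?_⟩
    rw [hr, hr, (t2 _ _ _).1, (t2 _ _ _).2]
    simpa using (hfull 0 0 v v').symm
  · rw [map_neg, refl_self hp, neg_neg]
    refine ⟨hval.symm, hc', hc, fun v v' => ?_⟩
    rw [hr, hr, hfull]

/-- `z` is an eigenvector of the Hessian at `q`. -/
def Eig (u : E3 → ℝ) (q z : E3) : Prop := ∀ v, D2 u q z v = ⟪z, v⟫ * D2 u q z z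

theorem Sol.invariant_of_eig {α : ℝ} {u : E3 → ℝ} (hu : Sol α u) (h1 : 2 < α) (h3 : α ≤ 3)
    {q z : E3} (hq : q ∈ S2) (hz : z ∈ S2) (hqz : ⟪z, q⟫ = 0) (hc : fderiv ℝ u q = 0)
    (hc' : fderiv ℝ u (-q) = 0) (he : Eig u q z) (he' : Eig u (-q) z) (x : E3) :
    u (refl z x) = u x := by
  have key : ∀ q' : E3, q' ≠ 0 → Eig u q' z → ∀ v v',
      D2 u q' (refl z v) (refl z v') = D2 u q' v v' := by
    intro q' hne he v v'
    rw [refl_apply hz, refl_apply hz, D2_sub_left, D2_sub_right, D2_sub_right, D2_smul_left,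
      D2_smul_left, D2_smul_right, D2_smul_right, D2_symm hu.sm hne v z, he v, he v']
    ring
  refine hu.invariant h1 h3 (refl z) hq ?_ x
  rintro q' (rfl | rfl)
  · rw [refl_of_inner hz hqz]
    exact ⟨rfl, hc, hc, key _ (S2.ne_zero hq) he⟩
  · rw [refl_of_inner hz (by simpa using hqz)]
    exact ⟨rfl, hc', hc', key _ (S2.ne_zero (S2.neg hq)) he'⟩

theorem eig_of_frame {u : E3 → ℝ} (hs : Sm u) (hu : Hom0 u) {q z e : E3} (hq : q ∈ S2)
    (hc : fderiv ℝ u q = 0) (h1 : OPair z e) (h2 : ⟪z, q⟫ = 0) (h3 : ⟪e, q⟫ = 0)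
    (h : D2 u q z e = 0) : Eig u q z := by
  obtain ⟨b, b0, b1, b2⟩ := exists_frame h1 ⟨h1.right, S2.inner_self hq, h3⟩
    ⟨S2.inner_self hq, h1.left, by rw [real_inner_comm]; exact h2⟩
  intro v
  have hx := b.expand v
  rw [b0, b1, b2] at hx
  conv_lhs => rw [hx]
  rw [(D2_tangent hs hu hq hc _ _ _).2, D2_add_right, D2_smul_right, D2_smul_right, h]
  ring

/-- Invariance under the reflection in `z^⊥`. -/
def Inv (u : E3 → ℝ) (z : E3) : Prop := ∀ x, u (refl z x) = u x

theorem Inv.fderiv {u : E3 → ℝ} {z : E3} (h : Inv u z) (x v : E3) :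
    fderiv ℝ u (refl z x) (refl z v) = fderiv ℝ u x v := by
  rw [← fderiv_comp_isometry]
  exact congrArg (fun g => _root_.fderiv ℝ g x v) (funext h)

theorem Inv.D2 {u : E3 → ℝ} (hs : Sm u) {z : E3} (h : Inv u z) {x : E3} (hx : x ≠ 0) (v v' : E3) :
    D2 u (refl z x) (refl z v) (refl z v') = D2 u x v v' := by
  rw [← D2_comp_isometry hs _ hx]
  exact congrArg (fun g => MeanField.D2 g x v v') (funext h)

theorem Inv.fderiv_normal {u : E3 → ℝ} {z : E3} (hz : z ∈ S2) (h : Inv u z) {x : E3}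
    (hx : ⟪z, x⟫ = 0) : _root_.fderiv ℝ u x z = 0 := by
  have := h.fderiv x z
  rw [refl_of_inner hz hx, refl_self hz, map_neg] at this
  linarith

theorem Inv.D2_normal {u : E3 → ℝ} (hs : Sm u) {z : E3} (hz : z ∈ S2) (h : Inv u z) {x : E3}
    (hx0 : x ≠ 0) (hx : ⟪z, x⟫ = 0) {e : E3} (he : ⟪z, e⟫ = 0) : MeanField.D2 u x z e = 0 := by
  have := h.D2 hs hx0 z e
  have h2 := D2_smul_left u x z e (-1)
  rw [refl_of_inner hz hx, refl_self hz, refl_of_inner hz he, ← neg_one_smul ℝ z, h2] at this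
  linarith

/-- The standing situation: a solution invariant under the three reflections of a frame. -/
structure Setup (α : ℝ) (u : E3 → ℝ) (b : Frame) : Prop where
  sol : Sol α u
  lt : 2 < α
  le : α ≤ 3
  inv : ∀ i, Inv u (b i)

theorem exists_setup {α : ℝ} {u : E3 → ℝ} (hu : Sol α u) (h1 : 2 < α) (h3 : α ≤ 3)
    {p : E3} (hp : p ∈ S2) (hc : fderiv ℝ u p = 0) (hc' : fderiv ℝ u (-p) = 0)
    (hh : ∀ v v', ⟪v, p⟫ = 0 → ⟪v', p⟫ = 0 → D2 u p v v' = D2 u (-p) v v') :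
    ∃ b : Frame, Setup α u b := by
  have hip : Inv u p := hu.invariant_of_match h1 h3 hp hc hc' hh
  obtain ⟨b, rfl⟩ := exists_frame_last hp
  have h01 := b.opair (show (0 : Fin 3) ≠ 1 by decide)
  have hne := S2.ne_zero hp
  obtain ⟨θ, -, hθ⟩ : ∃ θ ∈ Set.Icc 0 (π / 2),
      D2 u (b 2) (cos θ • b 0 + sin θ • b 1) (-sin θ • b 0 + cos θ • b 1) = 0 := by
    have hcont : ContinuousOn (fun θ : ℝ =>
        D2 u (b 2) (cos θ • b 0 + sin θ • b 1) (-sin θ • b 0 + cos θ • b 1)) (Set.Icc 0 (π / 2)) := by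
      unfold D2; fun_prop
    have e0 : D2 u (b 2) (cos 0 • b 0 + sin 0 • b 1) (-sin 0 • b 0 + cos 0 • b 1)
        = D2 u (b 2) (b 0) (b 1) := by simp
    have e1 : D2 u (b 2) (cos (π / 2) • b 0 + sin (π / 2) • b 1)
        (-sin (π / 2) • b 0 + cos (π / 2) • b 1) = -D2 u (b 2) (b 0) (b 1) := by
      have := D2_smul_right u (b 2) (b 0) (b 1) (-1)
      simp at this
      simp [this, D2_symm hu.sm hne (b 1) (b 0)]
    have hpi : (0 : ℝ) ≤ π / 2 := by positivity
    rcases le_total 0 (D2 u (b 2) (b 0) (b 1)) with h | h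
    · exact intermediate_value_Icc' hpi hcont ⟨by simp only [e1]; linarith, by simp only [e0]; exact h⟩
    · exact intermediate_value_Icc hpi hcont ⟨by simp only [e0]; exact h, by simp only [e1]; linarith⟩
  set a := cos θ • b 0 + sin θ • b 1 with ha
  set c := -sin θ • b 0 + cos θ • b 1 with hcdef
  have hsc := sin_sq_add_cos_sq θ
  have hac : OPair a c := by
    refine ⟨?_, ?_, ?_⟩ <;>
      simp [ha, hcdef, inner_add_left, inner_add_right, inner_smul_left, inner_smul_right,
        b.inner_matrix, -inner_self_eq_norm_sq_to_K] <;> nlinarith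
  have hap : ⟪a, b 2⟫ = 0 := by simp [ha, inner_add_left, inner_smul_left, b.inner_matrix]
  have hcp : ⟪c, b 2⟫ = 0 := by
    simp [hcdef, inner_add_left, inner_smul_left, b.inner_matrix]
  obtain ⟨d, d0, d1, d2⟩ := exists_frame hac ⟨hac.right, b.inner_self 2, hcp⟩
    ⟨b.inner_self 2, hac.left, by rw [real_inner_comm]; exact hap⟩
  have hθ' : D2 u (-b 2) a c = 0 := by
    rw [← hh a c hap hcp]; exact hθ
  have haS : a ∈ S2 := d0 ▸ d.mem_S2 0
  have hcS : c ∈ S2 := d1 ▸ d.mem_S2 1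
  refine ⟨d, hu, h1, h3, fun i => ?_⟩
  fin_cases i
  · change Inv u (d 0)
    rw [d0]
    exact hu.invariant_of_eig h1 h3 hp haS hap hc hc'
      (eig_of_frame hu.sm hu.hom hp hc hac hap hcp hθ)
      (eig_of_frame hu.sm hu.hom (S2.neg hp) hc' hac (by simpa using hap) (by simpa using hcp) hθ')
  · change Inv u (d 1)
    rw [d1]
    exact hu.invariant_of_eig h1 h3 hp hcS hcp hc hc'
      (eig_of_frame hu.sm hu.hom hp hc hac.symm hcp hap (by rw [D2_symm hu.sm hne]; exact hθ))
      (eig_of_frame hu.sm hu.hom (S2.neg hp) hc' hac.symm (by simpa using hcp) (by simpa using hap)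
        (by rw [D2_symm hu.sm (S2.ne_zero (S2.neg hp))]; exact hθ'))
  · change Inv u (d 2)
    rw [d2]
    exact hip

/-! ### Consequences of the three reflection symmetries -/

theorem fderiv_eq_zero_of_frame {u : E3 → ℝ} (d : Frame) {x : E3}
    (h : ∀ i, fderiv ℝ u x (d i) = 0) : fderiv ℝ u x = 0 := by
  ext v
  rw [d.expand v]
  simp [h]

theorem Setup.reindex {α : ℝ} {u : E3 → ℝ} {b : Frame} (h : Setup α u b) (σ : Equiv.Perm (Fin 3)) :
    Setup α u (b.reindex σ) :=
  ⟨h.sol, h.lt, h.le, fun i => by rw [OrthonormalBasis.reindex_apply]; exact h.inv _⟩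

theorem Setup.even {α : ℝ} {u : E3 → ℝ} {b : Frame} (h : Setup α u b) (x : E3) : u (-x) = u x := by
  have e : refl (b 0) (refl (b 1) (refl (b 2) x)) = -x := by
    simp only [refl_apply (b.mem_S2 _), inner_sub_right, inner_smul_right, b.inner_matrix]
    conv_rhs => rw [b.expand x]
    conv_lhs => enter [1, 1, 1]; rw [b.expand x]
    simp
    module
  rw [← e, h.inv 0, h.inv 1, h.inv 2]

theorem even_fderiv {u : E3 → ℝ} (h : ∀ x, u (-x) = u x) (x : E3) :
    fderiv ℝ u (-x) = -fderiv ℝ u x := by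
  have := fderiv_comp_isometry u (LinearIsometryEquiv.neg ℝ) x
  simp only [LinearIsometryEquiv.coe_neg, h] at this
  ext v
  simpa using (congrArg Neg.neg (this v)).symm

theorem even_D2 {u : E3 → ℝ} (hs : Sm u) (h : ∀ x, u (-x) = u x) {x : E3} (hx : x ≠ 0)
    (v v' : E3) : D2 u (-x) v v' = D2 u x v v' := by
  have := D2_comp_isometry hs (LinearIsometryEquiv.neg ℝ) hx v v'
  simp only [LinearIsometryEquiv.coe_neg, h] at this
  change D2 u x v v' = _ at this
  rw [this, ← neg_one_smul ℝ v, ← neg_one_smul ℝ v', D2_smul_left, D2_smul_right]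
  ring

theorem Setup.crit {α : ℝ} {u : E3 → ℝ} {b : Frame} (h : Setup α u b) (i : Fin 3) :
    fderiv ℝ u (b i) = 0 := by
  refine fderiv_eq_zero_of_frame b fun j => ?_
  rcases eq_or_ne j i with rfl | hj
  · exact fderiv_radial h.sol.hom _
  · exact (h.inv j).fderiv_normal (b.mem_S2 j) (b.inner_ne hj)

theorem Setup.inv_of_crit {α : ℝ} {u : E3 → ℝ} {b : Frame} (h : Setup α u b) {q : E3} (hq : q ∈ S2)
    (hc : fderiv ℝ u q = 0) : Inv u q :=
  h.sol.invariant_of_match h.lt h.le hq hc (by rw [even_fderiv h.even, hc, neg_zero])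
    fun v v' _ _ => (even_D2 h.sol.sm h.even (S2.ne_zero hq) v v').symm

theorem Setup.inv_of_eig {α : ℝ} {u : E3 → ℝ} {b : Frame} (h : Setup α u b) {q z : E3}
    (hq : q ∈ S2) (hz : z ∈ S2) (hqz : ⟪z, q⟫ = 0) (hc : fderiv ℝ u q = 0) (he : Eig u q z) :
    Inv u z :=
  h.sol.invariant_of_eig h.lt h.le hq hz hqz hc (by rw [even_fderiv h.even, hc, neg_zero]) he
    fun v => by simpa only [even_D2 h.sol.sm h.even (S2.ne_zero hq)] using he v

theorem Setup.axisym_of_umbilic {α : ℝ} {u : E3 → ℝ} {b : Frame} (h : Setup α u b) (d : Frame)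
    (hc : fderiv ℝ u (d 2) = 0) (h01 : D2 u (d 2) (d 0) (d 1) = 0)
    (h00 : D2 u (d 2) (d 0) (d 0) = D2 u (d 2) (d 1) (d 1)) : AxiallySymmetric u (d 2) := by
  intro x hx y hy hxy
  rcases eq_or_ne x y with rfl | hne
  · rfl
  have hq := d.mem_S2 2
  have hne0 := S2.ne_zero hq
  have hsub : x - y ≠ 0 := sub_ne_zero.2 hne
  set z := ‖x - y‖⁻¹ • (x - y) with hzdef
  have hz : z ∈ S2 := by
    rw [mem_S2_iff, norm_smul, norm_inv, norm_norm, inv_mul_cancel₀ (norm_ne_zero_iff.2 hsub)]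
  have hzq : ⟪z, d 2⟫ = 0 := by
    rw [hzdef, real_inner_smul_left, inner_sub_left, hxy]; ring
  have heig : Eig u (d 2) z := by
    have key : ∀ v, D2 u (d 2) z v = ⟪z, v⟫ * D2 u (d 2) (d 1) (d 1) := by
      intro v
      have h10 : D2 u (d 2) (d 1) (d 0) = 0 := by rw [D2_symm h.sol.sm hne0, h01]
      conv_lhs => rw [d.expand z, d.expand v]
      rw [(D2_tangent h.sol.sm h.sol.hom hq hc _ _ _).1,
        (D2_tangent h.sol.sm h.sol.hom hq hc _ _ _).2]
      simp only [D2_add_left, D2_add_right, D2_smul_left, D2_smul_right, h01, h10, h00]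
      rw [d.inner_eq z v, real_inner_comm z (d 2), hzq]
      ring
    intro v
    rw [key v, key z, S2.inner_self hz]; ring
  have hinv := h.inv_of_eig hq hz hzq hc heig
  have hr : refl z x = y := by
    have hspan : (ℝ ∙ z) = (ℝ ∙ (x - y)) :=
      Submodule.span_singleton_smul_eq (IsUnit.mk0 _ (inv_ne_zero (norm_ne_zero_iff.2 hsub))) _
    simp only [refl, hspan]
    exact Submodule.reflection_sub (by rw [S2.norm hx, S2.norm hy])
  rw [← hr, hinv]

theorem Setup.axisym_of_crit {α : ℝ} {u : E3 → ℝ} {b : Frame} (h : Setup α u b) {q : E3}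
    (hq : q ∈ S2) (hc : fderiv ℝ u q = 0) (hne : ∀ i, q ≠ b i ∧ q ≠ -b i) :
    ∃ q' ∈ S2, AxiallySymmetric u q' := by
  obtain ⟨i, hi⟩ : ∃ i, ⟪b i, q⟫ ≠ 0 := by
    by_contra! h0
    have := b.expand q
    simp only [h0, zero_smul, add_zero] at this
    exact S2.ne_zero hq this
  set e := b i
  set c := ⟪e, q⟫ with hcdef
  have he : e ∈ S2 := b.mem_S2 i
  have hwt : wt e q = 1 - c ^ 2 := by rw [wt, S2.inner_self hq]
  have hpos : 0 < 1 - c ^ 2 := by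
    refine lt_of_le_of_ne (hwt ▸ wt_nonneg he q) fun h0 => ?_
    have h1 : (c - 1) * (c + 1) = 0 := by linarith
    rcases mul_eq_zero.1 h1 with h1 | h1
    · refine (hne i).1 ?_
      have : ⟪e, q⟫ = 1 := by linarith
      exact ((inner_eq_one_iff_of_norm_eq_one (S2.norm he) (S2.norm hq)).1 this).symm
    · refine (hne i).2 ?_
      have : ⟪e, -q⟫ = 1 := by rw [inner_neg_right]; linarith
      have := (inner_eq_one_iff_of_norm_eq_one (S2.norm he) (S2.norm (S2.neg hq))).1 this
      rw [show b i = -q from this, neg_neg]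
  set s := √(1 - c ^ 2)
  have hs : s ^ 2 = 1 - c ^ 2 := sq_sqrt hpos.le
  have hs0 : s ≠ 0 := (sqrt_pos.2 hpos).ne'
  set f := s⁻¹ • (q - c • e) with hf
  have hqe : q = c • e + s • f := by rw [hf, smul_smul, mul_inv_cancel₀ hs0]; module
  have hef : OPair e f := by
    refine ⟨S2.inner_self he, ?_, ?_⟩
    · simp only [hf, inner_smul_right, real_inner_smul_left, inner_sub_left, inner_sub_right,
        S2.inner_self he, S2.inner_self hq, ← hcdef, real_inner_comm e q]
      field_simp
      linarith
    · simp only [hf, inner_smul_right, inner_sub_right, S2.inner_self he, ← hcdef]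
      ring
  obtain ⟨d, d0, d1⟩ := exists_frame_pair hef
  set n := d 2
  have hn : n ∈ S2 := d.mem_S2 2
  have hn0 := S2.ne_zero hn
  have hen : ⟪e, n⟫ = 0 := by rw [← d0]; exact d.inner_ne (by decide)
  have hfn : ⟪f, n⟫ = 0 := by rw [← d1]; exact d.inner_ne (by decide)
  have hqn : ⟪q, n⟫ = 0 := by
    rw [hqe, inner_add_left, real_inner_smul_left, real_inner_smul_left, hen, hfn]; ring
  have hie : Inv u e := h.inv i
  have hiq : Inv u q := h.inv_of_crit hq hc
  have g1 := hie.fderiv_normal he hen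
  have g2 := hiq.fderiv_normal hq hqn
  have g3 := hie.D2_normal h.sol.sm he hn0 hen hef.inner
  have g3' : D2 u n f e = 0 := by rw [D2_symm h.sol.sm hn0, g3]
  have g4 : D2 u n q (-s • e + c • f) = 0 := by
    refine hiq.D2_normal h.sol.sm hq hn0 hqn ?_
    rw [hqe]
    simp only [inner_add_left, inner_add_right, real_inner_smul_left, inner_smul_right, hef.left,
      hef.right, hef.inner, hef.inner']
    ring
  have hcn : fderiv ℝ u n = 0 := by
    refine fderiv_eq_zero_of_frame d fun j => ?_
    fin_cases j
    · change fderiv ℝ u n (d 0) = 0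
      rw [d0, g1]
    · change fderiv ℝ u n (d 1) = 0
      rw [d1]
      rw [hqe, map_add, map_smul, map_smul, g1, smul_zero, zero_add, smul_eq_mul] at g2
      exact (mul_eq_zero.1 g2).resolve_left hs0
    · exact fderiv_radial h.sol.hom _
  refine ⟨n, hn, h.axisym_of_umbilic d hcn (by rw [d0, d1, g3]) ?_⟩
  rw [d0, d1]
  rw [hqe] at g4
  simp only [D2_add_left, D2_add_right, D2_smul_left, D2_smul_right, g3, g3'] at g4
  have : c * s * (D2 u n f f - D2 u n e e) = 0 := by linarith
  have := (mul_eq_zero.1 this).resolve_left (mul_ne_zero hi hs0)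
  change D2 u n e e = D2 u n f f
  linarith

/-- A function annihilated by the rotations about an axis is axially symmetric. -/
theorem axisym_of_K {u : E3 → ℝ} (hu : Sm u) (d : Frame)
    (h : ∀ x, x ≠ 0 → K (d 0) (d 1) u x = 0) : AxiallySymmetric u (d 2) := by
  intro x hx y hy hxy
  have hp := d.opair (show (0 : Fin 3) ≠ 1 by decide)
  have hx0 := S2.ne_zero hx
  have hconst : ∀ t, u (flow (d 0) (d 1) t x) = u x := by
    intro t
    have hd := fun t => hasDerivAt_comp_flow hu hp hx0 t
    have := is_const_of_deriv_eq_zero (fun t => (hd t).differentiableAt)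
      (fun t => by rw [(hd t).deriv, h _ (flow_ne_zero hp t hx0)]) t 0
    simpa [flow_zero] using this
  have hxy' : ⟪d 2, x⟫ = ⟪d 2, y⟫ := by rw [real_inner_comm, hxy, real_inner_comm]
  have hnx := S2.inner_self hx
  have hny := S2.inner_self hy
  rw [d.inner_eq] at hnx hny
  rw [← hxy'] at hny
  obtain ⟨t, ht1, ht2⟩ : ∃ t, cos t * ⟪d 0, x⟫ - sin t * ⟪d 1, x⟫ = ⟪d 0, y⟫ ∧
      sin t * ⟪d 0, x⟫ + cos t * ⟪d 1, x⟫ = ⟪d 1, y⟫ := by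
    generalize ⟪d 0, x⟫ = x0, ⟪d 1, x⟫ = x1, ⟪d 0, y⟫ = y0, ⟪d 1, y⟫ = y1 at *
    by_cases hr : x0 ^ 2 + x1 ^ 2 = 0
    · refine ⟨0, ?_⟩
      have a0 : x0 = 0 := by nlinarith
      have a1 : x1 = 0 := by nlinarith
      have b0 : y0 = 0 := by nlinarith
      have b1 : y1 = 0 := by nlinarith
      simp [a0, a1, b0, b1]
    · have hn : ‖(⟨(x0 * y0 + x1 * y1) / (x0 ^ 2 + x1 ^ 2),
          (x0 * y1 - x1 * y0) / (x0 ^ 2 + x1 ^ 2)⟩ : ℂ)‖ = 1 := by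
        have he : y0 ^ 2 + y1 ^ 2 = x0 ^ 2 + x1 ^ 2 := by linarith
        rw [← sq_eq_sq₀ (norm_nonneg _) zero_le_one, Complex.sq_norm, Complex.normSq_mk]
        field_simp
        linear_combination (x0 ^ 2 + x1 ^ 2) * he
      obtain ⟨t, ht⟩ := (Complex.norm_eq_one_iff _).1 hn
      have e1 := congrArg Complex.re ht
      have e2 := congrArg Complex.im ht
      rw [Complex.exp_ofReal_mul_I_re] at e1
      rw [Complex.exp_ofReal_mul_I_im] at e2
      simp only at e1 e2
      refine ⟨t, ?_, ?_⟩ <;> rw [e1, e2] <;> field_simp <;> ring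
  have : flow (d 0) (d 1) t x = y := by
    rw [d.expand (flow _ _ _ _), inner_left_flow hp, inner_right_flow hp, ht1, ht2]
    have : ⟪d 2, flow (d 0) (d 1) t x⟫ = ⟪d 2, y⟫ := by
      simp [flow, inner_add_right, inner_smul_right, d.inner_matrix, hxy']
    rw [this, ← d.expand]
  rw [← this, hconst]

theorem K_combo (b : Frame) (F : E3 → ℝ) (r s : ℝ) (x : E3) :
    r * K (b 1) (b 2) F x + s * K (b 0) (b 1) F x = K (b 1) (r • b 2 - s • b 0) F x := by
  simp only [K_apply, inner_sub_left, real_inner_smul_left, map_sub, map_smul, smul_eq_mul]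
  ring

theorem axisym_of_combo {u : E3 → ℝ} (hu : Sm u) (b : Frame) {r s : ℝ} (hrs : r ≠ 0 ∨ s ≠ 0)
    (h : ∀ x, x ≠ 0 → r * K (b 1) (b 2) u x + s * K (b 0) (b 1) u x = 0) :
    ∃ q ∈ S2, AxiallySymmetric u q := by
  have hpos : 0 < r ^ 2 + s ^ 2 := by
    rcases hrs with h | h <;> positivity
  set N := √(r ^ 2 + s ^ 2)
  have hN : N ^ 2 = r ^ 2 + s ^ 2 := sq_sqrt hpos.le
  have hN0 : N ≠ 0 := (sqrt_pos.2 hpos).ne'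
  have hp : OPair (b 1) (N⁻¹ • (r • b 2 - s • b 0)) := by
    refine ⟨b.inner_self 1, ?_, ?_⟩
    · simp only [inner_smul_right, real_inner_smul_left, inner_sub_left, inner_sub_right,
        b.inner_matrix]
      simp
      field_simp
      linarith
    · simp [inner_smul_right, inner_sub_right, b.inner_matrix]
  obtain ⟨d, d0, d1⟩ := exists_frame_pair hp
  refine ⟨d 2, d.mem_S2 2, axisym_of_K hu d fun x hx => ?_⟩
  have := h x hx
  rw [K_combo] at this
  rw [d0, d1, K_apply, real_inner_smul_left, map_smul, smul_eq_mul]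
  rw [K_apply] at this
  linear_combination N⁻¹ * this

/-! ### Odd functions and their quotients by a coordinate -/

/-- Oddness under the reflection in `e^⊥`. -/
def OddIn (e : E3) (φ : E3 → ℝ) : Prop := ∀ x, φ (refl e x) = -φ x

theorem OddIn.eq_zero {e : E3} (he : e ∈ S2) {φ : E3 → ℝ} (h : OddIn e φ) {x : E3}
    (hx : ⟪e, x⟫ = 0) : φ x = 0 := by
  have := h x
  rw [refl_of_inner he hx] at this
  linarith

theorem OddIn.combo {e : E3} {φ ψ : E3 → ℝ} (h : OddIn e φ) (h' : OddIn e ψ) (r s : ℝ) :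
    OddIn e fun x => r * φ x + s * ψ x := fun x => by simp only [h x, h' x]; ring

theorem OddIn.fderiv {e : E3} {φ : E3 → ℝ} (h : OddIn e φ) (x v : E3) :
    fderiv ℝ φ (refl e x) (refl e v) = -fderiv ℝ φ x v := by
  rw [← fderiv_comp_isometry, show (fun y => φ (refl e y)) = fun y => -φ y from funext h,
    fderiv_fun_neg]
  rfl

theorem OddIn.D2 {e : E3} {φ : E3 → ℝ} (hs : Sm φ) (h : OddIn e φ) {x : E3} (hx : x ≠ 0)
    (v v' : E3) : D2 φ (refl e x) (refl e v) (refl e v') = -D2 φ x v v' := by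
  rw [← D2_comp_isometry hs _ hx, show (fun y => φ (refl e y)) = fun y => -φ y from funext h]
  simp only [MeanField.D2]
  have : _root_.fderiv ℝ (fun y => -φ y) = fun y => -_root_.fderiv ℝ φ y :=
    funext fun y => fderiv_fun_neg
  rw [this, fderiv_fun_neg]
  rfl

theorem oddIn_K {u : E3 → ℝ} {a c : E3} (h : Inv u a) (ha : a ∈ S2) (hac : ⟪a, c⟫ = 0) :
    OddIn a (K a c u) := by
  intro x
  have h1 := congrFun (K_comp_isometry u (refl a) a c) x
  rw [show (fun y => u (refl a y)) = u from funext h, refl_self ha, refl_of_inner ha hac] at h1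
  rw [h1, K_apply, K_apply, map_neg, inner_neg_left]; ring

theorem evenIn_K {u : E3 → ℝ} {a c e : E3} (h : Inv u e) (he : e ∈ S2) (ha : ⟪e, a⟫ = 0)
    (hc : ⟪e, c⟫ = 0) : Inv (K a c u) e := by
  intro x
  have h1 := congrFun (K_comp_isometry u (refl e) a c) x
  rw [show (fun y => u (refl e y)) = u from funext h, refl_of_inner he ha,
    refl_of_inner he hc] at h1
  exact h1.symm

/-- The quotient of `w` by the coordinate `⟪e, ·⟫`, extended by the normal derivative. -/
def quo (e : E3) (w : E3 → ℝ) (v : E3) : ℝ :=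
  open Classical in if ⟪e, v⟫ = 0 then fderiv ℝ w v e else w v / ⟪e, v⟫

theorem quo_of_eq {e v : E3} (w : E3 → ℝ) (h : ⟪e, v⟫ = 0) : quo e w v = fderiv ℝ w v e := if_pos h

theorem quo_of_ne {e v : E3} (w : E3 → ℝ) (h : ⟪e, v⟫ ≠ 0) : quo e w v = w v / ⟪e, v⟫ := if_neg h

theorem mul_quo {e : E3} {w : E3 → ℝ} (h0 : ∀ v, ⟪e, v⟫ = 0 → w v = 0) (v : E3) :
    ⟪e, v⟫ * quo e w v = w v := by
  by_cases h : ⟪e, v⟫ = 0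
  · rw [h, h0 v h, zero_mul]
  · rw [quo_of_ne w h, mul_div_cancel₀ _ h]

theorem quo_combo {e v : E3} {w w' : E3 → ℝ} (hw : Sm w) (hw' : Sm w') (hv : v ≠ 0) (r s : ℝ) :
    quo e (fun x => r * w x + s * w' x) v = r * quo e w v + s * quo e w' v := by
  by_cases h : ⟪e, v⟫ = 0
  · rw [quo_of_eq _ h, quo_of_eq _ h, quo_of_eq _ h,
      fderiv_fun_add ((hw.const_mul r).differentiableAt hv) ((hw'.const_mul s).differentiableAt hv),
      fderiv_const_mul (hw.differentiableAt hv), fderiv_const_mul (hw'.differentiableAt hv)]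
    simp
  · rw [quo_of_ne _ h, quo_of_ne _ h, quo_of_ne _ h]; ring

theorem quo_continuousAt {e : E3} (he : e ∈ S2) {w : E3 → ℝ} (hw : Sm w)
    (h0 : ∀ v, ⟪e, v⟫ = 0 → w v = 0) {v : E3} (hv : v ≠ 0) : ContinuousAt (quo e w) v := by
  have hin : Continuous fun x : E3 => ⟪e, x⟫ := (innerSL ℝ e).continuous
  by_cases h : ⟪e, v⟫ = 0
  · rw [Metric.continuousAt_iff]
    intro ε hε
    have hcd : ContinuousAt (fderiv ℝ w) v := (hw.contDiffAt_fderiv hv).continuousAt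
    obtain ⟨δ, hδ, hδ'⟩ := Metric.eventually_nhds_iff_ball.1
      ((Metric.tendsto_nhds.1 hcd (ε / 2) (half_pos hε)).and
        (isOpen_compl_singleton.mem_nhds hv))
    refine ⟨δ / 2, half_pos hδ, fun {x} hx => ?_⟩
    rw [quo_of_eq w h, Real.dist_eq]
    have hxδ : x ∈ Metric.ball v δ := Metric.mem_ball.2 (by linarith)
    have hop : ∀ y ∈ Metric.ball v δ, ‖fderiv ℝ w y - fderiv ℝ w v‖ ≤ ε / 2 := fun y hy => by
      have := (hδ' y hy).1
      rw [dist_eq_norm] at this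
      exact this.le
    by_cases hxe : ⟪e, x⟫ = 0
    · rw [quo_of_eq w hxe, ← sub_apply, ← Real.norm_eq_abs]
      refine ((fderiv ℝ w x - fderiv ℝ w v).le_opNorm e).trans_lt ?_
      rw [S2.norm he, mul_one]
      linarith [hop x hxδ]
    · set y := x - ⟪e, x⟫ • e with hy
      have hye : ⟪e, y⟫ = 0 := by
        rw [hy, inner_sub_right, inner_smul_right, S2.inner_self he]; ring
      have hxv : |⟪e, x⟫| ≤ ‖x - v‖ := by
        have := abs_real_inner_le_norm e (x - v)
        rwa [inner_sub_right, h, sub_zero, S2.norm he, one_mul] at this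
      have hyδ : y ∈ Metric.ball v δ := by
        rw [Metric.mem_ball, dist_eq_norm, hy, sub_right_comm]
        refine (norm_sub_le _ _).trans_lt ?_
        rw [norm_smul, S2.norm he, mul_one, Real.norm_eq_abs]
        rw [dist_eq_norm] at hx
        linarith
      have key := (convex_ball v δ).norm_image_sub_le_of_norm_fderiv_le' (𝕜 := ℝ) (f := w)
        (φ := fderiv ℝ w v) (C := ε / 2)
        (fun z hz => hw.differentiableAt (hδ' z hz).2) hop hyδ hxδ
      have hxy : x - y = ⟪e, x⟫ • e := by rw [hy]; abel
      rw [hxy, h0 y hye, norm_smul, S2.norm he, mul_one, map_smul, sub_zero, smul_eq_mul,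
        Real.norm_eq_abs, Real.norm_eq_abs] at key
      have hpos : 0 < |⟪e, x⟫| := abs_pos.2 hxe
      rw [quo_of_ne w hxe]
      have e1 : w x / ⟪e, x⟫ - fderiv ℝ w v e = (w x - ⟪e, x⟫ * fderiv ℝ w v e) / ⟪e, x⟫ := by
        field_simp
      rw [e1, abs_div, div_lt_iff₀ hpos]
      nlinarith
  · have : quo e w =ᶠ[𝓝 v] fun x => w x / ⟪e, x⟫ := by
      filter_upwards [hin.continuousAt.eventually_ne h] with x hx using quo_of_ne w hx
    exact ((hw.continuousAt hv).div hin.continuousAt h).congr this.symm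

/-- Non-negativity of the quotient extends to the boundary. -/
theorem quo_nonneg {e : E3} (he : e ∈ S2) {w : E3 → ℝ} (hw : Sm w)
    (h0 : ∀ v, ⟪e, v⟫ = 0 → w v = 0) {v : E3} (hv : v ≠ 0) (hve : 0 ≤ ⟪e, v⟫)
    (h : ∀ t : ℝ, 0 < t → 0 ≤ w (v + t • e)) : 0 ≤ quo e w v := by
  have h1 : Tendsto (fun t : ℝ => quo e w (v + t • e)) (𝓝[>] 0) (𝓝 (quo e w v)) := by
    have hc : ContinuousAt (fun t : ℝ => v + t • e) 0 := by fun_prop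
    have := ContinuousAt.comp (g := quo e w) (f := fun t : ℝ => v + t • e) (x := 0)
      (by simpa using quo_continuousAt he hw h0 hv) hc
    have h2 := this.tendsto.mono_left (nhdsWithin_le_nhds (s := Set.Ioi 0))
    simpa [Function.comp_def] using h2
  refine ge_of_tendsto h1 ?_
  filter_upwards [self_mem_nhdsWithin] with t ht
  have ht' : (0 : ℝ) < t := ht
  have hpos : 0 < ⟪e, v + t • e⟫ := by
    rw [inner_add_right, inner_smul_right, S2.inner_self he]; linarith
  rw [quo_of_ne w hpos.ne']
  exact div_nonneg (h t ht) hpos.le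

/-! ### Solutions without axis: arcs of the coordinate circles and flat points -/

/-- A solution with three reflection symmetries, without symmetry axis and with ordered values at
the endpoints of the frame. -/
structure Asym (α : ℝ) (u : E3 → ℝ) (b : Frame) : Prop extends Setup α u b where
  noaxis : ¬∃ q ∈ S2, AxiallySymmetric u q
  le01 : u (b 0) ≤ u (b 1)
  le12 : u (b 1) ≤ u (b 2)

theorem Setup.exists_asym {α : ℝ} {u : E3 → ℝ} {b : Frame} (h : Setup α u b)
    (hn : ¬∃ q ∈ S2, AxiallySymmetric u q) : ∃ d, Asym α u d := by
  have hm := Tuple.monotone_sort fun i => u (b i)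
  refine ⟨b.reindex (Tuple.sort fun i => u (b i)).symm, h.reindex _, hn, ?_, ?_⟩
  · simpa using hm (show (0 : Fin 3) ≤ 1 by decide)
  · simpa using hm (show (1 : Fin 3) ≤ 2 by decide)

section
variable {α : ℝ} {u : E3 → ℝ} {b : Frame}

theorem Asym.crit_axis (h : Asym α u b) {q : E3} (hq : q ∈ S2) (hc : fderiv ℝ u q = 0) :
    ∃ i, q = b i ∨ q = -b i := by
  by_contra! hne
  exact h.noaxis (h.axisym_of_crit hq hc hne)

theorem Asym.K_ne_zero (h : Asym α u b) {i j : Fin 3} (hij : i ≠ j) {c s : ℝ} (hc : c ≠ 0)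
    (hs : s ≠ 0) (hcs : c ^ 2 + s ^ 2 = 1) : K (b i) (b j) u (c • b i + s • b j) ≠ 0 := by
  intro hK
  set q := c • b i + s • b j with hqdef
  have hi : ⟪b i, q⟫ = c := by
    simp [hqdef, inner_add_right, inner_smul_right, b.inner_matrix, hij,
      -inner_self_eq_norm_sq_to_K]
  have hj : ⟪b j, q⟫ = s := by
    simp [hqdef, inner_add_right, inner_smul_right, b.inner_matrix, hij.symm,
      -inner_self_eq_norm_sq_to_K]
  have hk : ∀ k, k ≠ i → k ≠ j → ⟪b k, q⟫ = 0 := fun k h1 h2 => by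
    simp [hqdef, inner_add_right, inner_smul_right, b.inner_matrix, h1, h2]
  have hq : q ∈ S2 := by
    rw [mem_S2_iff, ← pow_left_inj₀ (norm_nonneg _) zero_le_one two_ne_zero,
      ← real_inner_self_eq_norm_sq]
    have : ⟪q, q⟫ = ⟪c • b i + s • b j, q⟫ := rfl
    rw [this, inner_add_left, real_inner_smul_left, real_inner_smul_left, hi, hj]
    linarith
  rw [K_apply, hi, hj] at hK
  have hrad := fderiv_radial h.sol.hom q
  conv at hrad => enter [1, 2]; rw [hqdef]
  rw [map_add, map_smul, map_smul, smul_eq_mul, smul_eq_mul] at hrad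
  have hcr : fderiv ℝ u q = 0 := by
    refine fderiv_eq_zero_of_frame b fun k => ?_
    by_cases h1 : k = i
    · subst h1; linear_combination c * hrad - s * hK - fderiv ℝ u q (b k) * hcs
    by_cases h2 : k = j
    · subst h2; linear_combination s * hrad + c * hK - fderiv ℝ u q (b k) * hcs
    exact (h.inv k).fderiv_normal (b.mem_S2 k) (hk k h1 h2)
  obtain ⟨k, hk' | hk'⟩ := h.crit_axis hq hcr
  all_goals
    rw [hk'] at hi hj
    simp only [inner_neg_right, b.inner_matrix] at hi hj
    rcases eq_or_ne i k with rfl | h1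
    · rw [if_neg hij.symm] at hj; exact hs (by linarith)
    · rw [if_neg h1] at hi; exact hc (by linarith)

theorem flow_left {a c : E3} (h : OPair a c) (t : ℝ) : flow a c t a = cos t • a + sin t • c := by
  rw [flow, h.left, h.inner']; module

theorem Asym.arc (h : Asym α u b) {i j : Fin 3} (hij : i ≠ j) (hle : u (b i) ≤ u (b j)) {c s : ℝ}
    (hc : 0 < c) (hs : 0 < s) : 0 < K (b i) (b j) u (c • b i + s • b j) := by
  have hp := b.opair hij
  set w := K (b i) (b j) u with hw
  have hws : Sm w := h.sol.sm.K _ _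
  have hb0 : b i ≠ 0 := S2.ne_zero (b.mem_S2 i)
  have hd := fun t => hasDerivAt_comp_flow h.sol.sm hp hb0 t
  have hcont : Continuous fun t => w (flow (b i) (b j) t (b i)) :=
    continuous_iff_continuousAt.2 fun t => (hasDerivAt_comp_flow hws hp hb0 t).continuousAt
  have hne : ∀ t ∈ Set.Ioo 0 (π / 2), w (flow (b i) (b j) t (b i)) ≠ 0 := fun t ht => by
    rw [flow_left hp]
    exact h.K_ne_zero hij (cos_pos_of_mem_Ioo ⟨by linarith [ht.1, pi_pos], ht.2⟩).ne'
      (sin_pos_of_pos_of_lt_pi ht.1 (by linarith [ht.2, pi_pos])).ne' (cos_sq_add_sin_sq t)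
  have hpos : ∀ t ∈ Set.Ioo 0 (π / 2), 0 < w (flow (b i) (b j) t (b i)) := by
    by_contra! hex
    obtain ⟨t₀, ht₀, hle₀⟩ := hex
    have hneg : ∀ t ∈ Set.Ioo 0 (π / 2), w (flow (b i) (b j) t (b i)) < 0 := by
      intro t ht
      by_contra! hge
      obtain ⟨r, hr, hr0⟩ := isPreconnected_Ioo.intermediate_value ht₀ ht hcont.continuousOn
        (Set.mem_Icc.2 ⟨hle₀, hge⟩)
      exact hne r hr hr0
    have hanti : StrictAntiOn (fun t => u (flow (b i) (b j) t (b i))) (Set.Icc 0 (π / 2)) := by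
      refine strictAntiOn_of_deriv_neg (convex_Icc _ _)
        (fun t _ => (hd t).continuousAt.continuousWithinAt) fun t ht => ?_
      rw [interior_Icc] at ht
      rw [(hd t).deriv]
      exact hneg t ht
    have := hanti (Set.left_mem_Icc.2 pi_div_two_pos.le) (Set.right_mem_Icc.2 pi_div_two_pos.le)
      pi_div_two_pos
    simp only [flow_left hp, cos_zero, sin_zero, cos_pi_div_two, sin_pi_div_two, one_smul,
      zero_smul, add_zero, zero_add] at this
    linarith
  set t := arctan (s / c) with ht
  have ht0 : 0 < t := arctan_pos.2 (div_pos hs hc)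
  have hct : 0 < cos t := cos_arctan_pos _
  have hst : s * cos t = c * sin t := by
    have := tan_arctan (s / c)
    rw [← ht, tan_eq_sin_div_cos, div_eq_div_iff hct.ne' hc.ne'] at this
    linarith
  have e : c • b i + s • b j = (c / cos t) • flow (b i) (b j) t (b i) := by
    rw [flow_left hp, smul_add, smul_smul, smul_smul, div_mul_cancel₀ _ hct.ne',
      div_mul_eq_mul_div, ← hst, mul_div_cancel_right₀ _ hct.ne']
  rw [e, hw, K_hom0 h.sol.hom _ _ _ _ (div_pos hc hct)]
  exact hpos t ⟨ht0, arctan_lt_pi_div_two _⟩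

theorem D2_eq_zero_of_frame {F : E3 → ℝ} (d : Frame) {x : E3}
    (h : ∀ i j, D2 F x (d i) (d j) = 0) (v v' : E3) : D2 F x v v' = 0 := by
  rw [d.expand v, d.expand v']
  simp only [D2_add_left, D2_add_right, D2_smul_left, D2_smul_right, h]
  ring

theorem OddIn.fderiv_eq_zero {e : E3} (he : e ∈ S2) {φ : E3 → ℝ} (h : OddIn e φ) {x v : E3}
    (hx : ⟪e, x⟫ = 0) (hv : ⟪e, v⟫ = 0) : _root_.fderiv ℝ φ x v = 0 := by
  have := h.fderiv x v
  rw [refl_of_inner he hx, refl_of_inner he hv] at this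
  linarith

theorem OddIn.D2_eq_zero {e : E3} (he : e ∈ S2) {φ : E3 → ℝ} (hs : Sm φ) (h : OddIn e φ) {x v v' : E3}
    (hx0 : x ≠ 0) (hx : ⟪e, x⟫ = 0) (hv : ⟪e, v⟫ = 0) (hv' : ⟪e, v'⟫ = 0) :
    MeanField.D2 φ x v v' = 0 := by
  have := h.D2 hs hx0 v v'
  rw [refl_of_inner he hx, refl_of_inner he hv, refl_of_inner he hv'] at this
  linarith

theorem OddIn.D2_self {e : E3} (he : e ∈ S2) {φ : E3 → ℝ} (hs : Sm φ) (h : OddIn e φ) {x : E3}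
    (hx0 : x ≠ 0) (hx : ⟪e, x⟫ = 0) : MeanField.D2 φ x e e = 0 := by
  have := h.D2 hs hx0 e e
  rw [refl_of_inner he hx, refl_self he, ← neg_one_smul ℝ e, D2_smul_left, D2_smul_right] at this
  linarith

theorem Asym.oddIn (h : Asym α u b) {i j : Fin 3} (hij : i ≠ j) : OddIn (b i) (K (b i) (b j) u) :=
  oddIn_K (h.inv i) (b.mem_S2 i) (b.inner_ne hij)

theorem Asym.oddIn' (h : Asym α u b) {i j : Fin 3} (hij : i ≠ j) : OddIn (b j) (K (b i) (b j) u) := by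
  intro x
  rw [K_swap]
  exact congrArg Neg.neg (h.oddIn hij.symm x)

theorem Asym.K_even (h : Asym α u b) (a c x : E3) : K a c u (-x) = K a c u x := by
  simp only [K_apply, even_fderiv h.even, inner_neg_right, neg_apply]
  ring

/-- The combination of the two rotation derivatives whose planes contain `b 1`. -/
def comb (b : Frame) (u : E3 → ℝ) (r s : ℝ) (x : E3) : ℝ :=
  r * K (b 1) (b 2) u x + s * K (b 0) (b 1) u x

theorem Asym.comb_odd (h : Asym α u b) (r s : ℝ) : OddIn (b 1) (comb b u r s) :=
  (h.oddIn (by decide)).combo (h.oddIn' (by decide)) r s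

theorem Asym.comb_even (h : Asym α u b) (r s : ℝ) (x : E3) :
    comb b u r s (-x) = comb b u r s x := by
  simp only [comb, h.K_even]

theorem Asym.comb_ker (h : Asym α u b) (r s : ℝ) : Ker u (comb b u r s) :=
  (h.sol.ker _ _).combo (h.sol.ker _ _) r s

theorem Asym.not_flat2 (h : Asym α u b) {r s : ℝ} (hrs : r ≠ 0 ∨ s ≠ 0) {x : E3} (hx : x ∈ S2)
    (hy : ⟪b 1, x⟫ ≠ 0) (hxz : x ≠ ⟪b 1, x⟫ • b 1) : ¬Flat2 (comb b u r s) x := by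
  rintro ⟨hf0, hf1⟩
  have hb := b.mem_S2 1
  have hodd := h.comb_odd r s
  have hev := h.comb_even r s
  have hneg : ∀ {x}, Flat2 (comb b u r s) x → Flat2 (comb b u r s) (-x) := fun {x} hx =>
    ⟨by rw [hev, hx.1], by rw [even_fderiv hev, hx.2, neg_zero]⟩
  have hr : Flat2 (comb b u r s) (refl (b 1) x) := by
    refine ⟨by rw [hodd x, hf0, neg_zero], ?_⟩
    ext v
    have := hodd.fderiv x ((refl (b 1)).symm v)
    rw [LinearIsometryEquiv.apply_symm_apply, hf1] at this
    simpa using this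
  have hrS : refl (b 1) x ∈ S2 := by
    rw [mem_S2_iff, LinearIsometryEquiv.norm_map, S2.norm hx]
  refine h.noaxis (axisym_of_combo h.sol.sm b hrs fun y hy0 =>
    Ker.eq_zero_of_flat2 h.sol h.lt h.le (h.comb_ker r s) hx hrS ?_ ?_ ⟨hf0, hf1⟩
      (hneg ⟨hf0, hf1⟩) hr (hneg hr) hy0)
  · intro he
    have := congrArg (fun y => ⟪b 1, y⟫) he
    simp only [refl_apply hb, inner_sub_right, inner_smul_right, b.inner_self] at this
    exact hy (by linarith)
  · intro he
    rw [refl_apply hb] at he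
    refine hxz ?_
    have h2 : (2 : ℝ) • x = (2 : ℝ) • (⟪b 1, x⟫ • b 1) := by
      have : (2 : ℝ) • x = x - -x := by module
      rw [this]
      nth_rw 1 [he]
      module
    exact smul_right_injective _ (two_ne_zero (α := ℝ)) h2

theorem Asym.not_flat_of_inner_eq_zero (h : Asym α u b) {r s : ℝ} (hrs : r ≠ 0 ∨ s ≠ 0) {x : E3}
    (hx : x ∈ S2) (hy : ⟪b 1, x⟫ = 0) (h1 : fderiv ℝ (comb b u r s) x (b 1) = 0)
    (h2 : D2 (comb b u r s) x (rot (b 0) (b 2) x) (b 1) = 0) : False := by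
  have hb := b.mem_S2 1
  have hx0 := S2.ne_zero hx
  have hodd := h.comb_odd r s
  have hev := h.comb_even r s
  have hker := h.comb_ker r s
  have e01 : ⟪b 1, b 0⟫ = 0 := b.inner_ne (by decide)
  have e21 : ⟪b 1, b 2⟫ = 0 := b.inner_ne (by decide)
  have hf1 : fderiv ℝ (comb b u r s) x = 0 := fderiv_eq_zero_of_frame b fun i => by
    fin_cases i
    · exact hodd.fderiv_eq_zero hb hy e01
    · exact h1
    · exact hodd.fderiv_eq_zero hb hy e21
  have hrad : D2 (comb b u r s) x x (b 1) = 0 := by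
    rw [D2_symm hker.sm hx0, D2_radial hker.hom hker.sm hx0, h1, neg_zero]
  have hxe := b.expand x
  rw [hy, zero_smul, add_zero] at hxe
  have hn : ⟪b 0, x⟫ ^ 2 + ⟪b 2, x⟫ ^ 2 = 1 := by
    have := b.inner_eq x x
    rw [S2.inner_self hx, hy] at this
    linarith
  rw [rot_apply, D2_sub_left, D2_smul_left, D2_smul_left] at h2
  conv at hrad => enter [1, 3]; rw [hxe]
  rw [D2_add_left, D2_smul_left, D2_smul_left] at hrad
  have h01 : D2 (comb b u r s) x (b 0) (b 1) = 0 := by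
    linear_combination ⟪b 0, x⟫ * hrad - ⟪b 2, x⟫ * h2 - D2 (comb b u r s) x (b 0) (b 1) * hn
  have h21 : D2 (comb b u r s) x (b 2) (b 1) = 0 := by
    linear_combination ⟪b 2, x⟫ * hrad + ⟪b 0, x⟫ * h2 - D2 (comb b u r s) x (b 2) (b 1) * hn
  have hD : ∀ v v', D2 (comb b u r s) x v v' = 0 := D2_eq_zero_of_frame b fun i j => by
    fin_cases i <;> fin_cases j
    · exact hodd.D2_eq_zero hb hker.sm hx0 hy e01 e01
    · exact h01
    · exact hodd.D2_eq_zero hb hker.sm hx0 hy e01 e21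
    · exact (D2_symm hker.sm hx0 _ _).trans h01
    · exact hodd.D2_self hb hker.sm hx0 hy
    · exact (D2_symm hker.sm hx0 _ _).trans h21
    · exact hodd.D2_eq_zero hb hker.sm hx0 hy e21 e01
    · exact h21
    · exact hodd.D2_eq_zero hb hker.sm hx0 hy e21 e21
  have hf0 : comb b u r s x = 0 := hodd.eq_zero hb hy
  refine h.noaxis (axisym_of_combo h.sol.sm b hrs fun y hy0 =>
    Ker.eq_zero_of_flat3 h.sol h.lt h.le hker hx ⟨⟨hf0, hf1⟩, hD⟩
      ⟨⟨by rw [hev, hf0], by rw [even_fderiv hev, hf1, neg_zero]⟩, fun v v' => ?_⟩ hy0)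
  rw [even_D2 hker.sm hev hx0, hD]

theorem Asym.D2_ne_zero (h : Asym α u b) {i j k : Fin 3} (hij : i ≠ j) (hki : k ≠ i) (hkj : k ≠ j) :
    D2 u (b i) (b j) (b j) ≠ 0 := by
  intro h0
  have hi0 := S2.ne_zero (b.mem_S2 i)
  have hk0 := S2.ne_zero (b.mem_S2 k)
  set w := K (b i) (b j) u with hw
  have hneg : ∀ {x}, Flat2 w x → Flat2 w (-x) := fun {x} hx =>
    ⟨(h.K_even _ _ _).trans hx.1, by rw [even_fderiv (h.K_even _ _), hx.2, neg_zero]⟩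
  have hi : Flat2 w (b i) := by
    refine ⟨by rw [hw, K_apply, h.crit i]; simp, ?_⟩
    have hrot : rot (b i) (b j) (b i) = b j := by
      rw [rot_apply, b.inner_self, b.inner_ne hij.symm]; module
    refine fderiv_eq_zero_of_frame b fun m => ?_
    rw [fderiv_K h.sol.sm hi0, h.crit i, hrot, zero_apply, add_zero]
    by_cases hmi : m = i
    · rw [hmi, D2_symm h.sol.sm hi0, D2_radial h.sol.hom h.sol.sm hi0, h.crit i]; simp
    by_cases hmj : m = j
    · rw [hmj, h0]
    exact (h.inv m).D2_normal h.sol.sm (b.mem_S2 m) hi0 (b.inner_ne hmi) (b.inner_ne hmj)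
  have hk : Flat2 w (b k) := by
    refine ⟨by rw [hw, K_apply, h.crit k]; simp, ?_⟩
    have hrot : rot (b i) (b j) (b k) = 0 := by
      rw [rot_apply, b.inner_ne hki.symm, b.inner_ne hkj.symm]; module
    ext v
    rw [fderiv_K h.sol.sm hk0, h.crit k, hrot]
    simp [D2]
  have hne : ∀ c : ℝ, b i ≠ c • b k := fun c hc => by
    have := congrArg (fun y => ⟪b i, y⟫) hc
    simp only [inner_smul_right, b.inner_self, b.inner_ne hki.symm] at this
    linarith
  obtain ⟨d, d0, d1⟩ := exists_frame_pair (b.opair hij)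
  refine h.noaxis ⟨d 2, d.mem_S2 2, axisym_of_K h.sol.sm d fun x hx => ?_⟩
  rw [d0, d1]
  exact Ker.eq_zero_of_flat2 h.sol h.lt h.le (h.sol.ker _ _) (b.mem_S2 i) (b.mem_S2 k)
    (by simpa using hne 1) (by simpa using hne (-1)) hi (hneg hi) hk (hneg hk) hx

theorem Asym.K12_zero (h : Asym α u b) {v : E3} (hv : ⟪b 2, v⟫ = 0) : K (b 1) (b 2) u v = 0 :=
  (h.oddIn' (by decide)).eq_zero (b.mem_S2 2) hv

theorem Asym.K01_zero (h : Asym α u b) {v : E3} (hv : ⟪b 0, v⟫ = 0) : K (b 0) (b 1) u v = 0 :=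
  (h.oddIn (by decide)).eq_zero (b.mem_S2 0) hv

theorem Asym.quo12_pos (h : Asym α u b) : 0 < quo (b 2) (K (b 1) (b 2) u) (b 1) := by
  have h1 := S2.ne_zero (b.mem_S2 1)
  have e21 : ⟪b 2, b 1⟫ = 0 := b.inner_ne (by decide)
  refine lt_of_le_of_ne (quo_nonneg (b.mem_S2 2) (h.sol.sm.K _ _) (fun v => h.K12_zero) h1 e21.ge
    fun t ht => ?_) fun h0 => ?_
  · simpa using (h.arc (show (1 : Fin 3) ≠ 2 by decide) h.le12 one_pos ht).le
  · rw [quo_of_eq _ e21, fderiv_K h.sol.sm h1, h.crit 1, rot_apply, b.inner_self, e21] at h0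
    refine h.D2_ne_zero (i := 1) (j := 2) (k := 0) (by decide) (by decide) (by decide) ?_
    simpa using h0.symm

theorem Asym.quo01_pos (h : Asym α u b) : 0 < quo (b 0) (K (b 0) (b 1) u) (b 1) := by
  have h1 := S2.ne_zero (b.mem_S2 1)
  have e01 : ⟪b 0, b 1⟫ = 0 := b.inner_ne (by decide)
  refine lt_of_le_of_ne (quo_nonneg (b.mem_S2 0) (h.sol.sm.K _ _) (fun v => h.K01_zero) h1 e01.ge
    fun t ht => ?_) fun h0 => ?_
  · simpa [add_comm] using (h.arc (show (0 : Fin 3) ≠ 1 by decide) h.le01 ht one_pos).le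
  · rw [quo_of_eq _ e01, fderiv_K h.sol.sm h1, h.crit 1, rot_apply, b.inner_self, e01,
      zero_smul, zero_sub, one_smul, ← neg_one_smul ℝ (b 0), D2_smul_right] at h0
    refine h.D2_ne_zero (i := 1) (j := 0) (k := 2) (by decide) (by decide) (by decide) ?_
    simpa using h0.symm

/-- Both rotation derivatives are non-negative in a cone around `b 1`. -/
theorem Asym.exists_cone (h : Asym α u b) : ∃ δ : ℝ, 0 < δ ∧ ∀ v : E3, 0 ≤ ⟪b 0, v⟫ →
    0 ≤ ⟪b 2, v⟫ → 0 < ⟪b 1, v⟫ → ⟪b 0, v⟫ + ⟪b 2, v⟫ ≤ δ * ⟪b 1, v⟫ →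
      (0 < ⟪b 2, v⟫ → 0 < K (b 1) (b 2) u v) ∧ (0 < ⟪b 0, v⟫ → 0 < K (b 0) (b 1) u v) := by
  have h1 := S2.ne_zero (b.mem_S2 1)
  have c1 := quo_continuousAt (b.mem_S2 2) (h.sol.sm.K (b 1) (b 2)) (fun v => h.K12_zero) h1
  have c2 := quo_continuousAt (b.mem_S2 0) (h.sol.sm.K (b 0) (b 1)) (fun v => h.K01_zero) h1
  obtain ⟨r, hr, hball⟩ := Metric.eventually_nhds_iff_ball.1
    ((c1.eventually_const_lt h.quo12_pos).and (c2.eventually_const_lt h.quo01_pos))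
  refine ⟨r / 2, half_pos hr, fun v hx hz hy hle => ?_⟩
  set x := ⟪b 0, v⟫ with hxd
  set y := ⟪b 1, v⟫ with hyd
  set z := ⟪b 2, v⟫ with hzd
  have hv' : y⁻¹ • v = b 1 + ((x / y) • b 0 + (z / y) • b 2) := by
    conv_lhs => rw [b.expand v, ← hxd, ← hyd, ← hzd]
    rw [smul_add, smul_add, smul_smul, smul_smul, smul_smul, inv_mul_cancel₀ hy.ne']
    rw [div_eq_inv_mul, div_eq_inv_mul]
    module
  have hmem : y⁻¹ • v ∈ Metric.ball (b 1) r := by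
    rw [Metric.mem_ball, dist_eq_norm, hv', add_sub_cancel_left]
    refine (norm_add_le _ _).trans_lt ?_
    rw [norm_smul, norm_smul, S2.norm (b.mem_S2 0), S2.norm (b.mem_S2 2), mul_one, mul_one,
      Real.norm_of_nonneg (div_nonneg hx hy.le), Real.norm_of_nonneg (div_nonneg hz hy.le),
      ← add_div]
    have := (div_le_iff₀ hy).2 hle
    linarith
  obtain ⟨p1, p2⟩ := hball _ hmem
  constructor
  · intro hz0
    have := mul_quo (e := b 2) (w := K (b 1) (b 2) u) (fun v => h.K12_zero) (y⁻¹ • v)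
    rw [K_hom0 h.sol.hom _ _ _ _ (inv_pos.2 hy)] at this
    rw [← this, inner_smul_right]
    exact mul_pos (mul_pos (inv_pos.2 hy) hz0) p1
  · intro hx0
    have := mul_quo (e := b 0) (w := K (b 0) (b 1) u) (fun v => h.K01_zero) (y⁻¹ • v)
    rw [K_hom0 h.sol.hom _ _ _ _ (inv_pos.2 hy)] at this
    rw [← this, inner_smul_right]
    exact mul_pos (mul_pos (inv_pos.2 hy) hx0) p2

end

/-! ### Polar angles and the sign of the rotation derivatives -/

theorem exists_polar_lift {U : Set E3} (hU : Convex ℝ U) (hUo : IsOpen U) {A B : E3 → ℝ}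
    (hA : ContinuousOn A U) (hB : ContinuousOn B U) (hne : ∀ v ∈ U, A v = 0 → B v = 0 → False)
    {v₀ : E3} (hv₀ : v₀ ∈ U) (hA₀ : 0 ≤ A v₀) (hB₀ : 0 ≤ B v₀) :
    ∃ ρ θ : E3 → ℝ, ContinuousOn θ U ∧
      (∀ v ∈ U, 0 < ρ v ∧ A v = ρ v * cos (θ v) ∧ B v = ρ v * sin (θ v)) ∧
      θ v₀ ∈ Set.Icc 0 (π / 2) := by
  have hsc : IsSimplyConnected U := by
    have := hU.contractibleSpace ⟨v₀, hv₀⟩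
    exact SimplyConnectedSpace.ofContractible U
  have hg : ContinuousOn (fun v => (⟨A v, B v⟩ : ℂ)) U :=
    Complex.equivRealProdCLM.symm.continuous.comp_continuousOn (hA.prodMk hB)
  obtain ⟨f, hf, hfe⟩ := Complex.exists_continuousOn_eqOn_exp_comp hsc hUo hg (by
    rintro ⟨v, hv, h0⟩
    exact hne v hv (congrArg Complex.re h0) (congrArg Complex.im h0))
  have hpol : ∀ v ∈ U, A v = Real.exp (f v).re * cos (f v).im ∧
      B v = Real.exp (f v).re * sin (f v).im := fun v hv => by
    have h := hfe hv
    constructor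
    · rw [← Complex.exp_re]; exact (congrArg Complex.re h).symm
    · rw [← Complex.exp_im]; exact (congrArg Complex.im h).symm
  set n := toIocDiv Real.two_pi_pos (-π) (f v₀).im
  have hmod : toIocMod Real.two_pi_pos (-π) (f v₀).im = (f v₀).im - n * (2 * π) := by
    rw [toIocMod, zsmul_eq_mul]
  have hmem := toIocMod_mem_Ioc Real.two_pi_pos (-π) (f v₀).im
  rw [hmod] at hmem
  refine ⟨fun v => Real.exp (f v).re, fun v => (f v).im - n * (2 * π),
    (Complex.continuous_im.comp_continuousOn hf).sub continuousOn_const,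
    fun v hv => ⟨Real.exp_pos _, ?_, ?_⟩, ?_⟩
  · rw [cos_sub_int_mul_two_pi]; exact (hpol v hv).1
  · rw [sin_sub_int_mul_two_pi]; exact (hpol v hv).2
  · have h1 : 0 ≤ cos ((f v₀).im - n * (2 * π)) := by
      rw [cos_sub_int_mul_two_pi]
      exact nonneg_of_mul_nonneg_right ((hpol v₀ hv₀).1 ▸ hA₀) (Real.exp_pos _)
    have h2 : 0 ≤ sin ((f v₀).im - n * (2 * π)) := by
      rw [sin_sub_int_mul_two_pi]
      exact nonneg_of_mul_nonneg_right ((hpol v₀ hv₀).2 ▸ hB₀) (Real.exp_pos _)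
    set t := (f v₀).im - n * (2 * π)
    constructor
    · by_contra! hlt
      exact absurd (sin_neg_of_neg_of_neg_pi_lt hlt hmem.1) (not_lt.2 h2)
    · by_contra! hlt
      refine absurd (cos_neg_of_pi_div_two_lt_of_lt hlt ?_) (not_lt.2 h1)
      linarith [hmem.2, pi_pos]

theorem quadrant_of_preconnected {S : Set E3} (hS : IsPreconnected S) {θ : E3 → ℝ}
    (hθ : ContinuousOn θ S) (hc : ∀ v ∈ S, 0 ≤ cos (θ v)) (hs : ∀ v ∈ S, 0 ≤ sin (θ v)) {v₀ : E3}
    (hv₀ : v₀ ∈ S) (h₀ : θ v₀ ∈ Set.Icc 0 (π / 2)) {v : E3} (hv : v ∈ S) :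
    θ v ∈ Set.Icc 0 (π / 2) := by
  have hpi := pi_pos
  constructor
  · by_contra! hlt
    obtain ⟨w, hw, hwe⟩ := hS.intermediate_value hv hv₀ hθ
      (show max (θ v) (-(π / 2)) ∈ Set.Icc (θ v) (θ v₀) from
        ⟨le_max_left _ _, max_le (hlt.le.trans h₀.1) (by linarith [h₀.1])⟩)
    have := hs w hw
    rw [hwe] at this
    refine absurd (sin_neg_of_neg_of_neg_pi_lt (max_lt hlt (by linarith)) ?_) (not_lt.2 this)
    exact lt_of_lt_of_le (by linarith) (le_max_right _ _)
  · by_contra! hlt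
    obtain ⟨w, hw, hwe⟩ := hS.intermediate_value hv₀ hv hθ
      (show min (θ v) π ∈ Set.Icc (θ v₀) (θ v) from
        ⟨le_min (h₀.2.trans hlt.le) (by linarith [h₀.2]), min_le_left _ _⟩)
    have := hc w hw
    rw [hwe] at this
    refine absurd (cos_neg_of_pi_div_two_lt_of_lt (lt_min hlt (by linarith)) ?_) (not_lt.2 this)
    exact lt_of_le_of_lt (min_le_right _ _) (by linarith)

theorem D2_combo {F G : E3 → ℝ} (hF : Sm F) (hG : Sm G) {x : E3} (hx : x ≠ 0) (r s : ℝ)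
    (v v' : E3) : D2 (fun y => r * F y + s * G y) x v v' = r * D2 F x v v' + s * D2 G x v v' := by
  have h : fderiv ℝ (fun y => r * F y + s * G y) =ᶠ[𝓝 x]
      fun y => r • fderiv ℝ F y + s • fderiv ℝ G y := by
    filter_upwards [isOpen_compl_singleton.mem_nhds hx] with y hy
    rw [fderiv_fun_add ((hF.const_mul r).differentiableAt hy)
      ((hG.const_mul s).differentiableAt hy), fderiv_const_mul (hF.differentiableAt hy),
      fderiv_const_mul (hG.differentiableAt hy)]
  have e := (((hF.differentiableAt_fderiv hx).hasFDerivAt.const_smul r).add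
    ((hG.differentiableAt_fderiv hx).hasFDerivAt.const_smul s)).fderiv
  rw [D2, h.fderiv_eq]
  exact congrArg (fun T => T v v') e

theorem fderiv_eq_zero_of_K {F : E3 → ℝ} (hF : Hom0 F) (d : Frame) {x : E3} (hx : x ∈ S2)
    (h01 : K (d 0) (d 1) F x = 0) (h12 : K (d 1) (d 2) F x = 0) (h02 : K (d 0) (d 2) F x = 0) :
    fderiv ℝ F x = 0 := by
  have hr := fderiv_radial hF x
  conv at hr => enter [1, 2]; rw [d.expand x]
  simp only [map_add, map_smul, smul_eq_mul] at hr
  have hn := d.inner_eq x x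
  rw [S2.inner_self hx] at hn
  rw [K_apply] at h01 h12 h02
  refine fderiv_eq_zero_of_frame d fun i => ?_
  fin_cases i
  · change fderiv ℝ F x (d 0) = 0
    linear_combination ⟪d 0, x⟫ * hr - ⟪d 1, x⟫ * h01 - ⟪d 2, x⟫ * h02 + fderiv ℝ F x (d 0) * hn
  · change fderiv ℝ F x (d 1) = 0
    linear_combination ⟪d 1, x⟫ * hr + ⟪d 0, x⟫ * h01 - ⟪d 2, x⟫ * h12 + fderiv ℝ F x (d 1) * hn
  · change fderiv ℝ F x (d 2) = 0
    linear_combination ⟪d 2, x⟫ * hr + ⟪d 1, x⟫ * h12 + ⟪d 0, x⟫ * h02 + fderiv ℝ F x (d 2) * hn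

theorem K_cyclic (b : Frame) (F : E3 → ℝ) (x : E3) :
    ⟪b 1, x⟫ * K (b 0) (b 2) F x = ⟪b 0, x⟫ * K (b 1) (b 2) F x + ⟪b 2, x⟫ * K (b 0) (b 1) F x := by
  simp only [K_apply]; ring

theorem quo_smul {e : E3} {w : E3 → ℝ} (hw : Hom0 w) {c : ℝ} (hc : 0 < c) (v : E3) :
    quo e w v = c * quo e w (c • v) := by
  by_cases h : ⟪e, v⟫ = 0
  · rw [quo_of_eq _ h, quo_of_eq _ (by rw [inner_smul_right, h, mul_zero]), fderiv_hom0 hw v hc]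
    rfl
  · have h' : ⟪e, c • v⟫ ≠ 0 := by rw [inner_smul_right]; exact mul_ne_zero hc.ne' h
    rw [quo_of_ne _ h, quo_of_ne _ h', hw v c hc, inner_smul_right]
    field_simp

section
variable {α : ℝ} {u : E3 → ℝ} {b : Frame}

theorem Asym.odd12 (h : Asym α u b) {v : E3} (hv : ⟪b 1, v⟫ = 0) : K (b 1) (b 2) u v = 0 :=
  (h.oddIn (by decide)).eq_zero (b.mem_S2 1) hv

theorem Asym.odd01 (h : Asym α u b) {v : E3} (hv : ⟪b 1, v⟫ = 0) : K (b 0) (b 1) u v = 0 :=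
  (h.oddIn' (by decide)).eq_zero (b.mem_S2 1) hv

theorem Asym.no_extremum (h : Asym α u b) {r s : ℝ} (hrs : r ≠ 0 ∨ s ≠ 0) {x : E3} (hx : x ∈ S2)
    (hx0 : ⟪b 0, x⟫ ≠ 0) (hx1 : 0 ≤ ⟪b 1, x⟫) (hq : quo (b 1) (comb b u r s) x = 0)
    (hev : ∀ᶠ v in 𝓝[S2] x, 0 ≤ ⟪b 1, v⟫ → 0 ≤ quo (b 1) (comb b u r s) v) : False := by
  have hker := h.comb_ker r s
  have hodd := h.comb_odd r s
  have hz : ∀ v, ⟪b 1, v⟫ = 0 → comb b u r s v = 0 := fun v => hodd.eq_zero (b.mem_S2 1)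
  have hne := S2.ne_zero hx
  rcases hx1.eq_or_lt with h1 | h1
  · have h1' := h1.symm
    rw [quo_of_eq _ h1'] at hq
    refine h.not_flat_of_inner_eq_zero hrs hx h1' hq ?_
    have hp := b.opair (show (0 : Fin 3) ≠ 2 by decide)
    have hin : ∀ t, ⟪b 1, flow (b 0) (b 2) t x⟫ = 0 := fun t => by
      simp [flow, inner_add_right, inner_smul_right, b.inner_matrix, h1']
    have hd : HasDerivAt (fun t => fderiv ℝ (comb b u r s) (flow (b 0) (b 2) t x) (b 1))
        (D2 (comb b u r s) x (rot (b 0) (b 2) x) (b 1)) 0 := by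
      have e1 : HasFDerivAt (fderiv ℝ (comb b u r s)) (fderiv ℝ (fderiv ℝ (comb b u r s)) x)
          (flow (b 0) (b 2) 0 x) := by
        rw [flow_zero]; exact (hker.sm.differentiableAt_fderiv hne).hasFDerivAt
      have e2 := e1.comp_hasDerivAt (0 : ℝ) (hasDerivAt_flow hp 0 x)
      rw [flow_zero] at e2
      exact ((ContinuousLinearMap.apply ℝ ℝ (b 1)).hasFDerivAt.comp_hasDerivAt (0 : ℝ) e2)
    refine IsLocalMin.hasDerivAt_eq_zero ?_ hd
    have ht : Tendsto (fun t => flow (b 0) (b 2) t x) (𝓝 0) (𝓝[S2] x) := by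
      refine tendsto_nhdsWithin_iff.2 ⟨?_, Eventually.of_forall fun t => flow_mem_S2 hp t hx⟩
      simpa [flow_zero] using (continuous_flow (b 0) (b 2) x).tendsto 0
    filter_upwards [ht.eventually hev] with t ht'
    have := ht' (hin t).ge
    rw [quo_of_eq _ (hin t), ← hq] at this
    simpa only [flow_zero] using this
  · have hmin : IsLocalMinOn (comb b u r s) S2 x := by
      have hc : ContinuousAt (fun v : E3 => ⟪b 1, v⟫) x := (innerSL ℝ (b 1)).continuous.continuousAt
      filter_upwards [hev, (hc.eventually_const_lt h1).filter_mono nhdsWithin_le_nhds] with v hv hv1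
      rw [← mul_quo hz x, ← mul_quo hz v, hq, mul_zero]
      exact mul_nonneg hv1.le (hv hv1.le)
    have hK : ∀ {i j : Fin 3}, i ≠ j → K (b i) (b j) (comb b u r s) x = 0 := fun hij =>
      (K_min hker.sm hx hmin (b.opair hij)).1
    refine h.not_flat2 hrs hx h1.ne' (fun he => ?_) ⟨by rw [← mul_quo hz x, hq, mul_zero],
      fderiv_eq_zero_of_K hker.hom b hx (hK (by decide)) (hK (by decide)) (hK (by decide))⟩
    rw [he, inner_smul_right, b.inner_ne (by decide), mul_zero] at hx0
    exact hx0 rfl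

theorem Asym.quo_ne_zero (h : Asym α u b) {v : E3} (hv : 0 < ⟪b 0, v⟫ + ⟪b 2, v⟫)
    (hA : quo (b 1) (K (b 1) (b 2) u) v = 0) (hB : quo (b 1) (K (b 0) (b 1) u) v = 0) : False := by
  have hv0 : v ≠ 0 := by rintro rfl; simp at hv
  have hc : 0 < ‖v‖⁻¹ := inv_pos.2 (norm_pos_iff.2 hv0)
  set q := ‖v‖⁻¹ • v with hq
  have hqS : q ∈ S2 := by
    rw [mem_S2_iff, norm_smul, norm_inv, norm_norm, inv_mul_cancel₀ (norm_ne_zero_iff.2 hv0)]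
  have hq0 := S2.ne_zero hqS
  have hqp : 0 < ⟪b 0, q⟫ + ⟪b 2, q⟫ := by
    rw [hq, inner_smul_right, inner_smul_right, ← mul_add]; exact mul_pos hc hv
  rw [quo_smul (K_hom0 h.sol.hom _ _) hc, ← hq] at hA hB
  replace hA := (mul_eq_zero.1 hA).resolve_left hc.ne'
  replace hB := (mul_eq_zero.1 hB).resolve_left hc.ne'
  have s12 := h.sol.sm.K (b 1) (b 2)
  have s01 := h.sol.sm.K (b 0) (b 1)
  by_cases hy : ⟪b 1, q⟫ = 0
  · rw [quo_of_eq _ hy] at hA hB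
    have hfd : ∀ r s, fderiv ℝ (comb b u r s) q (b 1) = 0 := fun r s => by
      have := quo_combo (e := b 1) s12 s01 hq0 r s
      rw [quo_of_eq _ hy, quo_of_eq _ hy, quo_of_eq _ hy, hA, hB, mul_zero, mul_zero,
        add_zero] at this
      exact this
    have hD := D2_combo s12 s01 hq0
    set β := D2 (K (b 1) (b 2) u) q (rot (b 0) (b 2) q) (b 1)
    set γ := D2 (K (b 0) (b 1) u) q (rot (b 0) (b 2) q) (b 1)
    by_cases h0 : γ = 0 ∧ β = 0
    · refine h.not_flat_of_inner_eq_zero (r := 1) (s := 0) (Or.inl one_ne_zero) hqS hy (hfd _ _) ?_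
      refine (hD _ _ _ _).trans ?_
      change 1 * β + 0 * γ = 0
      rw [h0.2]; ring
    · refine h.not_flat_of_inner_eq_zero (r := γ) (s := -β) ?_ hqS hy (hfd _ _) ?_
      · by_contra! h1
        exact h0 ⟨h1.1, by linarith [h1.2]⟩
      · refine (hD _ _ _ _).trans ?_
        change γ * β + -β * γ = 0
        ring
  · have k12 : K (b 1) (b 2) u q = 0 := by
      rw [← mul_quo (fun v => h.odd12) q, hA, mul_zero]
    have k01 : K (b 0) (b 1) u q = 0 := by
      rw [← mul_quo (fun v => h.odd01) q, hB, mul_zero]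
    have k02 : K (b 0) (b 2) u q = 0 := by
      have := K_cyclic b u q
      rw [k12, k01, mul_zero, mul_zero, add_zero] at this
      exact (mul_eq_zero.1 this).resolve_left hy
    obtain ⟨k, hk⟩ := h.crit_axis hqS (fderiv_eq_zero_of_K h.sol.hom b hqS k01 k12 k02)
    have hcoord : ∀ i, i ≠ k → ⟪b i, q⟫ = 0 := fun i hi => by
      rcases hk with hk | hk <;> simp [hk, b.inner_matrix, hi]
    have hk1 : (1 : Fin 3) = k := by
      by_contra hne
      exact hy (hcoord 1 hne)
    rw [hcoord 0 (by rw [← hk1]; decide), hcoord 2 (by rw [← hk1]; decide)] at hqp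
    linarith

theorem Asym.quo_face (h : Asym α u b) {v : E3} (hy : 0 ≤ ⟪b 1, v⟫)
    (hv : 0 < ⟪b 0, v⟫ ∧ ⟪b 2, v⟫ = 0 ∨ ⟪b 0, v⟫ = 0 ∧ 0 < ⟪b 2, v⟫) :
    0 ≤ quo (b 1) (K (b 1) (b 2) u) v ∧ 0 ≤ quo (b 1) (K (b 0) (b 1) u) v := by
  have hv0 : v ≠ 0 := by rintro rfl; simp at hv
  have hin : ∀ (t : ℝ) (i : Fin 3), ⟪b i, v + t • b 1⟫ = ⟪b i, v⟫ + if i = 1 then t else 0 := by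
    intro t i
    rw [inner_add_right, inner_smul_right, b.inner_matrix]
    split_ifs <;> simp
  constructor
  · refine quo_nonneg (b.mem_S2 1) (h.sol.sm.K _ _) (fun v => h.odd12) hv0 hy fun t ht => ?_
    have h0 := hin t 0
    have h1 := hin t 1
    have h2 := hin t 2
    simp only [Fin.reduceEq, if_false, if_true, add_zero] at h0 h1 h2
    rcases hv with ⟨hx, hz⟩ | ⟨hx, hz⟩
    · rw [h.K12_zero (h2.trans hz)]
    · rw [b.expand (v + t • b 1), h0, h1, h2, hx, zero_smul, zero_add]
      exact (h.arc (by decide) h.le12 (by linarith) hz).le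
  · refine quo_nonneg (b.mem_S2 1) (h.sol.sm.K _ _) (fun v => h.odd01) hv0 hy fun t ht => ?_
    have h0 := hin t 0
    have h1 := hin t 1
    have h2 := hin t 2
    simp only [Fin.reduceEq, if_false, if_true, add_zero] at h0 h1 h2
    rcases hv with ⟨hx, hz⟩ | ⟨hx, hz⟩
    · rw [b.expand (v + t • b 1), h0, h1, h2, hz, zero_smul, add_zero]
      exact (h.arc (by decide) h.le01 hx (by linarith)).le
    · rw [h.K01_zero (h0.trans hx)]

end

section
variable {α : ℝ} {u : E3 → ℝ} {b : Frame}

theorem quo_comb (b : Frame) {u : E3 → ℝ} (hu : Sm u) {v : E3} (hv : v ≠ 0) (r s : ℝ) :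
    quo (b 1) (comb b u r s) v
      = r * quo (b 1) (K (b 1) (b 2) u) v + s * quo (b 1) (K (b 0) (b 1) u) v :=
  quo_combo (hu.K _ _) (hu.K _ _) hv r s

/-- On the part of the octant away from `b 1` both quotients are non-negative. -/
theorem Asym.quo_nonneg_far (h : Asym α u b) {δ : ℝ} (hδ : 0 < δ)
    (hcone : ∀ v : E3, 0 ≤ ⟪b 0, v⟫ → 0 ≤ ⟪b 2, v⟫ → 0 < ⟪b 1, v⟫ →
      ⟪b 0, v⟫ + ⟪b 2, v⟫ ≤ δ * ⟪b 1, v⟫ →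
      (0 < ⟪b 2, v⟫ → 0 < K (b 1) (b 2) u v) ∧ (0 < ⟪b 0, v⟫ → 0 < K (b 0) (b 1) u v))
    {v : E3} (hv : v ∈ S2) (hx : 0 ≤ ⟪b 0, v⟫) (hy : 0 ≤ ⟪b 1, v⟫) (hz : 0 ≤ ⟪b 2, v⟫)
    (hfar : δ * ⟪b 1, v⟫ ≤ ⟪b 0, v⟫ + ⟪b 2, v⟫) :
    0 ≤ quo (b 1) (K (b 1) (b 2) u) v ∧ 0 ≤ quo (b 1) (K (b 0) (b 1) u) v := by
  have hcont : ∀ i : Fin 3, Continuous fun v : E3 => ⟪b i, v⟫ := fun i => (innerSL ℝ (b i)).continuous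
  set A := quo (b 1) (K (b 1) (b 2) u)
  set B := quo (b 1) (K (b 0) (b 1) u)
  set Hs : Set E3 := {v | 0 < ⟪b 0, v⟫ + ⟪b 2, v⟫}
  have hHo : IsOpen Hs := isOpen_lt continuous_const ((hcont 0).add (hcont 2))
  have hHne : ∀ v ∈ Hs, v ≠ 0 := by
    rintro v hv rfl
    simp [Hs] at hv
  have hHc : Convex ℝ Hs := by
    intro v hv w hw s t hs ht hst
    simp only [Hs, Set.mem_ofPred_eq, inner_add_right, inner_smul_right] at hv hw ⊢
    rcases hs.eq_or_lt with rfl | hs'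
    · rw [zero_add] at hst; subst hst; linarith
    · nlinarith [mul_pos hs' hv, mul_nonneg ht hw.le]
  have hA : ContinuousOn A Hs := fun v hv => (quo_continuousAt (b.mem_S2 1) (h.sol.sm.K _ _)
    (fun v => h.odd12) (hHne v hv)).continuousWithinAt
  have hB : ContinuousOn B Hs := fun v hv => (quo_continuousAt (b.mem_S2 1) (h.sol.sm.K _ _)
    (fun v => h.odd01) (hHne v hv)).continuousWithinAt
  -- the cone and the two faces
  set C : Set E3 := {v | 0 ≤ ⟪b 0, v⟫ ∧ 0 ≤ ⟪b 2, v⟫ ∧ 0 < ⟪b 1, v⟫ ∧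
    0 < ⟪b 0, v⟫ + ⟪b 2, v⟫ ∧ ⟪b 0, v⟫ + ⟪b 2, v⟫ ≤ δ * ⟪b 1, v⟫}
  set F₁ : Set E3 := {v | 0 ≤ ⟪b 1, v⟫ ∧ 0 < ⟪b 0, v⟫ ∧ ⟪b 2, v⟫ = 0}
  set F₂ : Set E3 := {v | 0 ≤ ⟪b 1, v⟫ ∧ ⟪b 0, v⟫ = 0 ∧ 0 < ⟪b 2, v⟫}
  have hpos : ∀ {s t x y : ℝ}, 0 ≤ s → 0 ≤ t → s + t = 1 → 0 < x → 0 < y → 0 < s * x + t * y := by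
    intro s t x y hs ht hst hx hy
    rcases hs.eq_or_lt with rfl | hs'
    · rw [zero_add] at hst; subst hst; linarith
    · nlinarith [mul_pos hs' hx, mul_nonneg ht hy.le]
  have hCc : Convex ℝ C := by
    intro v hv w hw s t hs ht hst
    simp only [C, Set.mem_ofPred_eq, inner_add_right, inner_smul_right] at hv hw ⊢
    obtain ⟨v1, v2, v3, v4, v5⟩ := hv
    obtain ⟨w1, w2, w3, w4, w5⟩ := hw
    refine ⟨by positivity, by positivity, hpos hs ht hst v3 w3, ?_, ?_⟩
    · have := hpos hs ht hst v4 w4; linarith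
    · have := mul_le_mul_of_nonneg_left v5 hs
      have := mul_le_mul_of_nonneg_left w5 ht
      linarith
  have hF₁c : Convex ℝ F₁ := by
    intro v hv w hw s t hs ht hst
    simp only [F₁, Set.mem_ofPred_eq, inner_add_right, inner_smul_right] at hv hw ⊢
    obtain ⟨v1, v2, v3⟩ := hv
    obtain ⟨w1, w2, w3⟩ := hw
    exact ⟨by positivity, hpos hs ht hst v2 w2, by rw [v3, w3]; ring⟩
  have hF₂c : Convex ℝ F₂ := by
    intro v hv w hw s t hs ht hst
    simp only [F₂, Set.mem_ofPred_eq, inner_add_right, inner_smul_right] at hv hw ⊢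
    obtain ⟨v1, v2, v3⟩ := hv
    obtain ⟨w1, w2, w3⟩ := hw
    exact ⟨by positivity, by rw [v2, w2]; ring, hpos hs ht hst v3 w3⟩
  set p₁ : E3 := b 1 + δ • b 0
  set p₂ : E3 := b 1 + δ • b 2
  have hp₁C : p₁ ∈ C := by
    simp [C, p₁, inner_add_right, inner_smul_right, b.inner_matrix, hδ, hδ.le,
      -inner_self_eq_norm_sq_to_K]
  have hp₂C : p₂ ∈ C := by
    simp [C, p₂, inner_add_right, inner_smul_right, b.inner_matrix, hδ, hδ.le,
      -inner_self_eq_norm_sq_to_K]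
  have hp₁F : p₁ ∈ F₁ := by
    simp [F₁, p₁, inner_add_right, inner_smul_right, b.inner_matrix, hδ,
      -inner_self_eq_norm_sq_to_K]
  have hp₂F : p₂ ∈ F₂ := by
    simp [F₂, p₂, inner_add_right, inner_smul_right, b.inner_matrix, hδ,
      -inner_self_eq_norm_sq_to_K]
  set Q : Set E3 := (C ∪ F₁) ∪ F₂
  have hQ : IsPreconnected Q := (hCc.isPreconnected.union p₁ hp₁C hp₁F hF₁c.isPreconnected).union p₂
    (Or.inl hp₂C) hp₂F hF₂c.isPreconnected
  have hQH : Q ⊆ Hs := by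
    rintro v ((hv | hv) | hv)
    · exact hv.2.2.2.1
    · simp only [Hs, Set.mem_ofPred_eq, hv.2.2, add_zero]; exact hv.2.1
    · simp only [Hs, Set.mem_ofPred_eq, hv.2.1, zero_add]; exact hv.2.2
  have hQnn : ∀ v ∈ Q, 0 ≤ A v ∧ 0 ≤ B v := by
    rintro v ((hv | hv) | hv)
    · obtain ⟨h1, h2, h3, -, h5⟩ := hv
      obtain ⟨c1, c2⟩ := hcone v h1 h2 h3 h5
      simp only [A, B, quo_of_ne _ h3.ne']
      constructor
      · refine div_nonneg ?_ h3.le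
        rcases h2.eq_or_lt with h2 | h2
        · rw [h.K12_zero h2.symm]
        · exact (c1 h2).le
      · refine div_nonneg ?_ h3.le
        rcases h1.eq_or_lt with h1 | h1
        · rw [h.K01_zero h1.symm]
        · exact (c2 h1).le
    · exact h.quo_face hv.1 (Or.inl hv.2)
    · exact h.quo_face hv.1 (Or.inr hv.2)
  have hp₁Q : p₁ ∈ Q := Or.inl (Or.inl hp₁C)
  obtain ⟨ρ, θ, hθ, hpol, hθ₀⟩ := exists_polar_lift hHc hHo hA hB
    (fun v hv => h.quo_ne_zero hv) (hQH hp₁Q) (hQnn _ hp₁Q).1 (hQnn _ hp₁Q).2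
  have hθQ : ∀ v ∈ Q, θ v ∈ Set.Icc 0 (π / 2) := fun v hv =>
    quadrant_of_preconnected hQ (hθ.mono hQH)
      (fun v hv => nonneg_of_mul_nonneg_right ((hpol v (hQH hv)).2.1 ▸ (hQnn v hv).1)
        (hpol v (hQH hv)).1)
      (fun v hv => nonneg_of_mul_nonneg_right ((hpol v (hQH hv)).2.2 ▸ (hQnn v hv).2)
        (hpol v (hQH hv)).1) hp₁Q hθ₀ hv
  set D : Set E3 := S2 ∩ {v | 0 ≤ ⟪b 0, v⟫ ∧ 0 ≤ ⟪b 1, v⟫ ∧ 0 ≤ ⟪b 2, v⟫ ∧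
    δ * ⟪b 1, v⟫ ≤ ⟪b 0, v⟫ + ⟪b 2, v⟫}
  have hDc : IsCompact D := isCompact_S2.inter_right
    ((isClosed_le continuous_const (hcont 0)).inter ((isClosed_le continuous_const (hcont 1)).inter
      ((isClosed_le continuous_const (hcont 2)).inter
        (isClosed_le ((hcont 1).const_mul δ) ((hcont 0).add (hcont 2))))))
  have hDH : D ⊆ Hs := by
    rintro v ⟨hvS, h0, h1, h2, h3⟩
    refine lt_of_le_of_ne (add_nonneg h0 h2) fun he => S2.ne_zero hvS ?_
    have hy0 : ⟪b 1, v⟫ = 0 := by nlinarith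
    have := b.expand v
    rw [hy0, show ⟪b 0, v⟫ = 0 by linarith, show ⟪b 2, v⟫ = 0 by linarith] at this
    simpa using this
  have hvD : v ∈ D := ⟨hv, hx, hy, hz, hfar⟩
  -- an extremum of the angle outside the quadrant lies off the cone and the faces
  have hoff : ∀ x ∈ D, θ x ∉ Set.Icc 0 (π / 2) → 0 < ⟪b 0, x⟫ ∧
      ∀ᶠ v in 𝓝[S2] x, 0 ≤ ⟪b 1, v⟫ → v ∈ D := by
    rintro x hxD hxθ
    have hxQ : x ∉ Q := fun hq => hxθ (hθQ x hq)
    obtain ⟨hxS, h0, h1, h2, h3⟩ := id hxD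
    have hH : 0 < ⟪b 0, x⟫ + ⟪b 2, x⟫ := hDH hxD
    have hx0 : 0 < ⟪b 0, x⟫ := lt_of_le_of_ne h0 fun he =>
      hxQ (Or.inr ⟨h1, he.symm, by linarith⟩)
    have hx2 : 0 < ⟪b 2, x⟫ := lt_of_le_of_ne h2 fun he =>
      hxQ (Or.inl (Or.inr ⟨h1, hx0, he.symm⟩))
    have hx3 : δ * ⟪b 1, x⟫ < ⟪b 0, x⟫ + ⟪b 2, x⟫ := lt_of_le_of_ne h3 fun he =>
      hxQ (Or.inl (Or.inl ⟨h0, h2, by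
        by_contra! hle
        nlinarith, hH, he.ge⟩))
    refine ⟨hx0, ?_⟩
    have e0 := (hcont 0).continuousAt.eventually_const_lt hx0
    have e2 := (hcont 2).continuousAt.eventually_const_lt hx2
    have e3 := ((hcont 1).const_mul δ).continuousAt.eventually_lt
      ((hcont 0).add (hcont 2)).continuousAt hx3
    filter_upwards [self_mem_nhdsWithin, e0.filter_mono nhdsWithin_le_nhds,
      e2.filter_mono nhdsWithin_le_nhds, e3.filter_mono nhdsWithin_le_nhds] with v hvS e0 e2 e3 hv1
    exact ⟨hvS, e0.le, hv1, e2.le, e3.le⟩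
  have hclose : ∀ x ∈ D, ∀ᶠ v in 𝓝[S2] x, |θ v - θ x| < π := fun x hx => by
    have : ContinuousAt θ x := hθ.continuousAt (hHo.mem_nhds (hDH hx))
    have := Metric.tendsto_nhds.1 this π pi_pos
    exact this.filter_mono nhdsWithin_le_nhds
  obtain ⟨xM, hxM, hM⟩ := hDc.exists_isMaxOn ⟨v, hvD⟩ (hθ.mono hDH)
  obtain ⟨xm, hxm, hm⟩ := hDc.exists_isMinOn ⟨v, hvD⟩ (hθ.mono hDH)
  have hxMle : θ xM ≤ π / 2 := by
    by_contra! hgt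
    obtain ⟨hx0, hev⟩ := hoff xM hxM fun hm => by linarith [hm.2]
    refine h.no_extremum (r := sin (θ xM)) (s := -cos (θ xM)) ?_ hxM.1 hx0.ne' hxM.2.2.1 ?_ ?_
    · by_contra! h0
      have := sin_sq_add_cos_sq (θ xM)
      rw [h0.1, neg_eq_zero.1 h0.2] at this
      norm_num at this
    · rw [quo_comb b h.sol.sm (S2.ne_zero hxM.1)]
      obtain ⟨-, p1, p2⟩ := hpol xM (hDH hxM)
      linear_combination sin (θ xM) * p1 - cos (θ xM) * p2
    · filter_upwards [hev, hclose xM hxM] with w hw hw' hw1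
      have hwD := hw hw1
      rw [quo_comb b h.sol.sm (S2.ne_zero hwD.1)]
      obtain ⟨p0, p1, p2⟩ := hpol w (hDH hwD)
      have : 0 ≤ ρ w * sin (θ xM - θ w) := mul_nonneg p0.le
        (sin_nonneg_of_nonneg_of_le_pi (sub_nonneg.2 (hM hwD)) (by linarith [(abs_lt.1 hw').1]))
      rw [sin_sub] at this
      have e : sin (θ xM) * A w + -cos (θ xM) * B w
          = ρ w * (sin (θ xM) * cos (θ w) - cos (θ xM) * sin (θ w)) := by
        linear_combination sin (θ xM) * p1 - cos (θ xM) * p2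
      exact e ▸ this
  have hxmge : 0 ≤ θ xm := by
    by_contra! hlt
    obtain ⟨hx0, hev⟩ := hoff xm hxm fun hm => by linarith [hm.1]
    refine h.no_extremum (r := -sin (θ xm)) (s := cos (θ xm)) ?_ hxm.1 hx0.ne' hxm.2.2.1 ?_ ?_
    · by_contra! h0
      have := sin_sq_add_cos_sq (θ xm)
      rw [h0.2, neg_eq_zero.1 h0.1] at this
      norm_num at this
    · rw [quo_comb b h.sol.sm (S2.ne_zero hxm.1)]
      obtain ⟨-, p1, p2⟩ := hpol xm (hDH hxm)
      linear_combination -sin (θ xm) * p1 + cos (θ xm) * p2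
    · filter_upwards [hev, hclose xm hxm] with w hw hw' hw1
      have hwD := hw hw1
      rw [quo_comb b h.sol.sm (S2.ne_zero hwD.1)]
      obtain ⟨p0, p1, p2⟩ := hpol w (hDH hwD)
      have : 0 ≤ ρ w * sin (θ w - θ xm) := mul_nonneg p0.le
        (sin_nonneg_of_nonneg_of_le_pi (sub_nonneg.2 (hm hwD)) (abs_lt.1 hw').2.le)
      rw [sin_sub] at this
      have e : -sin (θ xm) * A w + cos (θ xm) * B w
          = ρ w * (sin (θ w) * cos (θ xm) - cos (θ w) * sin (θ xm)) := by
        linear_combination -sin (θ xm) * p1 + cos (θ xm) * p2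
      exact e ▸ this
  have hv0 : 0 ≤ θ v := hxmge.trans (hm hvD)
  have hv1 : θ v ≤ π / 2 := le_trans (hM hvD) hxMle
  obtain ⟨p0, p1, p2⟩ := hpol v (hDH hvD)
  rw [p1, p2]
  exact ⟨mul_nonneg p0.le (cos_nonneg_of_mem_Icc ⟨by linarith [pi_pos], hv1⟩),
    mul_nonneg p0.le (sin_nonneg_of_nonneg_of_le_pi hv0 (by linarith [pi_pos]))⟩

/-- The product of the three rotation derivatives. -/
def triple (b : Frame) (u : E3 → ℝ) (x : E3) : ℝ :=
  K (b 0) (b 1) u x * K (b 0) (b 2) u x * K (b 1) (b 2) u x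

theorem Asym.triple_of_octant (h : Asym α u b) {v : E3} (hx : 0 ≤ ⟪b 0, v⟫)
    (hy : 0 ≤ ⟪b 1, v⟫) (hz : 0 ≤ ⟪b 2, v⟫) : 0 ≤ triple b u v := by
  rcases hy.eq_or_lt with h1 | h1
  · rw [triple, h.odd01 h1.symm, zero_mul, zero_mul]
  obtain ⟨δ, hδ, hcone⟩ := h.exists_cone
  have key : 0 ≤ K (b 1) (b 2) u v ∧ 0 ≤ K (b 0) (b 1) u v := by
    rcases le_total (⟪b 0, v⟫ + ⟪b 2, v⟫) (δ * ⟪b 1, v⟫) with hle | hle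
    · obtain ⟨c1, c2⟩ := hcone v hx hz h1 hle
      constructor
      · rcases hz.eq_or_lt with hz | hz
        · rw [h.K12_zero hz.symm]
        · exact (c1 hz).le
      · rcases hx.eq_or_lt with hx | hx
        · rw [h.K01_zero hx.symm]
        · exact (c2 hx).le
    · have hv0 : v ≠ 0 := by rintro rfl; simp at h1
      have hc : 0 < ‖v‖⁻¹ := inv_pos.2 (norm_pos_iff.2 hv0)
      have hqS : ‖v‖⁻¹ • v ∈ S2 := by
        rw [mem_S2_iff, norm_smul, norm_inv, norm_norm, inv_mul_cancel₀ (norm_ne_zero_iff.2 hv0)]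
      obtain ⟨a1, a2⟩ := h.quo_nonneg_far hδ hcone hqS (by rw [inner_smul_right]; positivity)
        (by rw [inner_smul_right]; positivity) (by rw [inner_smul_right]; positivity) (by
          simp only [inner_smul_right]
          nlinarith)
      rw [← mul_quo (fun v => h.odd12) v, ← mul_quo (fun v => h.odd01) v,
        quo_smul (K_hom0 h.sol.hom (b 1) (b 2)) hc v,
        quo_smul (K_hom0 h.sol.hom (b 0) (b 1)) hc v]
      exact ⟨mul_nonneg hy (mul_nonneg hc.le a1), mul_nonneg hy (mul_nonneg hc.le a2)⟩
  have h02 : 0 ≤ K (b 0) (b 2) u v := by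
    refine nonneg_of_mul_nonneg_right (a := ⟪b 1, v⟫) ?_ h1
    rw [K_cyclic]
    exact add_nonneg (mul_nonneg hx key.1) (mul_nonneg hz key.2)
  exact mul_nonneg (mul_nonneg key.2 h02) key.1

theorem Asym.triple_refl (h : Asym α u b) (i : Fin 3) (v : E3) :
    triple b u (refl (b i) v) = triple b u v := by
  have ev : ∀ {j k : Fin 3}, i ≠ j → i ≠ k →
      K (b j) (b k) u (refl (b i) v) = K (b j) (b k) u v := fun hj hk =>
    evenIn_K (h.inv i) (b.mem_S2 i) (b.inner_ne hj) (b.inner_ne hk) v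
  have od : ∀ {j : Fin 3}, i ≠ j → K (b i) (b j) u (refl (b i) v) = -K (b i) (b j) u v :=
    fun hj => h.oddIn hj v
  have od' : ∀ {j : Fin 3}, j ≠ i → K (b j) (b i) u (refl (b i) v) = -K (b j) (b i) u v :=
    fun hj => h.oddIn' hj v
  unfold triple
  fin_cases i
  · have e1 := od (j := 1) (by decide)
    have e2 := od (j := 2) (by decide)
    have e3 := ev (j := 1) (k := 2) (by decide) (by decide)
    dsimp only [Fin.zero_eta] at e1 e2 e3 ⊢
    rw [e1, e2, e3]; ring
  · have e1 := od' (j := 0) (by decide)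
    have e2 := ev (j := 0) (k := 2) (by decide) (by decide)
    have e3 := od (j := 2) (by decide)
    dsimp only [Fin.mk_one] at e1 e2 e3 ⊢
    rw [e1, e2, e3]; ring
  · have e1 := ev (j := 0) (k := 1) (by decide) (by decide)
    have e2 := od' (j := 0) (by decide)
    have e3 := od' (j := 1) (by decide)
    dsimp only [Fin.reduceFinMk] at e1 e2 e3 ⊢
    rw [e1, e2, e3]; ring

theorem inner_refl_frame (b : Frame) (i j : Fin 3) (v : E3) :
    ⟪b j, refl (b i) v⟫ = if j = i then -⟪b j, v⟫ else ⟪b j, v⟫ := by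
  rw [refl_apply (b.mem_S2 i), inner_sub_right, inner_smul_right, b.inner_matrix]
  split_ifs with hji
  · rw [hji]; ring
  · ring

theorem Asym.triple_nonneg (h : Asym α u b) (v : E3) : 0 ≤ triple b u v := by
  have fix : ∀ (i : Fin 3) (v : E3), ∃ w, triple b u w = triple b u v ∧ 0 ≤ ⟪b i, w⟫ ∧
      ∀ j, j ≠ i → ⟪b j, w⟫ = ⟪b j, v⟫ := by
    intro i v
    rcases le_total 0 ⟪b i, v⟫ with h0 | h0
    · exact ⟨v, rfl, h0, fun _ _ => rfl⟩
    · refine ⟨refl (b i) v, h.triple_refl i v, ?_, fun j hj => ?_⟩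
      · rw [inner_refl_frame, if_pos rfl]; linarith
      · rw [inner_refl_frame, if_neg hj]
  obtain ⟨v₁, e₁, p₁, q₁⟩ := fix 0 v
  obtain ⟨v₂, e₂, p₂, q₂⟩ := fix 1 v₁
  obtain ⟨v₃, e₃, p₃, q₃⟩ := fix 2 v₂
  rw [← e₁, ← e₂, ← e₃]
  refine h.triple_of_octant ?_ ?_ p₃
  · rw [q₃ 0 (by decide), q₂ 0 (by decide)]; exact p₁
  · rw [q₃ 1 (by decide)]; exact p₂

theorem Asym.exists_triple_pos (h : Asym α u b) : ∃ v, v ∈ S2 ∧ 0 < triple b u v := by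
  obtain ⟨δ, hδ, hcone⟩ := h.exists_cone
  set v : E3 := b 1 + ((δ / 2) • b 0 + (δ / 2) • b 2) with hv
  have h0 : ⟪b 0, v⟫ = δ / 2 := by
    simp [hv, inner_add_right, inner_smul_right, b.inner_matrix, -inner_self_eq_norm_sq_to_K]
  have h1 : ⟪b 1, v⟫ = 1 := by
    simp [hv, inner_add_right, inner_smul_right, b.inner_matrix, -inner_self_eq_norm_sq_to_K]
  have h2 : ⟪b 2, v⟫ = δ / 2 := by
    simp [hv, inner_add_right, inner_smul_right, b.inner_matrix, -inner_self_eq_norm_sq_to_K]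
  have hv0 : v ≠ 0 := by intro h'; rw [h'] at h1; simp at h1
  obtain ⟨c1, c2⟩ := hcone v (by rw [h0]; positivity) (by rw [h2]; positivity)
    (by rw [h1]; exact one_pos) (by rw [h0, h1, h2]; linarith)
  replace c1 := c1 (by rw [h2]; positivity)
  replace c2 := c2 (by rw [h0]; positivity)
  have h02 : 0 < K (b 0) (b 2) u v := by
    have := K_cyclic b u v
    rw [h0, h1, h2, one_mul] at this
    rw [this]
    positivity
  have hc : 0 < ‖v‖⁻¹ := inv_pos.2 (norm_pos_iff.2 hv0)
  refine ⟨‖v‖⁻¹ • v, ?_, ?_⟩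
  · rw [mem_S2_iff, norm_smul, norm_inv, norm_norm, inv_mul_cancel₀ (norm_ne_zero_iff.2 hv0)]
  · rw [triple, K_hom0 h.sol.hom _ _ _ _ hc, K_hom0 h.sol.hom _ _ _ _ hc,
      K_hom0 h.sol.hom _ _ _ _ hc]
    positivity

end

/-! ### Integration by parts for infinitesimal rotations -/

theorem integral_K_eq_zero {H : E3 → ℝ} (hH : ContDiff ℝ ∞ H) (hc : HasCompactSupport H)
    {a c : E3} (hac : ⟪a, c⟫ = 0) : ∫ x, K a c H x = 0 := by
  have hd : ∀ v, Continuous fun x => fderiv ℝ H x v := fun v =>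
    (hH.continuous_fderiv (by simp)).clm_apply continuous_const
  have hdc : ∀ v, HasCompactSupport fun x => fderiv ℝ H x v := fun v => hc.fderiv_apply ℝ v
  have hl : ∀ v : E3, Continuous fun x => ⟪v, x⟫ := fun v => (innerSL ℝ v).continuous
  have key : ∀ v w : E3, ⟪v, w⟫ = 0 → ∫ x, ⟪v, x⟫ * fderiv ℝ H x w = 0 := by
    intro v w hvw
    have hf : ∀ x, fderiv ℝ (fun x => ⟪v, x⟫) x = innerSL ℝ v := fun x => (innerSL ℝ v).fderiv
    rw [integral_mul_fderiv_eq_neg_fderiv_mul_of_integrable]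
    · simp [hf, hvw]
    · simp [hf, hvw]
    · exact ((hl v).mul (hd w)).integrable_of_hasCompactSupport (hdc w).mul_left
    · exact ((hl v).mul hH.continuous).integrable_of_hasCompactSupport hc.mul_left
    · exact fun x _ => (innerSL ℝ v).differentiableAt
    · exact fun x _ => (hH.differentiable (by simp)).differentiableAt
  simp only [K_apply]
  rw [integral_sub, key a c hac, key c a (by rw [real_inner_comm]; exact hac), sub_zero]
  · exact ((hl a).mul (hd c)).integrable_of_hasCompactSupport (hdc c).mul_left
  · exact ((hl c).mul (hd a)).integrable_of_hasCompactSupport (hdc a).mul_left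

/-- A smooth bump on the line centred at `1`. -/
def annulusBump : ContDiffBump (1 : ℝ) := ⟨1 / 4, 1 / 2, by norm_num, by norm_num⟩

/-- A radial cutoff supported in an annulus around the unit sphere. -/
def cutoff (x : E3) : ℝ := annulusBump ⟪x, x⟫

theorem cutoff_nonneg (x : E3) : 0 ≤ cutoff x := annulusBump.nonneg

theorem cutoff_S2 {x : E3} (hx : x ∈ S2) : cutoff x = 1 := by
  rw [cutoff, S2.inner_self hx]
  exact annulusBump.one_of_mem_closedBall (by simp [annulusBump])

theorem contDiff_cutoff : ContDiff ℝ ∞ cutoff :=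
  annulusBump.contDiff.comp (contDiff_id.inner ℝ contDiff_id)

theorem cutoff_of_dist {x : E3} (h : 1 / 2 ≤ |⟪x, x⟫ - 1|) : cutoff x = 0 :=
  annulusBump.zero_of_le_dist h

theorem cutoff_eventually_zero : ∀ᶠ x in 𝓝 (0 : E3), cutoff x = 0 := by
  have h : Tendsto (fun x : E3 => |⟪x, x⟫ - 1|) (𝓝 0) (𝓝 1) := by
    have : Continuous fun x : E3 => |⟪x, x⟫ - 1| :=
      ((continuous_id.inner continuous_id).sub continuous_const).abs
    simpa using this.tendsto 0
  filter_upwards [h.eventually (lt_mem_nhds (by norm_num : (1 / 2 : ℝ) < 1))] with x hx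
  exact cutoff_of_dist hx.le

theorem hasCompactSupport_cutoff : HasCompactSupport cutoff := by
  refine HasCompactSupport.intro (isCompact_closedBall (0 : E3) 2) fun x hx => cutoff_of_dist ?_
  rw [mem_closedBall_zero_iff, not_le] at hx
  rw [real_inner_self_eq_norm_sq]
  exact le_trans (by nlinarith) (le_abs_self _)

theorem contDiff_cutoff_mul {F : E3 → ℝ} (hF : Sm F) : ContDiff ℝ ∞ fun x => cutoff x * F x := by
  refine contDiff_iff_contDiffAt.2 fun x => ?_
  rcases eq_or_ne x 0 with rfl | hx
  · refine (contDiffAt_const (c := (0 : ℝ))).congr_of_eventuallyEq ?_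
    filter_upwards [cutoff_eventually_zero] with y hy
    rw [hy, zero_mul]
  · exact contDiff_cutoff.contDiffAt.mul (hF.contDiffAt hx)

theorem integrable_cutoff_mul {F : E3 → ℝ} (hF : Sm F) : Integrable fun x => cutoff x * F x :=
  (contDiff_cutoff_mul hF).continuous.integrable_of_hasCompactSupport
    hasCompactSupport_cutoff.mul_right

theorem K_cutoff (a c : E3) : K a c cutoff = fun _ => 0 := by
  have h := K_comp sm_inner_self (g := annulusBump) (g' := deriv annulusBump)
    (fun t => (annulusBump.contDiff.differentiable (n := 1) (by simp) t).hasDerivAt) a c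
  have h' : cutoff = fun x => annulusBump ⟪x, x⟫ := rfl
  rw [h', h]
  simp [K_inner_self, -inner_self_eq_norm_sq_to_K]

theorem integral_cutoff_mul_K {F : E3 → ℝ} (hF : Sm F) {a c : E3} (hac : ⟪a, c⟫ = 0) :
    ∫ x, cutoff x * K a c F x = 0 := by
  have := integral_K_eq_zero (contDiff_cutoff_mul hF) hasCompactSupport_cutoff.mul_right hac
  rw [K_mul (Sm.of_contDiff contDiff_cutoff) hF, K_cutoff] at this
  simpa using this

/-- Green's identity on the sphere. -/
theorem integral_cutoff_green {F G : E3 → ℝ} (hF : Sm F) (hG : Sm G) (b : Frame) :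
    ∫ x, cutoff x * (F x * Lap b G x - G x * Lap b F x) = 0 := by
  have hb : ∀ i : Fin 3, ⟪b (i + 1), b (i + 2)⟫ = 0 := fun i => b.inner_ne (by grind)
  have hs : ∀ i, Sm fun x => F x * L b i G x - G x * L b i F x := fun i =>
    (hF.mul (hG.L b i)).sub (hG.mul (hF.L b i))
  have e : (fun x => cutoff x * (F x * Lap b G x - G x * Lap b F x)) = fun x =>
      ∑ i, cutoff x * L b i (fun x => F x * L b i G x - G x * L b i F x) x := by
    ext x
    simp only [L_sub (hF.mul (hG.L b _)) (hG.mul (hF.L b _)), L_mul hF (hG.L b _),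
      L_mul hG (hF.L b _), Lap, Fin.sum_univ_three]
    ring
  rw [e, integral_finsetSum _ fun i _ => integrable_cutoff_mul ((hs i).L b i)]
  exact Finset.sum_eq_zero fun i _ => integral_cutoff_mul_K (hs i) (hb i)

/-! ### Axial symmetry -/

theorem Asym.false {α : ℝ} {u : E3 → ℝ} {b : Frame} (h : Asym α u b) : False := by
  have hu := h.sol
  have k01 := hu.ker (b 0) (b 1)
  have k02 := hu.ker (b 0) (b 2)
  have hexp : Sm fun x => exp (2 * u x) :=
    hu.sm.comp (g := fun t => exp (2 * t)) (contDiff_const.mul contDiff_id).exp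
  have hKe : K (b 1) (b 2) (fun x => exp (2 * u x))
      = fun x => 2 * exp (2 * u x) * K (b 1) (b 2) u x :=
    K_comp hu.sm (g := fun t => exp (2 * t)) (g' := fun t => 2 * exp (2 * t)) (fun t => by
      simpa [mul_comm] using ((hasDerivAt_id t).const_mul 2).exp) _ _
  have hψ : ∀ x, Lap b (K (b 1) (b 2) (K (b 0) (b 1) u)) x
      = -2 * (exp (2 * u x) * K (b 1) (b 2) (K (b 0) (b 1) u) x
        + K (b 0) (b 1) u x * (2 * exp (2 * u x) * K (b 1) (b 2) u x)) := by
    intro x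
    have e : ∀ y, y ≠ 0 → Lap b (K (b 0) (b 1) u) y
        = -2 * (exp (2 * u y) * K (b 0) (b 1) u y) := fun y hy => by
      rw [k01.lap b y hy, mul_assoc]
    rw [Lap_K k01.sm, K_congr e, K_const_mul _ (hexp.mul k01.sm), K_mul hexp k01.sm, hKe]
  have htr : Sm (triple b u) :=
    ((hu.sm.K (b 0) (b 1)).mul (hu.sm.K (b 0) (b 2))).mul (hu.sm.K (b 1) (b 2))
  have hint : ∫ x, cutoff x * (exp (2 * u x) * triple b u x) = 0 := by
    have h0 := integral_cutoff_green k02.sm (k01.sm.K (b 1) (b 2)) b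
    have e : (fun x => cutoff x * (exp (2 * u x) * triple b u x)) = fun x => (-1 / 4) *
        (cutoff x * (K (b 0) (b 2) u x * Lap b (K (b 1) (b 2) (K (b 0) (b 1) u)) x
          - K (b 1) (b 2) (K (b 0) (b 1) u) x * Lap b (K (b 0) (b 2) u) x)) := by
      ext x
      rcases eq_or_ne x 0 with rfl | hx
      · simp [cutoff_eventually_zero.self_of_nhds]
      · rw [hψ, k02.lap b x hx, triple]; ring
    rw [e, integral_const_mul, h0, mul_zero]
  obtain ⟨v, hv, hpos⟩ := h.exists_triple_pos
  have hsm := contDiff_cutoff_mul (hexp.mul htr)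
  refine (hsm.continuous.integral_pos_of_hasCompactSupport_nonneg_nonzero (μ := volume) (x := v)
    hasCompactSupport_cutoff.mul_right
    (fun x => mul_nonneg (cutoff_nonneg x) (mul_nonneg (exp_pos _).le (h.triple_nonneg x)))
    ?_).ne' hint
  rw [cutoff_S2 hv]
  exact (mul_pos one_pos (mul_pos (exp_pos _) hpos)).ne'

theorem Setup.axiallySymmetric {α : ℝ} {u : E3 → ℝ} {b : Frame} (h : Setup α u b) :
    ∃ q ∈ S2, AxiallySymmetric u q := by
  by_contra hn
  obtain ⟨d, hd⟩ := h.exists_asym hn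
  exact hd.false

/-! ### Axially symmetric solutions for `α = 3` -/

theorem AxiallySymmetric.K_eq_zero {u : E3 → ℝ} (hs : Sm u) (hu : Hom0 u) (b : Frame)
    (h : AxiallySymmetric u (b 2)) {x : E3} (hx : x ≠ 0) : K (b 0) (b 1) u x = 0 := by
  refine hom0_eq_zero (K_hom0 hu _ _) (fun x hx => ?_) hx
  have ho : OPair (b 0) (b 1) := b.opair (by decide)
  have hd := hasDerivAt_comp_flow hs ho (S2.ne_zero hx) 0
  have hc : (fun t => u (flow (b 0) (b 1) t x)) = fun _ => u x := by
    ext t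
    refine h _ (flow_mem_S2 ho t hx) _ hx ?_
    simp [flow, inner_add_left, real_inner_smul_left, b.inner_matrix]
  rw [hc, flow_zero] at hd
  exact hd.unique (hasDerivAt_const _ _)

theorem sin_mul_Lap {F : E3 → ℝ} (hF : Sm F) (b : Frame)
    (h : ∀ x, x ≠ 0 → K (b 0) (b 1) F x = 0) (t : ℝ) :
    sin t * Lap b F (flow (b 2) (b 0) t (b 2))
      = cos t * K (b 2) (b 0) F (flow (b 2) (b 0) t (b 2))
        + sin t * K (b 2) (b 0) (K (b 2) (b 0) F) (flow (b 2) (b 0) t (b 2)) := by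
  set x := flow (b 2) (b 0) t (b 2) with hx
  have i0 : ⟪b 0, x⟫ = sin t := by
    simp [hx, flow, inner_add_right, inner_smul_right, b.inner_matrix,
      -inner_self_eq_norm_sq_to_K]
  have i1 : ⟪b 1, x⟫ = 0 := by
    simp [hx, flow, inner_add_right, inner_smul_right, b.inner_matrix,
      -inner_self_eq_norm_sq_to_K]
  have i2 : ⟪b 2, x⟫ = cos t := by
    simp [hx, flow, inner_add_right, inner_smul_right, b.inner_matrix,
      -inner_self_eq_norm_sq_to_K]
  have hz : ∀ a c, K a c (K (b 0) (b 1) F) x = 0 := by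
    intro a c
    rw [K_congr (G := fun _ => 0) h]
    simp [K]
  have hL := L_comm hF b 2 x
  have hLap : Lap b F x = K (b 1) (b 2) (K (b 1) (b 2) F) x
      + K (b 2) (b 0) (K (b 2) (b 0) F) x + K (b 0) (b 1) (K (b 0) (b 1) F) x := by
    rw [Lap, Fin.sum_univ_three]; rfl
  replace hL : K (b 0) (b 1) (K (b 1) (b 2) F) x - K (b 1) (b 2) (K (b 0) (b 1) F) x
      = -K (b 2) (b 0) F x := hL
  have hswap : sin t * K (b 1) (b 2) (K (b 1) (b 2) F) x
      = -cos t * K (b 0) (b 1) (K (b 1) (b 2) F) x := by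
    rw [K_apply (b 1) (b 2) (K (b 1) (b 2) F), K_apply (b 0) (b 1) (K (b 1) (b 2) F), i0, i1, i2]
    ring
  rw [hLap, hz]
  rw [hz] at hL
  linear_combination hswap - cos t * hL

/-- The ODE for the profile of an axially symmetric solution has only constant solutions. -/
theorem ode_deriv_eq_zero {U V G : ℝ → ℝ} (hU : ∀ t, HasDerivAt U (V t) t)
    (hG : ∀ t, G t = sin t * V t) (hG' : ∀ t, HasDerivAt G (sin t * (3 - exp (2 * U t))) t)
    {t : ℝ} (ht : t ∈ Set.Ioo 0 π) : V t = 0 := by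
  set Φ : ℝ → ℝ := fun t => cos t * sin t ^ 2 * (3 - exp (2 * U t))
    + (1 - 3 * cos t ^ 2) * G t - cos t * G t ^ 2 with hΦ
  have hd : ∀ t, HasDerivAt Φ (sin t * G t ^ 2) t := by
    intro t
    have hc := hasDerivAt_cos t
    have hs := hasDerivAt_sin t
    have hE := ((hU t).const_mul 2).exp.const_sub 3
    have := (((hc.mul (hs.pow 2)).mul hE).add ((((hc.pow 2).const_mul 3).const_sub 1).mul
      (hG' t))).sub (hc.mul ((hG' t).pow 2))
    refine this.congr_deriv ?_
    simp only [Pi.mul_apply, Pi.pow_apply, hG t]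
    have hcs := cos_sq' t
    linear_combination -sin t * (3 - exp (2 * U t)) * hcs
  have hmono : MonotoneOn Φ (Set.Icc 0 π) := by
    refine monotoneOn_of_deriv_nonneg (convex_Icc 0 π)
      (fun t _ => (hd t).continuousAt.continuousWithinAt)
      (fun t _ => (hd t).differentiableAt.differentiableWithinAt) fun t ht => ?_
    rw [interior_Icc] at ht
    rw [(hd t).deriv]
    exact mul_nonneg (sin_pos_of_mem_Ioo ht).le (sq_nonneg _)
  have h0 : Φ 0 = 0 := by simp [hΦ, hG]
  have hπ : Φ π = 0 := by simp [hΦ, hG]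
  have hzero : ∀ t ∈ Set.Ioo 0 π, Φ t = 0 := fun t ht => le_antisymm
    (hπ ▸ hmono ⟨ht.1.le, ht.2.le⟩ ⟨pi_pos.le, le_rfl⟩ ht.2.le)
    (h0 ▸ hmono ⟨le_rfl, pi_pos.le⟩ ⟨ht.1.le, ht.2.le⟩ ht.1.le)
  have hev : Φ =ᶠ[𝓝 t] fun _ => 0 := by
    filter_upwards [Ioo_mem_nhds ht.1 ht.2] with s hs using hzero s hs
  have hs := sin_pos_of_mem_Ioo ht
  have := (hd t).unique ((hasDerivAt_const t (0 : ℝ)).congr_of_eventuallyEq hev)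
  rw [hG] at this
  simpa [hs.ne'] using this

theorem Sol.const_of_axiallySymmetric {u : E3 → ℝ} (hu : Sol 3 u) {q : E3} (hq : q ∈ S2)
    (h : AxiallySymmetric u q) {x : E3} (hx : x ∈ S2) : u x = u q := by
  obtain ⟨b, rfl⟩ := exists_frame_last hq
  have ho : OPair (b 2) (b 0) := b.opair (by decide)
  have hne : b 2 ≠ 0 := S2.ne_zero hq
  have hU := hasDerivAt_comp_flow hu.sm ho hne
  have hV := hasDerivAt_comp_flow (hu.sm.K (b 2) (b 0)) ho hne
  have hz : ∀ t ∈ Set.Ioo 0 π, K (b 2) (b 0) u (flow (b 2) (b 0) t (b 2)) = 0 := fun t ht =>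
    ode_deriv_eq_zero hU (fun _ => rfl) (fun t => by
      refine ((hasDerivAt_sin t).mul (hV t)).congr_deriv ?_
      rw [← hu.lap b _ (flow_ne_zero ho t hne),
        sin_mul_Lap hu.sm b fun y hy => AxiallySymmetric.K_eq_zero hu.sm hu.hom b h hy]) ht
  have hconst : ∀ t ∈ Set.Icc 0 π, u (flow (b 2) (b 0) t (b 2)) = u (b 2) := by
    have hc : ContinuousOn (fun t => u (flow (b 2) (b 0) t (b 2))) (Set.Icc 0 π) :=
      fun t _ => (hU t).continuousAt.continuousWithinAt
    have hd : DifferentiableOn ℝ (fun t => u (flow (b 2) (b 0) t (b 2)))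
        (interior (Set.Icc 0 π)) := fun t _ => (hU t).differentiableAt.differentiableWithinAt
    have h0 : ∀ t ∈ interior (Set.Icc 0 π),
        deriv (fun t => u (flow (b 2) (b 0) t (b 2))) t = 0 := fun t ht => by
      rw [interior_Icc] at ht
      rw [(hU t).deriv, hz t ht]
    intro t ht
    have hi := monotoneOn_of_deriv_nonneg (convex_Icc 0 π) hc hd (fun t ht => (h0 t ht).ge)
      ⟨le_rfl, pi_pos.le⟩ ht ht.1
    have hj := antitoneOn_of_deriv_nonpos (convex_Icc 0 π) hc hd (fun t ht => (h0 t ht).le)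
      ⟨le_rfl, pi_pos.le⟩ ht ht.1
    simp only [flow_zero] at hi hj
    exact le_antisymm hj hi
  have hb := abs_le.1 (abs_real_inner_le_norm x (b 2))
  rw [S2.norm hx, S2.norm hq, one_mul] at hb
  rw [← hconst (arccos ⟪x, b 2⟫) ⟨arccos_nonneg _, arccos_le_pi _⟩]
  refine h _ hx _ (flow_mem_S2 ho _ hq) ?_
  rw [real_inner_comm _ (flow _ _ _ _), inner_left_flow ho, ho.left, ho.inner', cos_arccos hb.1 hb.2]
  ring

theorem axiallySymmetric_of_umbilic {α : ℝ} {u : E3 → ℝ} (hu : MFE u α) (h1 : 2 < α) (h3 : α ≤ 3)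
    {p : E3} (hp : p ∈ S2) (hc : fderiv ℝ u p = 0) (hc' : fderiv ℝ u (-p) = 0)
    (hh : ∀ v v' : E3, ⟪v, p⟫ = 0 → ⟪v', p⟫ = 0 →
      iteratedFDeriv ℝ 2 u p ![v, v'] = iteratedFDeriv ℝ 2 u (-p) ![v, v']) :
    ∃ q ∈ S2, AxiallySymmetric u q := by
  obtain ⟨b, hb⟩ := exists_setup (Sol.of_MFE hu) h1 h3 hp hc hc' fun v v' hv hv' => by
    simpa [iteratedFDeriv_two_apply, D2] using hh v v' hv hv'
  exact hb.axiallySymmetric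

end MeanField

end

theorem stmt6 (α : ℝ) (hα1 : 2 < α) (hα2 : α ≤ 3) (u : E3 → ℝ) (hu : MFE u α)
    (p : E3) (hp : p ∈ S2) (hc1 : fderiv ℝ u p = 0) (hc2 : fderiv ℝ u (-p) = 0)
    (hhess : ∀ v v' : E3, ⟪v, p⟫ = 0 → ⟪v', p⟫ = 0 →
      iteratedFDeriv ℝ 2 u p ![v, v'] = iteratedFDeriv ℝ 2 u (-p) ![v, v']) :
    (∃ p' ∈ S2, AxiallySymmetric u p') ∧ (α = 3 → ∃ c : ℝ, ∀ x ∈ S2, u x = c) := by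
  obtain ⟨q, hq, h⟩ := MeanField.axiallySymmetric_of_umbilic hu hα1 hα2 hp hc1 hc2 hhess
  refine ⟨⟨q, hq, h⟩, ?_⟩
  rintro rfl
  exact ⟨u q, fun x hx => (MeanField.Sol.of_MFE hu).const_of_axiallySymmetric hq h hx⟩
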